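/- Let n ≥ 2, 0 ≤ q ≤ n, s, k positive integers with k ≥ 1, 0 < λ < 1, δ > 0, μ > 0, T > 0. Then there exist constants C₁, C₂ > 0 such that for all q-forms u', u'' ∈ C^{k,s(s,λ,δ)}_{T,Λ^q,D_{d⊕d*}}: ‖Ψ_{μ,q}N_q(u') − Ψ_{μ,q}N_q(u'')‖_{C^{k−1,s(s+1,λ,2δ−1)}_{T,Λ^q}} ≤ C₁ ‖u''‖_{C^{k,s(s,λ,δ)}_{T,Λ^q,D_{d⊕d*}}} ‖u'−u''‖_{C^{k,s(s,λ,δ)}_{T,Λ^q}} + C₂ ‖u'−u''‖²_{C^{k,s(s,λ,δ)}_{T,Λ^q}}. In particular, since N_q(u') − N_q(u'') = B_q(u'', u'−u'') + (1/2)B_q(u'−u'', u'−u''), the nonlinear map Ψ_{μ,q}N_q is locally Lipschitz from C^{k,s(s,λ,δ)}_{T,Λ^q,D_{d⊕d*}} into C^{k−1,s(s+1,λ,2δ−1)}_{T,Λ^q}. -/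

import Mathlib

open scoped BigOperators ENNReal Classical
open Filter MeasureTheory

noncomputable section

namespace NSdeRham

/-- Euclidean space `ℝⁿ`. -/
abbrev Spc (n : ℕ) := EuclideanSpace ℝ (Fin n)

variable {n : ℕ}

/-- The weight `w(x) = √(1+|x|²)`. -/
def wt (x : Spc n) : ℝ := Real.sqrt (1 + ‖x‖ ^ 2)

/-- `w(x,y) = max (w x) (w y)`. -/
def wt2 (x y : Spc n) : ℝ := max (wt x) (wt y)

/-- Partial derivative in the `i`-th coordinate direction. -/
def pd (i : Fin n) (f : Spc n → ℝ) (x : Spc n) : ℝ :=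
  fderiv ℝ f x (EuclideanSpace.single i 1)

/-- The Laplace operator `Δ = ∑ ∂²/∂xᵢ²`. -/
def lap (f : Spc n → ℝ) (x : Spc n) : ℝ := ∑ i : Fin n, pd i (pd i f) x

section enorms

variable {F : Type*} [NormedAddCommGroup F]

/-- Weighted sup-"norm" `sup_x w(x)^δ ‖g x‖` (with values in `ℝ≥0∞`). -/
def eWSup (δ : ℝ) (g : Spc n → F) : ℝ≥0∞ :=
  ⨆ x : Spc n, ENNReal.ofReal (wt x ^ δ * ‖g x‖)

/-- Weighted Hölder seminorm `⟨g⟩_{λ,δ}`. -/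
def eWHold (lam δ : ℝ) (g : Spc n → F) : ℝ≥0∞ :=
  ⨆ (x : Spc n) (y : Spc n) (_ : x ≠ y ∧ ‖x - y‖ ≤ ‖x‖ / 2),
    ENNReal.ofReal (wt2 x y ^ (δ + lam) * ‖g x - g y‖ / ‖x - y‖ ^ lam)

/-- The ordinary Hölder norm on the (closed) unit ball around the origin. -/
def eOHold (lam : ℝ) (g : Spc n → F) : ℝ≥0∞ :=
  (⨆ (x : Spc n) (_ : ‖x‖ ≤ 1), ENNReal.ofReal ‖g x‖) +
    ⨆ (x : Spc n) (y : Spc n) (_ : ‖x‖ ≤ 1 ∧ ‖y‖ ≤ 1 ∧ x ≠ y),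
      ENNReal.ofReal (‖g x - g y‖ / ‖x - y‖ ^ lam)

/-- The norm of `C^{0,λ,δ}`; for `λ = 0` this is just the weighted sup-norm. -/
def eHol0 (lam δ : ℝ) (g : Spc n → F) : ℝ≥0∞ :=
  if lam = 0 then eWSup δ g else eOHold lam g + eWSup δ g + eWHold lam δ g

/-- The norm of the base anisotropic space `C^{𝐬(0,λ,δ)}_T`. -/
def eAniso0 (T lam δ : ℝ) (v : ℝ → Spc n → F) : ℝ≥0∞ :=
  (⨆ t : Set.Icc (0 : ℝ) T, eHol0 lam δ (v t)) +
    if lam = 0 then 0 else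
      ⨆ (t₁ : Set.Icc (0 : ℝ) T) (t₂ : Set.Icc (0 : ℝ) T) (_ : (t₁ : ℝ) ≠ (t₂ : ℝ))
        (x : Spc n),
        ENNReal.ofReal (wt x ^ δ * ‖v t₁ x - v t₂ x‖ / |(t₁ : ℝ) - (t₂ : ℝ)| ^ (lam / 2))

end enorms

/-- The norm of the static weighted Hölder space `C^{s,λ,δ}`. -/
def eHolS (s : ℕ) (lam δ : ℝ) (g : Spc n → ℝ) : ℝ≥0∞ :=
  ∑ m ∈ Finset.range (s + 1), eHol0 lam (δ + m) (iteratedFDeriv ℝ m g)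

/-- Membership in the static weighted Hölder space `C^{s,λ,δ}`. -/
def HolSMem (s : ℕ) (lam δ : ℝ) (g : Spc n → ℝ) : Prop :=
  ContDiff ℝ s g ∧ eHolS s lam δ g ≠ ⊤

/-- Time derivative of order `j` (within `[0,T]`). -/
def tDeriv (T : ℝ) (j : ℕ) (u : ℝ → Spc n → ℝ) (t : ℝ) (x : Spc n) : ℝ :=
  iteratedDerivWithin j (fun τ => u τ x) (Set.Icc 0 T) t

/-- Mixed derivative `∂_x^m ∂_t^j`. -/
def mixDeriv (T : ℝ) (m j : ℕ) (u : ℝ → Spc n → ℝ) (t : ℝ) :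
    Spc n → ContinuousMultilinearMap ℝ (fun _ : Fin m => Spc n) ℝ :=
  iteratedFDeriv ℝ m (fun x => tDeriv T j u t x)

/-- The norm of the anisotropic weighted parabolic Hölder space `C^{k,𝐬(s,λ,δ)}_T`. -/
def eAnisoKS (T : ℝ) (k s : ℕ) (lam δ : ℝ) (u : ℝ → Spc n → ℝ) : ℝ≥0∞ :=
  ∑ b ∈ Finset.range (k + 1), ∑ m ∈ Finset.range (2 * s + 1), ∑ j ∈ Finset.range (s + 1),
    if m + 2 * j ≤ 2 * s then eAniso0 T lam (δ + b + m) (mixDeriv T (b + m) j u) else 0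

/-- Regularity required of members of `C^{k,𝐬(s,λ,δ)}_T`. -/
def AnisoReg (T : ℝ) (k s : ℕ) (u : ℝ → Spc n → ℝ) : Prop :=
  (∀ x : Spc n, ContDiffOn ℝ s (fun t => u t x) (Set.Icc 0 T)) ∧
  (∀ j : ℕ, j ≤ s → ∀ t ∈ Set.Icc (0 : ℝ) T,
    ContDiff ℝ (2 * (s - j) + k) (fun x => tDeriv T j u t x)) ∧
  (∀ j m : ℕ, j ≤ s → m + 2 * j ≤ 2 * s + k →
    Continuous fun p : Set.Icc (0 : ℝ) T × Spc n => mixDeriv T m j u p.1 p.2)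

/-- Membership in `C^{k,𝐬(s,λ,δ)}_T`. -/
def AnisoMem (T : ℝ) (k s : ℕ) (lam δ : ℝ) (u : ℝ → Spc n → ℝ) : Prop :=
  AnisoReg T k s u ∧ eAnisoKS T k s lam δ u ≠ ⊤

/-- The norm of `𝓕^{k,𝐬(s,λ,λ',δ)}_T = C^{k+1,𝐬(s,λ,δ)}_T ∩ C^{k,𝐬(s,λ',δ)}_T`. -/
def eFn (T : ℝ) (k s : ℕ) (lam lam' δ : ℝ) (u : ℝ → Spc n → ℝ) : ℝ≥0∞ :=
  eAnisoKS T (k + 1) s lam δ u + eAnisoKS T k s lam' δ u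

/-- Membership in `𝓕^{k,𝐬(s,λ,λ',δ)}_T`. -/
def FMem (T : ℝ) (k s : ℕ) (lam lam' δ : ℝ) (u : ℝ → Spc n → ℝ) : Prop :=
  AnisoReg T (k + 1) s u ∧ eFn T k s lam lam' δ u ≠ ⊤

/-- Index set of a basis of `Λ^q`. -/
abbrev Idx (n q : ℕ) := {I : Finset (Fin n) // I.card = q}

/-- Static differential `q`-forms: coefficient functions. -/
abbrev FormS (n q : ℕ) := Idx n q → Spc n → ℝ

/-- Time-dependent differential `q`-forms. -/
abbrev FormT (n q : ℕ) := Idx n q → ℝ → Spc n → ℝ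

/-- Fibre of the bundle `Λ^q`. -/
abbrev Fib (n q : ℕ) := Idx n q → ℝ

/-- The exterior derivative `d_q` on static `q`-forms. -/
def dS {q : ℕ} (u : FormS n q) : FormS n (q + 1) := fun J x =>
  ∑ i : Fin n,
    if h : i ∈ J.1 then
      (-1 : ℝ) ^ (J.1.filter fun j => j < i).card *
        pd i (u ⟨J.1.erase i, by simp [Finset.card_erase_of_mem h, J.2]⟩) x
    else 0

/-- The exterior derivative `d_{q-1}` mapping `(q-1)`-forms to `q`-forms. -/
def dLowS {q : ℕ} (p : FormS n (q - 1)) : FormS n q := fun J x =>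
  ∑ i : Fin n,
    if h : i ∈ J.1 ∧ (J.1.erase i).card = q - 1 then
      (-1 : ℝ) ^ (J.1.filter fun j => j < i).card * pd i (p ⟨J.1.erase i, h.2⟩) x
    else 0

/-- The formal adjoint `d_{q-1}^*` mapping `q`-forms to `(q-1)`-forms. -/
def coDS {q : ℕ} (u : FormS n q) : FormS n (q - 1) := fun K x =>
  -∑ i : Fin n,
    if h : i ∉ K.1 ∧ (insert i K.1).card = q then
      (-1 : ℝ) ^ (K.1.filter fun j => j < i).card * pd i (u ⟨insert i K.1, h.2⟩) x
    else 0

/-- `d_q` on time-dependent forms. -/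
def dT {q : ℕ} (u : FormT n q) : FormT n (q + 1) := fun J t => dS (fun I => u I t) J

/-- `d_{q-1}` on time-dependent forms. -/
def dLowT {q : ℕ} (p : FormT n (q - 1)) : FormT n q := fun J t => dLowS (fun I => p I t) J

/-- `d_{q-1}^*` on time-dependent forms. -/
def coDT {q : ℕ} (u : FormT n q) : FormT n (q - 1) := fun K t => coDS (fun I => u I t) K

/-- Norm of `C^{k,𝐬(s,λ,δ)}_{T,Λ^q}`. -/
def eAnisoKSF {q : ℕ} (T : ℝ) (k s : ℕ) (lam δ : ℝ) (u : FormT n q) : ℝ≥0∞ :=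
  ∑ I : Idx n q, eAnisoKS T k s lam δ (u I)

/-- Membership in `C^{k,𝐬(s,λ,δ)}_{T,Λ^q}`. -/
def CMemF {q : ℕ} (T : ℝ) (k s : ℕ) (lam δ : ℝ) (u : FormT n q) : Prop :=
  (∀ I, AnisoReg T k s (u I)) ∧ eAnisoKSF T k s lam δ u ≠ ⊤

/-- Graph norm of `C^{k,𝐬(s,λ,δ)}_{T,Λ^q,𝒟_{d⊕d*}}`. -/
def eCD {q : ℕ} (T : ℝ) (k s : ℕ) (lam δ : ℝ) (u : FormT n q) : ℝ≥0∞ :=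
  eAnisoKSF T k s lam δ u + eAnisoKSF T k s lam (δ + 1) (dT u) +
    eAnisoKSF T k s lam (δ + 1) (coDT u)

/-- Membership in `C^{k,𝐬(s,λ,δ)}_{T,Λ^q,𝒟_{d⊕d*}}`. -/
def CMemD {q : ℕ} (T : ℝ) (k s : ℕ) (lam δ : ℝ) (u : FormT n q) : Prop :=
  CMemF T k s lam δ u ∧ CMemF T k s lam (δ + 1) (dT u) ∧ CMemF T k s lam (δ + 1) (coDT u)

/-- Norm of `𝓕^{k,𝐬(s,λ,λ',δ)}_{T,Λ^q}`. -/
def eFF {q : ℕ} (T : ℝ) (k s : ℕ) (lam lam' δ : ℝ) (u : FormT n q) : ℝ≥0∞ :=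
  ∑ I : Idx n q, eFn T k s lam lam' δ (u I)

/-- Membership in `𝓕^{k,𝐬(s,λ,λ',δ)}_{T,Λ^q}`. -/
def FMemF {q : ℕ} (T : ℝ) (k s : ℕ) (lam lam' δ : ℝ) (u : FormT n q) : Prop :=
  (∀ I, AnisoReg T (k + 1) s (u I)) ∧ eFF T k s lam lam' δ u ≠ ⊤

/-- Graph norm of `𝓕^{k,𝐬(s,λ,λ',δ)}_{T,Λ^q,𝒟_{d⊕d*}}`. -/
def eFD {q : ℕ} (T : ℝ) (k s : ℕ) (lam lam' δ : ℝ) (u : FormT n q) : ℝ≥0∞ :=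
  eFF T k s lam lam' δ u + eFF T k s lam lam' (δ + 1) (dT u) +
    eFF T k s lam lam' (δ + 1) (coDT u)

/-- Membership in `𝓕^{k,𝐬(s,λ,λ',δ)}_{T,Λ^q,𝒟_{d⊕d*}}`. -/
def FMemD {q : ℕ} (T : ℝ) (k s : ℕ) (lam lam' δ : ℝ) (u : FormT n q) : Prop :=
  FMemF T k s lam lam' δ u ∧ FMemF T k s lam lam' (δ + 1) (dT u) ∧
    FMemF T k s lam lam' (δ + 1) (coDT u)

/-- Norm of the static space `C^{s,λ,δ}_{Λ^q}`. -/
def eHolSF {q : ℕ} (s : ℕ) (lam δ : ℝ) (g : FormS n q) : ℝ≥0∞ :=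
  ∑ I : Idx n q, eHolS s lam δ (g I)

/-- Membership in the static space `C^{s,λ,δ}_{Λ^q}`. -/
def HolMemF {q : ℕ} (s : ℕ) (lam δ : ℝ) (g : FormS n q) : Prop :=
  (∀ I, ContDiff ℝ s (g I)) ∧ eHolSF s lam δ g ≠ ⊤

/-- Equality of time-dependent forms on `ℝⁿ × [0,T]`. -/
def EqOnT {q : ℕ} (T : ℝ) (u v : FormT n q) : Prop :=
  ∀ I, ∀ t ∈ Set.Icc (0 : ℝ) T, ∀ x, u I t x = v I t x

/-- The form `u` is co-closed (`d^* u = 0`) on `ℝⁿ × [0,T]`. -/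
def CoClosed {q : ℕ} (T : ℝ) (u : FormT n q) : Prop :=
  ∀ K, ∀ t ∈ Set.Icc (0 : ℝ) T, ∀ x, coDT u K t x = 0

/-- Type of the bilinear zero order operator `M₁^{(q)}`. -/
abbrev M1Type (n q : ℕ) := (Fib n (q + 1) × Fib n (q - 1)) →ₗ[ℝ] Fib n q →ₗ[ℝ] Fib n q

/-- Type of the bilinear zero order operator `M₂^{(q)}`. -/
abbrev M2Type (n q : ℕ) := Fib n q →ₗ[ℝ] Fib n q →ₗ[ℝ] Fib n (q - 1)

/-- Value of a time-dependent form at a point, as an element of the fibre. -/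
def fib {q : ℕ} (u : FormT n q) (t : ℝ) (x : Spc n) : Fib n q := fun I => u I t x

/-- Value of `(d_q ⊕ d_{q-1}^*) u` at a point. -/
def ddFib {q : ℕ} (u : FormT n q) (t : ℝ) (x : Spc n) : Fib n (q + 1) × Fib n (q - 1) :=
  (fun J => dT u J t x, fun K => coDT u K t x)

/-- The operator `W_q u = M₁((d⊕d^*)u, w) + M₁((d⊕d^*)w, u)`. -/
def Wop {q : ℕ} (M₁ : M1Type n q) (w u : FormT n q) : FormT n q := fun I t x =>
  M₁ (ddFib u t x) (fib w t x) I + M₁ (ddFib w t x) (fib u t x) I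

/-- The symmetric bilinearization `B_q(w,u)` of the nonlinearity. -/
def Bop {q : ℕ} (M₁ : M1Type n q) (M₂ : M2Type n q) (w u : FormT n q) : FormT n q :=
  fun I t x =>
    Wop M₁ w u I t x +
      dLowT (fun K t' x' =>
        M₂ (fib u t' x') (fib w t' x') K + M₂ (fib w t' x') (fib u t' x') K) I t x

/-- The nonlinearity `𝒩_q u = M₁((d⊕d^*)u, u) + d_{q-1} M₂(u,u)`. -/
def Nop {q : ℕ} (M₁ : M1Type n q) (M₂ : M2Type n q) (u : FormT n q) : FormT n q :=
  fun I t x =>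
    M₁ (ddFib u t x) (fib u t x) I +
      dLowT (fun K t' x' => M₂ (fib u t' x') (fib u t' x') K) I t x

/-- Fundamental solution of the heat operator `∂_t - μΔ`. -/
def heatKer (μ : ℝ) (x : Spc n) (t : ℝ) : ℝ :=
  if 0 < t then (4 * Real.pi * μ * t) ^ (-(n : ℝ) / 2) * Real.exp (-‖x‖ ^ 2 / (4 * μ * t))
  else 0

/-- Volume heat potential `Ψ_μ`. -/
def volPot (μ : ℝ) (f : ℝ → Spc n → ℝ) (t : ℝ) (x : Spc n) : ℝ :=
  ∫ τ in Set.Ioc (0 : ℝ) t, ∫ y : Spc n, heatKer μ (x - y) (t - τ) * f τ y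

/-- Poisson heat potential `Ψ_{μ,0}`. -/
def poisPot (μ : ℝ) (g : Spc n → ℝ) (t : ℝ) (x : Spc n) : ℝ :=
  ∫ y : Spc n, heatKer μ (x - y) t * g y

/-- Volume heat potential acting coefficient-wise on forms. -/
def volPotF {q : ℕ} (μ : ℝ) (f : FormT n q) : FormT n q := fun I => volPot μ (f I)

/-- Poisson heat potential acting coefficient-wise on forms. -/
def poisPotF {q : ℕ} (μ : ℝ) (g : FormS n q) : FormT n q := fun I => poisPot μ (g I)

/-- Area of the unit sphere in `ℝⁿ`. -/
def sphArea (n : ℕ) : ℝ := 2 * Real.pi ^ ((n : ℝ) / 2) / Real.Gamma ((n : ℝ) / 2)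

/-- Standard fundamental solution of the Laplace operator in `ℝⁿ`. -/
def lapKer (n : ℕ) (x : Spc n) : ℝ :=
  if n = 2 then (1 / Real.pi) * Real.log ‖x‖
  else ‖x‖ ^ (2 - (n : ℝ)) / (sphArea n * (2 - (n : ℝ)))

/-- Newtonian potential. -/
def newtPot (f : Spc n → ℝ) (x : Spc n) : ℝ := ∫ y : Spc n, lapKer n (x - y) * f y

/-- The integral operator `Φ_q` mapping `(q+1)`-forms to `q`-forms;
concretely `Φ_q f = -d^* (e * f)`. -/
def PhiOp {q : ℕ} (f : FormT n (q + 1)) : FormT n q := fun K t x =>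
  -coDS (n := n) (q := q + 1) (fun J y => newtPot (fun z => f J t z) y) K x

/-- Squared `L²` norm of a form at time `t`. -/
def l2Sq {q : ℕ} (u : FormT n q) (t : ℝ) : ℝ :=
  ∑ I : Idx n q, ∫ x : Spc n, (u I t x) ^ 2

/-- Squared `L²` norm of the spatial gradient of a form at time `t`. -/
def gradSq {q : ℕ} (u : FormT n q) (t : ℝ) : ℝ :=
  ∑ I : Idx n q, ∑ i : Fin n, ∫ x : Spc n, (pd i (fun y => u I t y) x) ^ 2

/-- The norm of `C^{0,𝐬(0,0,δ)}_{T,Λ^q}` (weighted sup-norm). -/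
def eSupT {q : ℕ} (T δ : ℝ) (u : FormT n q) : ℝ≥0∞ :=
  ∑ I : Idx n q,
    ⨆ (t : Set.Icc (0 : ℝ) T) (x : Spc n), ENNReal.ofReal (wt x ^ δ * |u I t x|)

/-- The norm `‖∇u‖_{C^{0,𝐬(0,0,δ)}_{T}}` of the spatial gradient. -/
def eSupGradT {q : ℕ} (T δ : ℝ) (u : FormT n q) : ℝ≥0∞ :=
  ∑ I : Idx n q, ∑ i : Fin n,
    ⨆ (t : Set.Icc (0 : ℝ) T) (x : Spc n),
      ENNReal.ofReal (wt x ^ δ * |pd i (fun y => u I t y) x|)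

/-- `q`-form with coefficients harmonic polynomials of degree at most `m`. -/
def HarmPolyForm {q : ℕ} (m : ℕ) (h : FormS n q) : Prop :=
  ∀ I, (∃ P : MvPolynomial (Fin n) ℝ, P.totalDegree ≤ m ∧
      ∀ x : Spc n, h I x = MvPolynomial.eval (fun i => x i) P) ∧
    ∀ x : Spc n, lap (h I) x = 0

/-- Classical solution of the Cauchy problem
`∂_t u - μ Δ u + extra = f` on `ℝⁿ × (0,T)`, `u(·,0) = u₀`. -/
def CauchySol {q : ℕ} (T μ : ℝ) (u extra f : FormT n q) (u₀ : FormS n q) : Prop :=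
  (∀ I, ∀ t ∈ Set.Ioo (0 : ℝ) T, ∀ x,
    deriv (fun τ => u I τ x) t - μ * lap (fun y => u I t y) x + extra I t x = f I t x) ∧
  ∀ I x, u I 0 x = u₀ I x

/-- `Ψ_{μ,q} 𝒩_q u`. -/
def NopPot {q : ℕ} (μ : ℝ) (M₁ : M1Type n q) (M₂ : M2Type n q) (u : FormT n q) : FormT n q :=
  volPotF μ (Nop M₁ M₂ u)

/-- `u + Ψ_{μ,q} 𝒩_q u`. -/
def TmapN {q : ℕ} (μ : ℝ) (M₁ : M1Type n q) (M₂ : M2Type n q) (u : FormT n q) : FormT n q :=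
  u + NopPot μ M₁ M₂ u

/-- The linearization `u + Ψ_{μ,q} B_q(v,u)`. -/
def LmapB {q : ℕ} (μ : ℝ) (M₁ : M1Type n q) (M₂ : M2Type n q) (v u : FormT n q) :
    FormT n q :=
  u + volPotF μ (Bop M₁ M₂ v u)

/-- `Φ_q d_q Ψ_{μ,q} 𝒩_q u`. -/
def PhiNpot {q : ℕ} (μ : ℝ) (M₁ : M1Type n q) (M₂ : M2Type n q) (u : FormT n q) :
    FormT n q :=
  PhiOp (dT (volPotF μ (Nop M₁ M₂ u)))

/-- `u + Φ_q d_q Ψ_{μ,q} 𝒩_q u`. -/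
def PhiNmap {q : ℕ} (μ : ℝ) (M₁ : M1Type n q) (M₂ : M2Type n q) (u : FormT n q) :
    FormT n q :=
  u + PhiNpot μ M₁ M₂ u

/-- The linearization `u + Φ_q d_q Ψ_{μ,q} B_q(v,u)`. -/
def PhiLmap {q : ℕ} (μ : ℝ) (M₁ : M1Type n q) (M₂ : M2Type n q) (v u : FormT n q) :
    FormT n q :=
  u + PhiOp (dT (volPotF μ (Bop M₁ M₂ v u)))

section

/-! ### Elementary properties of the weight -/

lemma one_le_wt (x : Spc n) : 1 ≤ wt x := by
  unfold wt
  rw [Real.one_le_sqrt]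
  nlinarith [sq_nonneg ‖x‖]

lemma wt_pos (x : Spc n) : 0 < wt x := lt_of_lt_of_le one_pos (one_le_wt x)

lemma wt_sq (x : Spc n) : wt x ^ 2 = 1 + ‖x‖ ^ 2 := by
  unfold wt
  rw [Real.sq_sqrt]
  positivity

lemma norm_le_wt (x : Spc n) : ‖x‖ ≤ wt x :=
  (le_abs_self _).trans (abs_le_of_sq_le_sq (by rw [wt_sq]; linarith) (wt_pos x).le)

lemma wt_zero : wt (0 : Spc n) = 1 := by simp [wt]

lemma wt_le_wt_add (x y : Spc n) : wt y ≤ wt x + ‖x - y‖ := by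
  have h1 : ‖y‖ ≤ ‖x‖ + ‖x - y‖ := by
    have := norm_sub_norm_le y x
    rw [norm_sub_rev] at this
    linarith
  have h2 := norm_le_wt x
  refine (le_abs_self _).trans (abs_le_of_sq_le_sq ?_ (by have := wt_pos x; positivity))
  nlinarith [wt_sq x, wt_sq y, norm_nonneg y, norm_nonneg x, norm_nonneg (x - y),
    mul_le_mul_of_nonneg_right h2 (norm_nonneg (x - y))]

lemma wt_le_wt_mul (x y : Spc n) : wt y ≤ wt x * (1 + ‖x - y‖) := by
  nlinarith [wt_le_wt_add x y, one_le_wt x, norm_nonneg (x - y)]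

lemma rpow_le_rpow_mul_abs {a b c e : ℝ} (ha : 0 < a) (hb : 0 < b) (hc : 1 ≤ c)
    (hab : a ≤ b * c) (hba : b ≤ a * c) : a ^ e ≤ b ^ e * c ^ |e| := by
  have hc0 : 0 < c := by linarith
  rcases le_total 0 e with he | he
  · rw [abs_of_nonneg he, ← Real.mul_rpow hb.le hc0.le]
    exact Real.rpow_le_rpow ha.le hab he
  · rw [abs_of_nonpos he]
    have h : b ^ (-e) ≤ (a * c) ^ (-e) := Real.rpow_le_rpow hb.le hba (by linarith)
    rw [Real.mul_rpow ha.le hc0.le] at h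
    have h1 : a ^ e * a ^ (-e) = 1 := by rw [← Real.rpow_add ha]; simp
    have h2 : b ^ e * b ^ (-e) = 1 := by rw [← Real.rpow_add hb]; simp
    have h3 : 0 < a ^ e := Real.rpow_pos_of_pos ha e
    have h4 : 0 < b ^ e := Real.rpow_pos_of_pos hb e
    calc a ^ e = (a ^ e * b ^ e) * b ^ (-e) := by rw [mul_assoc, h2, mul_one]
      _ ≤ (a ^ e * b ^ e) * (a ^ (-e) * c ^ (-e)) := by gcongr
      _ = (a ^ e * a ^ (-e)) * (b ^ e * c ^ (-e)) := by ring
      _ = _ := by rw [h1, one_mul]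

/-- Peetre-type inequality for the weight. -/
lemma wt_rpow_le (e : ℝ) (x y : Spc n) : wt y ^ e ≤ wt x ^ e * (1 + ‖x - y‖) ^ |e| :=
  rpow_le_rpow_mul_abs (wt_pos y) (wt_pos x) (by linarith [norm_nonneg (x - y)])
    (wt_le_wt_mul x y) (by simpa [norm_sub_rev] using wt_le_wt_mul y x)

lemma wt_rpow_pos (e : ℝ) (x : Spc n) : 0 < wt x ^ e := Real.rpow_pos_of_pos (wt_pos x) e

lemma wt_rpow_mono {e e' : ℝ} (h : e ≤ e') (x : Spc n) : wt x ^ e ≤ wt x ^ e' :=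
  Real.rpow_le_rpow_of_exponent_le (one_le_wt x) h

/-- Pairs of points at which the weights are comparable. -/
def Near (x y : Spc n) : Prop := ‖x - y‖ ≤ 1 ∨ ‖x - y‖ ≤ ‖x‖ / 2

lemma Near.wt_le {x y : Spc n} (h : Near x y) : wt y ≤ wt x * 2 := by
  have := wt_le_wt_add x y
  have h1 := one_le_wt x
  have h2 := norm_le_wt x
  rcases h with h | h <;> linarith [norm_nonneg x]

lemma Near.le_wt {x y : Spc n} (h : Near x y) : wt x ≤ wt y * 2 := by
  have := wt_le_wt_add y x
  rw [norm_sub_rev] at this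
  have h1 := one_le_wt y
  have h2 := norm_le_wt x
  rcases h with h | h <;> linarith [norm_nonneg x]

lemma Near.wt_rpow_le {x y : Spc n} (h : Near x y) (e : ℝ) :
    wt y ^ e ≤ wt x ^ e * 2 ^ |e| :=
  rpow_le_rpow_mul_abs (wt_pos y) (wt_pos x) one_le_two h.wt_le h.le_wt

/-! ### Weighted Hölder bounds with explicit constants -/

section HB

variable {F : Type*} [NormedAddCommGroup F]

/-- The weighted parabolic Hölder bounds of `C^{𝐬(0,λ,δ)}_T` with constant `K`. -/
structure HB (T lam δ : ℝ) (v : ℝ → Spc n → F) (K : ℝ) : Prop where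
  nonneg : 0 ≤ K
  sup : ∀ t ∈ Set.Icc (0 : ℝ) T, ∀ x, ‖v t x‖ ≤ K * wt x ^ (-δ)
  space : ∀ t ∈ Set.Icc (0 : ℝ) T, ∀ x y, Near x y →
    ‖v t x - v t y‖ ≤ K * wt x ^ (-(δ + lam)) * ‖x - y‖ ^ lam
  time : ∀ t₁ ∈ Set.Icc (0 : ℝ) T, ∀ t₂ ∈ Set.Icc (0 : ℝ) T, ∀ x,
    ‖v t₁ x - v t₂ x‖ ≤ K * wt x ^ (-δ) * |t₁ - t₂| ^ (lam / 2)

variable {T lam δ δ' K K' : ℝ} {v v' : ℝ → Spc n → F}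

lemma HB.mono (h : HB T lam δ v K) (hδ : δ' ≤ δ) (hK : K ≤ K') : HB T lam δ' v K' := by
  have h0 := h.nonneg
  refine ⟨h0.trans hK, fun t ht x => (h.sup t ht x).trans ?_,
    fun t ht x y hxy => (h.space t ht x y hxy).trans ?_,
    fun t₁ h₁ t₂ h₂ x => (h.time t₁ h₁ t₂ h₂ x).trans ?_⟩
  · exact mul_le_mul hK (wt_rpow_mono (by linarith) x) (wt_rpow_pos _ x).le (h0.trans hK)
  · gcongr
    · exact (wt_rpow_pos _ x).le
    · exact h0.trans hK
    · exact one_le_wt x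
  · gcongr
    · exact (wt_rpow_pos _ x).le
    · exact h0.trans hK
    · exact one_le_wt x

lemma HB.congr (h : HB T lam δ v K) (hv : ∀ t ∈ Set.Icc (0 : ℝ) T, ∀ x, v t x = v' t x) :
    HB T lam δ v' K := by
  refine ⟨h.nonneg, fun t ht x => ?_, fun t ht x y hxy => ?_, fun t₁ h₁ t₂ h₂ x => ?_⟩
  · rw [← hv t ht]; exact h.sup t ht x
  · rw [← hv t ht, ← hv t ht]; exact h.space t ht x y hxy
  · rw [← hv t₁ h₁, ← hv t₂ h₂]; exact h.time t₁ h₁ t₂ h₂ x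

lemma HB.zero : HB T lam δ (0 : ℝ → Spc n → F) 0 := by
  constructor <;> intros <;> simp

lemma HB.add (h : HB T lam δ v K) (h' : HB T lam δ v' K') :
    HB T lam δ (v + v') (K + K') := by
  refine ⟨add_nonneg h.nonneg h'.nonneg, fun t ht x => ?_, fun t ht x y hxy => ?_,
    fun t₁ h₁ t₂ h₂ x => ?_⟩
  · rw [add_mul]
    exact (norm_add_le _ _).trans (add_le_add (h.sup t ht x) (h'.sup t ht x))
  · rw [add_mul, add_mul]
    have : (v + v') t x - (v + v') t y = (v t x - v t y) + (v' t x - v' t y) := by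
      simp only [Pi.add_apply]; abel
    rw [this]
    exact (norm_add_le _ _).trans (add_le_add (h.space t ht x y hxy) (h'.space t ht x y hxy))
  · rw [add_mul, add_mul]
    have : (v + v') t₁ x - (v + v') t₂ x = (v t₁ x - v t₂ x) + (v' t₁ x - v' t₂ x) := by
      simp only [Pi.add_apply]; abel
    rw [this]
    exact (norm_add_le _ _).trans
      (add_le_add (h.time t₁ h₁ t₂ h₂ x) (h'.time t₁ h₁ t₂ h₂ x))

/-- Pointwise norm domination by finitely many scalar functions transfers Hölder bounds. -/
lemma HB.of_components {ι : Type*} [Fintype ι] {w : ι → ℝ → Spc n → ℝ}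
    (h : ∀ i, HB T lam δ (w i) K) (hK : 0 ≤ K)
    (h1 : ∀ t ∈ Set.Icc (0 : ℝ) T, ∀ x, ‖v t x‖ ≤ ∑ i, |w i t x|)
    (h2 : ∀ t₁ ∈ Set.Icc (0 : ℝ) T, ∀ t₂ ∈ Set.Icc (0 : ℝ) T, ∀ x y,
      ‖v t₁ x - v t₂ y‖ ≤ ∑ i, |w i t₁ x - w i t₂ y|) :
    HB T lam δ v (Fintype.card ι * K) := by
  refine ⟨by positivity, fun t ht x => (h1 t ht x).trans ?_,
    fun t ht x y hxy => (h2 t ht t ht x y).trans ?_,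
    fun t₁ h₁ t₂ h₂ x => (h2 t₁ h₁ t₂ h₂ x x).trans ?_⟩
  · refine (Finset.sum_le_card_nsmul _ _ _ fun i _ => (h i).sup t ht x).trans ?_
    rw [nsmul_eq_mul, Finset.card_univ, mul_assoc]
  · refine (Finset.sum_le_card_nsmul _ _ _ fun i _ => (h i).space t ht x y hxy).trans ?_
    rw [nsmul_eq_mul, Finset.card_univ, mul_assoc, mul_assoc, mul_assoc]
  · refine (Finset.sum_le_card_nsmul _ _ _ fun i _ => (h i).time t₁ h₁ t₂ h₂ x).trans ?_
    rw [nsmul_eq_mul, Finset.card_univ, mul_assoc, mul_assoc, mul_assoc]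

lemma HB.of_norm_le {F' : Type*} [NormedAddCommGroup F'] {w : ℝ → Spc n → F'}
    (h : HB T lam δ v K)
    (h1 : ∀ t ∈ Set.Icc (0 : ℝ) T, ∀ x, ‖w t x‖ ≤ ‖v t x‖)
    (h2 : ∀ t₁ ∈ Set.Icc (0 : ℝ) T, ∀ t₂ ∈ Set.Icc (0 : ℝ) T, ∀ x y,
      ‖w t₁ x - w t₂ y‖ ≤ ‖v t₁ x - v t₂ y‖) : HB T lam δ w K :=
  ⟨h.nonneg, fun t ht x => (h1 t ht x).trans (h.sup t ht x),
    fun t ht x y hxy => (h2 t ht t ht x y).trans (h.space t ht x y hxy),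
    fun t₁ h₁ t₂ h₂ x => (h2 t₁ h₁ t₂ h₂ x x).trans (h.time t₁ h₁ t₂ h₂ x)⟩

/-- Hölder bounds imply joint continuity. -/
lemma HB.continuousOn (hl : 0 < lam) (h : HB T lam δ v K) :
    ContinuousOn (fun p : ℝ × Spc n => v p.1 p.2) (Set.Icc 0 T ×ˢ Set.univ) := by
  rintro ⟨t, x⟩ ⟨ht, -⟩
  rw [ContinuousWithinAt, tendsto_iff_norm_sub_tendsto_zero]
  have key : Tendsto (fun p : ℝ × Spc n =>
      K * wt x ^ (-(δ + lam)) * ‖x - p.2‖ ^ lam * 1 +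
        K * wt x ^ (-δ) * |p.1 - t| ^ (lam / 2))
      (nhdsWithin (t, x) (Set.Icc 0 T ×ˢ Set.univ)) (nhds 0) := by
    have : Continuous (fun p : ℝ × Spc n =>
      K * wt x ^ (-(δ + lam)) * ‖x - p.2‖ ^ lam * 1 +
        K * wt x ^ (-δ) * |p.1 - t| ^ (lam / 2)) := by
      have h1 : Continuous fun p : ℝ × Spc n => ‖x - p.2‖ ^ lam :=
        (by fun_prop : Continuous fun p : ℝ × Spc n => ‖x - p.2‖).rpow_const fun _ => Or.inr hl.le
      have h2 : Continuous fun p : ℝ × Spc n => |p.1 - t| ^ (lam / 2) :=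
        (by fun_prop : Continuous fun p : ℝ × Spc n => |p.1 - t|).rpow_const
          fun _ => Or.inr (by positivity)
      fun_prop
    have h3 := (this.tendsto (t, x)).mono_left
      (nhdsWithin_le_nhds (s := Set.Icc 0 T ×ˢ Set.univ))
    simpa [Real.zero_rpow hl.ne', Real.zero_rpow (half_pos hl).ne'] using h3
  refine squeeze_zero' (Eventually.of_forall fun _ => norm_nonneg _) ?_ key
  have hball : ∀ᶠ p : ℝ × Spc n in nhdsWithin (t, x) (Set.Icc 0 T ×ˢ Set.univ),
      ‖x - p.2‖ < 1 := by
    refine nhdsWithin_le_nhds ?_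
    have : Continuous fun p : ℝ × Spc n => ‖x - p.2‖ := by fun_prop
    exact this.tendsto (t, x) |>.eventually (gt_mem_nhds (by simp))
  filter_upwards [hball, self_mem_nhdsWithin] with p hp hpm
  have e : v p.1 p.2 - v t x = -(v p.1 x - v p.1 p.2) + (v p.1 x - v t x) := by abel
  rw [e]
  refine (norm_add_le _ _).trans (add_le_add ?_ (h.time _ hpm.1 _ ht x))
  rw [norm_neg, mul_one]
  exact h.space _ hpm.1 _ _ (Or.inl hp.le)

lemma HB.eAniso0_le (hl : 0 < lam) (h : HB T lam δ v K) :
    eAniso0 T lam δ v ≤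
      ENNReal.ofReal ((2 ^ |δ| + (2 ^ |δ + lam| + 2 * 2 ^ |δ|) + 1 + 2 ^ |δ + lam| + 1) * K) := by
  have hK := h.nonneg
  have hunit : ∀ (e : ℝ) (x : Spc n), ‖x‖ ≤ 1 → wt x ^ e ≤ 2 ^ |e| := by
    intro e x hx
    have := wt_rpow_le e 0 x
    rw [wt_zero, Real.one_rpow, one_mul, zero_sub, norm_neg] at this
    exact this.trans (Real.rpow_le_rpow (by positivity) (by linarith) (abs_nonneg e))
  have hsup1 : ∀ t ∈ Set.Icc (0 : ℝ) T, ∀ x : Spc n, ‖x‖ ≤ 1 → ‖v t x‖ ≤ 2 ^ |δ| * K := by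
    intro t ht x hx
    refine (h.sup t ht x).trans ?_
    rw [mul_comm]
    gcongr
    simpa using hunit (-δ) x hx
  have p1 : (0 : ℝ) < 2 ^ |δ| := by positivity
  have p2 : (0 : ℝ) < 2 ^ |δ + lam| := by positivity
  have hne := hl.ne'
  rw [show (2 ^ |δ| + (2 ^ |δ + lam| + 2 * 2 ^ |δ|) + 1 + 2 ^ |δ + lam| + 1) * K =
    ((2 ^ |δ| * K + (2 ^ |δ + lam| + 2 * 2 ^ |δ|) * K) + 1 * K + 2 ^ |δ + lam| * K) + 1 * K
    from by ring]
  rw [ENNReal.ofReal_add (by positivity) (by positivity),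
    ENNReal.ofReal_add (by positivity) (by positivity),
    ENNReal.ofReal_add (by positivity) (by positivity),
    ENNReal.ofReal_add (by positivity) (by positivity)]
  unfold eAniso0
  rw [if_neg hne]
  refine add_le_add (iSup_le fun t => ?_) ?_
  · have ht := t.2
    unfold eHol0
    rw [if_neg hne]
    refine add_le_add (add_le_add ?_ ?_) ?_
    · refine add_le_add ?_ ?_
      · exact iSup₂_le fun x hx => ENNReal.ofReal_le_ofReal (hsup1 t ht x hx)
      · refine iSup_le fun x => iSup_le fun y => iSup_le fun hxy => ENNReal.ofReal_le_ofReal ?_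
        obtain ⟨hx, hy, hne⟩ := hxy
        have hpos : 0 < ‖x - y‖ := norm_pos_iff.2 (sub_ne_zero.2 hne)
        rw [div_le_iff₀ (Real.rpow_pos_of_pos hpos _)]
        rcases le_or_gt ‖x - y‖ 1 with h1 | h1
        · refine (h.space t ht x y (Or.inl h1)).trans ?_
          have := hunit (-(δ + lam)) x hx
          rw [abs_neg] at this
          have h3 : K * wt x ^ (-(δ + lam)) ≤ (2 ^ |δ + lam| + 2 * 2 ^ |δ|) * K := by
            nlinarith
          gcongr
        · have h3 : (1 : ℝ) ≤ ‖x - y‖ ^ lam := Real.one_le_rpow h1.le hl.le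
          have h4 : ‖v t x - v t y‖ ≤ 2 * 2 ^ |δ| * K := by
            refine (norm_sub_le _ _).trans ?_
            linarith [hsup1 t ht x hx, hsup1 t ht y hy]
          have h5 : 0 ≤ 2 ^ |δ + lam| * K := by positivity
          have h6 : 0 ≤ 2 * 2 ^ |δ| * K := by positivity
          nlinarith
    · refine iSup_le fun x => ENNReal.ofReal_le_ofReal ?_
      have := h.sup t ht x
      rw [Real.rpow_neg (wt_pos x).le, ← div_eq_mul_inv, le_div_iff₀ (wt_rpow_pos _ _)] at this
      linarith
    · refine iSup_le fun x => iSup_le fun y => iSup_le fun hxy => ENNReal.ofReal_le_ofReal ?_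
      have hpos : 0 < ‖x - y‖ := norm_pos_iff.2 (sub_ne_zero.2 hxy.1)
      rw [div_le_iff₀ (Real.rpow_pos_of_pos hpos _)]
      have hn : Near x y := Or.inr hxy.2
      have hw : wt2 x y ^ (δ + lam) ≤ wt x ^ (δ + lam) * 2 ^ |δ + lam| := by
        unfold wt2
        rcases max_choice (wt x) (wt y) with e | e <;> rw [e]
        · exact le_mul_of_one_le_right (wt_rpow_pos _ _).le
            (Real.one_le_rpow one_le_two (abs_nonneg _))
        · exact hn.wt_rpow_le _
      have hs := h.space t ht x y hn
      have e1 : wt x ^ (δ + lam) * wt x ^ (-(δ + lam)) = 1 := by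
        rw [← Real.rpow_add (wt_pos x)]; simp
      calc wt2 x y ^ (δ + lam) * ‖v t x - v t y‖
          ≤ (wt x ^ (δ + lam) * 2 ^ |δ + lam|) *
            (K * wt x ^ (-(δ + lam)) * ‖x - y‖ ^ lam) := by
            have := wt_rpow_pos (δ + lam) x
            gcongr
        _ = (wt x ^ (δ + lam) * wt x ^ (-(δ + lam))) * (2 ^ |δ + lam| * K * ‖x - y‖ ^ lam) := by
            ring
        _ = _ := by rw [e1, one_mul]
  · refine iSup_le fun t₁ => iSup_le fun t₂ => iSup_le fun hne => iSup_le fun x =>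
      ENNReal.ofReal_le_ofReal ?_
    have hpos : 0 < |(t₁ : ℝ) - t₂| := abs_pos.2 (sub_ne_zero.2 hne)
    rw [div_le_iff₀ (Real.rpow_pos_of_pos hpos _), one_mul]
    have := h.time t₁ t₁.2 t₂ t₂.2 x
    have e1 : wt x ^ δ * wt x ^ (-δ) = 1 := by
      rw [← Real.rpow_add (wt_pos x)]; simp
    calc wt x ^ δ * ‖v t₁ x - v t₂ x‖ ≤
          wt x ^ δ * (K * wt x ^ (-δ) * |(t₁ : ℝ) - t₂| ^ (lam / 2)) := by
          have := wt_rpow_pos δ x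
          gcongr
      _ = (wt x ^ δ * wt x ^ (-δ)) * (K * |(t₁ : ℝ) - t₂| ^ (lam / 2)) := by ring
      _ = _ := by rw [e1, one_mul]

lemma HB.of_eAniso0_le (hl : 0 < lam) (hl1 : lam ≤ 1) (hK : 0 ≤ K)
    (h : eAniso0 T lam δ v ≤ ENNReal.ofReal K) :
    HB T lam δ v (4 * 3 ^ |δ| * 3 ^ |δ + lam| * K) := by
  have hne := hl.ne'
  unfold eAniso0 at h
  rw [if_neg hne] at h
  have hA := le_self_add.trans h
  have hB := le_add_self.trans h
  have hA' : ∀ t : Set.Icc (0 : ℝ) T, eHol0 lam δ (v t) ≤ ENNReal.ofReal K :=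
    fun t => (le_iSup (fun t : Set.Icc (0 : ℝ) T => eHol0 lam δ (v t)) t).trans hA
  simp only [eHol0, if_neg hne] at hA'
  have q1 : (1 : ℝ) ≤ 3 ^ |δ| := Real.one_le_rpow (by norm_num) (abs_nonneg _)
  have q2 : (1 : ℝ) ≤ 3 ^ |δ + lam| := Real.one_le_rpow (by norm_num) (abs_nonneg _)
  have q12 : (1 : ℝ) ≤ 3 ^ |δ| * 3 ^ |δ + lam| := one_le_mul_of_one_le_of_one_le q1 q2
  have hsup : ∀ t ∈ Set.Icc (0 : ℝ) T, ∀ x, ‖v t x‖ ≤ K * wt x ^ (-δ) := by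
    intro t ht x
    have h1 := (le_add_self.trans le_self_add).trans (hA' ⟨t, ht⟩)
    have h2 := (le_iSup (fun x => ENNReal.ofReal (wt x ^ δ * ‖v t x‖)) x).trans h1
    rw [ENNReal.ofReal_le_ofReal_iff hK] at h2
    rw [Real.rpow_neg (wt_pos x).le, ← div_eq_mul_inv, le_div_iff₀ (wt_rpow_pos _ _)]
    linarith
  have hwh : ∀ t ∈ Set.Icc (0 : ℝ) T, ∀ x y, Near x y → ‖x - y‖ ≤ ‖x‖ / 2 →
      ‖v t x - v t y‖ ≤ K * wt2 x y ^ (-(δ + lam)) * ‖x - y‖ ^ lam := by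
    intro t ht x y _ hxy
    by_cases hne : x = y
    · subst hne; simp [Real.zero_rpow hl.ne']
    have h1 := le_add_self.trans (hA' ⟨t, ht⟩)
    unfold eWHold at h1
    have h2 := (le_iSup (fun x => ⨆ (y : Spc n) (_ : x ≠ y ∧ ‖x - y‖ ≤ ‖x‖ / 2),
      ENNReal.ofReal (wt2 x y ^ (δ + lam) * ‖v t x - v t y‖ / ‖x - y‖ ^ lam)) x).trans h1
    have h3 := (le_iSup₂ (f := fun (y : Spc n) (_ : x ≠ y ∧ ‖x - y‖ ≤ ‖x‖ / 2) =>
      ENNReal.ofReal (wt2 x y ^ (δ + lam) * ‖v t x - v t y‖ / ‖x - y‖ ^ lam)) y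
        ⟨hne, hxy⟩).trans h2
    rw [ENNReal.ofReal_le_ofReal_iff hK] at h3
    have hpos : 0 < ‖x - y‖ := norm_pos_iff.2 (sub_ne_zero.2 hne)
    have hw : 0 < wt2 x y := lt_of_lt_of_le (wt_pos x) (le_max_left _ _)
    rw [div_le_iff₀ (Real.rpow_pos_of_pos hpos _)] at h3
    rw [Real.rpow_neg hw.le, mul_right_comm, ← div_eq_mul_inv,
      le_div_iff₀ (Real.rpow_pos_of_pos hw _)]
    linarith
  have hcmp : ∀ x y : Spc n, Near x y →
      wt2 x y ^ (-(δ + lam)) ≤ wt x ^ (-(δ + lam)) * 3 ^ |δ + lam| := by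
    intro x y hn
    have h0 := wt_rpow_pos (-(δ + lam)) x
    unfold wt2
    rcases max_choice (wt x) (wt y) with e | e <;> rw [e]
    · exact le_mul_of_one_le_right h0.le q2
    · refine (hn.wt_rpow_le _).trans ?_
      rw [abs_neg]
      gcongr
      norm_num
  have hwh' : ∀ t ∈ Set.Icc (0 : ℝ) T, ∀ x y, Near x y →
      ‖v t x - v t y‖ ≤ K * wt2 x y ^ (-(δ + lam)) * ‖x - y‖ ^ lam →
      ‖v t x - v t y‖ ≤
        4 * 3 ^ |δ| * 3 ^ |δ + lam| * K * wt x ^ (-(δ + lam)) * ‖x - y‖ ^ lam := by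
    intro t ht x y hn h
    refine h.trans ?_
    gcongr ?_ * _
    have h0 := wt_rpow_pos (-(δ + lam)) x
    calc K * wt2 x y ^ (-(δ + lam)) ≤ K * (wt x ^ (-(δ + lam)) * 3 ^ |δ + lam|) := by
          gcongr; exact hcmp x y hn
      _ = 1 * (3 ^ |δ + lam| * K * wt x ^ (-(δ + lam))) := by ring
      _ ≤ (4 * 3 ^ |δ|) * (3 ^ |δ + lam| * K * wt x ^ (-(δ + lam))) := by
          gcongr; linarith
      _ = _ := by ring
  refine ⟨by positivity, fun t ht x => (hsup t ht x).trans ?_, fun t ht x y hn => ?_,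
    fun t₁ h₁ t₂ h₂ x => ?_⟩
  · gcongr
    · exact (wt_rpow_pos _ x).le
    · nlinarith
  · by_cases c1 : ‖x - y‖ ≤ ‖x‖ / 2
    · exact hwh' t ht x y hn (hwh t ht x y hn c1)
    by_cases c2 : ‖x - y‖ ≤ ‖y‖ / 2
    · refine hwh' t ht x y hn ?_
      have := hwh t ht y x (Or.inr (by rwa [norm_sub_rev])) (by rwa [norm_sub_rev])
      rw [norm_sub_rev, norm_sub_rev y x] at this
      unfold wt2 at this ⊢
      rwa [max_comm]
    push Not at c1 c2
    have hxy1 : ‖x - y‖ ≤ 1 := by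
      rcases hn with h | h
      · exact h
      · linarith
    have hx2 : ‖x‖ ≤ 2 := by linarith
    have hy2 : ‖y‖ ≤ 2 := by linarith
    have hthree : ∀ (e : ℝ) (z : Spc n), ‖z‖ ≤ 2 → wt z ^ e ≤ 3 ^ |e| := by
      intro e x hx
      have := wt_rpow_le e 0 x
      rw [wt_zero, Real.one_rpow, one_mul, zero_sub, norm_neg] at this
      exact this.trans (Real.rpow_le_rpow (by positivity) (by linarith) (abs_nonneg e))
    have hlow : 1 ≤ 3 ^ |δ + lam| * wt x ^ (-(δ + lam)) := by
      have h1 := hthree (δ + lam) x hx2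
      have e1 : wt x ^ (δ + lam) * wt x ^ (-(δ + lam)) = 1 := by
        rw [← Real.rpow_add (wt_pos x)]; simp
      calc 1 = _ := e1.symm
        _ ≤ _ := by
          have := wt_rpow_pos (-(δ + lam)) x
          gcongr
    by_cases c3 : ‖x‖ ≤ 1 ∧ ‖y‖ ≤ 1
    · by_cases hne : x = y
      · subst hne; simp [Real.zero_rpow hl.ne']
      have h1 := (le_self_add.trans le_self_add).trans (hA' ⟨t, ht⟩)
      unfold eOHold at h1
      have h1' := le_add_self.trans h1
      have h2 := (le_iSup (fun x => ⨆ (y : Spc n) (_ : ‖x‖ ≤ 1 ∧ ‖y‖ ≤ 1 ∧ x ≠ y),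
        ENNReal.ofReal (‖v t x - v t y‖ / ‖x - y‖ ^ lam)) x).trans h1'
      have h3 := (le_iSup₂ (f := fun (y : Spc n) (_ : ‖x‖ ≤ 1 ∧ ‖y‖ ≤ 1 ∧ x ≠ y) =>
        ENNReal.ofReal (‖v t x - v t y‖ / ‖x - y‖ ^ lam)) y ⟨c3.1, c3.2, hne⟩).trans h2
      rw [ENNReal.ofReal_le_ofReal_iff hK] at h3
      have hpos : 0 < ‖x - y‖ := norm_pos_iff.2 (sub_ne_zero.2 hne)
      rw [div_le_iff₀ (Real.rpow_pos_of_pos hpos _)] at h3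
      refine h3.trans ?_
      gcongr
      calc K = 1 * (1 * K) := by ring
        _ ≤ (4 * 3 ^ |δ|) * ((3 ^ |δ + lam| * wt x ^ (-(δ + lam))) * K) := by
            gcongr
            linarith
        _ = _ := by ring
    · have hhalf : 1 / 2 ≤ ‖x - y‖ := by
        by_contra hc
        exact c3 ⟨by linarith, by linarith⟩
      have h2 : 1 ≤ 2 * ‖x - y‖ ^ lam := by
        have : (1 / 2 : ℝ) ≤ ‖x - y‖ ^ lam :=
          calc (1 / 2 : ℝ) = (1 / 2 : ℝ) ^ (1 : ℝ) := by simp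
            _ ≤ (1 / 2 : ℝ) ^ lam :=
              Real.rpow_le_rpow_of_exponent_ge (by norm_num) (by norm_num) hl1
            _ ≤ _ := Real.rpow_le_rpow (by norm_num) hhalf hl.le
        linarith
      have hb : ∀ z : Spc n, ‖z‖ ≤ 2 → ‖v t z‖ ≤ K * 3 ^ |δ| := by
        intro z hz
        refine (hsup t ht z).trans ?_
        gcongr
        simpa using hthree (-δ) z hz
      calc ‖v t x - v t y‖ ≤ ‖v t x‖ + ‖v t y‖ := norm_sub_le _ _
        _ ≤ 2 * 3 ^ |δ| * K * 1 * 1 := by linarith [hb x hx2, hb y hy2]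
        _ ≤ 2 * 3 ^ |δ| * K * (3 ^ |δ + lam| * wt x ^ (-(δ + lam))) * (2 * ‖x - y‖ ^ lam) := by
            gcongr
        _ = _ := by ring
  · by_cases hne : t₁ = t₂
    · subst hne; simp [Real.zero_rpow (half_pos hl).ne']
    have h1 := (le_iSup (fun t₁ : Set.Icc (0 : ℝ) T => ⨆ (t₂ : Set.Icc (0 : ℝ) T)
      (_ : (t₁ : ℝ) ≠ (t₂ : ℝ)) (x : Spc n), ENNReal.ofReal (wt x ^ δ * ‖v t₁ x - v t₂ x‖ /
        |(t₁ : ℝ) - (t₂ : ℝ)| ^ (lam / 2))) ⟨t₁, h₁⟩).trans hB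
    have h2 := (le_iSup₂ (f := fun (t₂ : Set.Icc (0 : ℝ) T) (_ : t₁ ≠ (t₂ : ℝ)) =>
      ⨆ (x : Spc n), ENNReal.ofReal (wt x ^ δ * ‖v t₁ x - v t₂ x‖ /
        |t₁ - (t₂ : ℝ)| ^ (lam / 2))) ⟨t₂, h₂⟩ hne).trans h1
    have h3 := (le_iSup (fun x => ENNReal.ofReal (wt x ^ δ * ‖v t₁ x - v t₂ x‖ /
        |t₁ - t₂| ^ (lam / 2))) x).trans h2
    rw [ENNReal.ofReal_le_ofReal_iff hK] at h3
    have hpos : 0 < |t₁ - t₂| := abs_pos.2 (sub_ne_zero.2 hne)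
    rw [div_le_iff₀ (Real.rpow_pos_of_pos hpos _)] at h3
    have h4 : ‖v t₁ x - v t₂ x‖ ≤ K * wt x ^ (-δ) * |t₁ - t₂| ^ (lam / 2) := by
      rw [Real.rpow_neg (wt_pos x).le, mul_right_comm, ← div_eq_mul_inv,
        le_div_iff₀ (wt_rpow_pos _ _)]
      linarith
    refine h4.trans ?_
    gcongr
    · exact (wt_rpow_pos _ x).le
    · nlinarith

end HB

variable {T lam δ δ' K K' : ℝ}

lemma HB.smul {v : ℝ → Spc n → ℝ} (c : ℝ) (h : HB T lam δ v K) :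
    HB T lam δ (fun t x => c * v t x) (|c| * K) := by
  have hK := h.nonneg
  refine ⟨by positivity, fun t ht x => ?_, fun t ht x y hxy => ?_, fun t₁ h₁ t₂ h₂ x => ?_⟩
  · rw [norm_mul, Real.norm_eq_abs, mul_assoc]
    gcongr
    exact h.sup t ht x
  · rw [← mul_sub, norm_mul, Real.norm_eq_abs, mul_assoc, mul_assoc, ← mul_assoc K]
    gcongr
    exact h.space t ht x y hxy
  · rw [← mul_sub, norm_mul, Real.norm_eq_abs, mul_assoc, mul_assoc, ← mul_assoc K]
    gcongr
    exact h.time t₁ h₁ t₂ h₂ x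

lemma HB.mul {a b : ℝ → Spc n → ℝ} (ha : HB T lam δ a K) (hb : HB T lam δ' b K') :
    HB T lam (δ + δ') (fun t x => a t x * b t x) ((1 + 2 ^ |δ'|) * K * K') := by
  have hK := ha.nonneg
  have hK' := hb.nonneg
  have e0 : ∀ x : Spc n, wt x ^ (-(δ + δ')) = wt x ^ (-δ) * wt x ^ (-δ') := fun x => by
    rw [← Real.rpow_add (wt_pos x)]; congr 1; ring
  have q : (1 : ℝ) ≤ 2 ^ |δ'| := Real.one_le_rpow one_le_two (abs_nonneg _)
  refine ⟨by positivity, fun t ht x => ?_, fun t ht x y hxy => ?_, fun t₁ h₁ t₂ h₂ x => ?_⟩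
  · rw [norm_mul, e0]
    calc ‖a t x‖ * ‖b t x‖ ≤ (K * wt x ^ (-δ)) * (K' * wt x ^ (-δ')) := by
          have := wt_rpow_pos (-δ) x
          gcongr
          · exact ha.sup t ht x
          · exact hb.sup t ht x
      _ = 1 * (K * K' * (wt x ^ (-δ) * wt x ^ (-δ'))) := by ring
      _ ≤ (1 + 2 ^ |δ'|) * (K * K' * (wt x ^ (-δ) * wt x ^ (-δ'))) := by
          have := wt_rpow_pos (-δ) x
          have := wt_rpow_pos (-δ') x
          gcongr
          linarith
      _ = _ := by ring
  · have e1 : a t x * b t x - a t y * b t y =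
        a t x * (b t x - b t y) + b t y * (a t x - a t y) := by ring
    have e2 : wt x ^ (-(δ + δ' + lam)) = wt x ^ (-δ) * wt x ^ (-(δ' + lam)) := by
      rw [← Real.rpow_add (wt_pos x)]; congr 1; ring
    have e3 : wt x ^ (-(δ + δ' + lam)) = wt x ^ (-δ') * wt x ^ (-(δ + lam)) := by
      rw [← Real.rpow_add (wt_pos x)]; congr 1; ring
    rw [e1]
    have hy : ‖b t y‖ ≤ K' * (wt x ^ (-δ') * 2 ^ |δ'|) := by
      refine (hb.sup t ht y).trans ?_
      gcongr
      simpa using hxy.wt_rpow_le (-δ')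
    have p1 := wt_rpow_pos (-δ) x
    have p2 := wt_rpow_pos (-δ') x
    calc ‖a t x * (b t x - b t y) + b t y * (a t x - a t y)‖
        ≤ ‖a t x‖ * ‖b t x - b t y‖ + ‖b t y‖ * ‖a t x - a t y‖ := by
          refine (norm_add_le _ _).trans ?_
          rw [norm_mul, norm_mul]
      _ ≤ (K * wt x ^ (-δ)) * (K' * wt x ^ (-(δ' + lam)) * ‖x - y‖ ^ lam) +
          (K' * (wt x ^ (-δ') * 2 ^ |δ'|)) * (K * wt x ^ (-(δ + lam)) * ‖x - y‖ ^ lam) := by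
          gcongr
          · exact ha.sup t ht x
          · exact hb.space t ht x y hxy
          · exact ha.space t ht x y hxy
      _ = (K * K' * ‖x - y‖ ^ lam) * (wt x ^ (-δ) * wt x ^ (-(δ' + lam))) +
          (K * K' * ‖x - y‖ ^ lam) * 2 ^ |δ'| * (wt x ^ (-δ') * wt x ^ (-(δ + lam))) := by ring
      _ = _ := by rw [← e2, ← e3]; ring
  · have e1 : a t₁ x * b t₁ x - a t₂ x * b t₂ x =
        a t₁ x * (b t₁ x - b t₂ x) + b t₂ x * (a t₁ x - a t₂ x) := by ring
    rw [e1, e0]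
    have p1 := wt_rpow_pos (-δ) x
    have p2 := wt_rpow_pos (-δ') x
    calc ‖a t₁ x * (b t₁ x - b t₂ x) + b t₂ x * (a t₁ x - a t₂ x)‖
        ≤ ‖a t₁ x‖ * ‖b t₁ x - b t₂ x‖ + ‖b t₂ x‖ * ‖a t₁ x - a t₂ x‖ := by
          refine (norm_add_le _ _).trans ?_
          rw [norm_mul, norm_mul]
      _ ≤ (K * wt x ^ (-δ)) * (K' * wt x ^ (-δ') * |t₁ - t₂| ^ (lam / 2)) +
          (K' * wt x ^ (-δ')) * (K * wt x ^ (-δ) * |t₁ - t₂| ^ (lam / 2)) := by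
          gcongr
          · exact ha.sup t₁ h₁ x
          · exact hb.time t₁ h₁ t₂ h₂ x
          · exact hb.sup t₂ h₂ x
          · exact ha.time t₁ h₁ t₂ h₂ x
      _ = (1 + 1) * (K * K' * (wt x ^ (-δ) * wt x ^ (-δ')) * |t₁ - t₂| ^ (lam / 2)) := by ring
      _ ≤ (1 + 2 ^ |δ'|) * (K * K' * (wt x ^ (-δ) * wt x ^ (-δ')) * |t₁ - t₂| ^ (lam / 2)) := by
          gcongr
      _ = _ := by ring

end

section

/-! ### Recursive description of the anisotropic spaces -/

/-- Spatial partial derivative of a time-dependent function. -/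
def spd (i : Fin n) (u : ℝ → Spc n → ℝ) : ℝ → Spc n → ℝ := fun t => pd i (u t)

/-- First time derivative within `[0,T]`. -/
def tdv (T : ℝ) (u : ℝ → Spc n → ℝ) : ℝ → Spc n → ℝ :=
  fun t x => derivWithin (fun τ => u τ x) (Set.Icc 0 T) t

/-- Functions having all mixed derivatives of parabolic order at most `N`, with at most `s` time
derivatives, bounded by `K` in the weighted Hölder sense; each spatial derivative
raises the weight by one. -/
inductive Cls (T lam : ℝ) : ℕ → ℕ → ℝ → (ℝ → Spc n → ℝ) → ℝ → Prop
  | intro {N s : ℕ} {δ : ℝ} {u : ℝ → Spc n → ℝ} {K : ℝ}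
      (hb : HB T lam δ u K)
      (hdx : 1 ≤ N → ∀ t ∈ Set.Icc (0 : ℝ) T, Differentiable ℝ (u t))
      (hx : ∀ i, 1 ≤ N → Cls T lam (N - 1) s (δ + 1) (spd i u) K)
      (hdt : 2 ≤ N → 1 ≤ s → ∀ x, DifferentiableOn ℝ (fun t => u t x) (Set.Icc 0 T))
      (ht : 2 ≤ N → 1 ≤ s → Cls T lam (N - 2) (s - 1) δ (tdv T u) K) :
      Cls T lam N s δ u K

variable {T lam δ δ' K K' : ℝ} {N N' s s' : ℕ} {u v : ℝ → Spc n → ℝ}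

lemma Cls.hb (h : Cls T lam N s δ u K) : HB T lam δ u K := by cases h; assumption

lemma Cls.nonneg (h : Cls T lam N s δ u K) : 0 ≤ K := h.hb.nonneg

lemma Cls.hdx (h : Cls T lam N s δ u K) (hN : 1 ≤ N) :
    ∀ t ∈ Set.Icc (0 : ℝ) T, Differentiable ℝ (u t) := by
  cases h with | intro hb hdx hx hdt ht => exact hdx hN

lemma Cls.hx (h : Cls T lam N s δ u K) (hN : 1 ≤ N) (i : Fin n) :
    Cls T lam (N - 1) s (δ + 1) (spd i u) K := by
  cases h with | intro hb hdx hx hdt ht => exact hx i hN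

lemma Cls.hdt (h : Cls T lam N s δ u K) (hN : 2 ≤ N) (hs : 1 ≤ s) (x : Spc n) :
    DifferentiableOn ℝ (fun t => u t x) (Set.Icc 0 T) := by
  cases h with | intro hb hdx hx hdt ht => exact hdt hN hs x

lemma Cls.ht (h : Cls T lam N s δ u K) (hN : 2 ≤ N) (hs : 1 ≤ s) :
    Cls T lam (N - 2) (s - 1) δ (tdv T u) K := by
  cases h with | intro hb hdx hx hdt ht => exact ht hN hs

lemma Cls.mono (h : Cls T lam N s δ u K) (hN : N' ≤ N) (hs : s' ≤ s) (hδ : δ' ≤ δ)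
    (hK : K ≤ K') : Cls T lam N' s' δ' u K' := by
  induction N using Nat.strong_induction_on generalizing N' s s' δ δ' u with
  | _ N ih =>
    refine ⟨h.hb.mono hδ hK, fun h1 => h.hdx (h1.trans hN), fun i h1 => ?_,
      fun h1 h2 => h.hdt (h1.trans hN) (h2.trans hs), fun h1 h2 => ?_⟩
    · exact ih (N - 1) (by omega) (h.hx (h1.trans hN) i) (by omega) hs (by linarith)
    · exact ih (N - 2) (by omega) (h.ht (h1.trans hN) (h2.trans hs)) (by omega) (by omega) hδ

lemma tdv_congr (h : ∀ t ∈ Set.Icc (0 : ℝ) T, ∀ x, u t x = v t x) :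
    ∀ t ∈ Set.Icc (0 : ℝ) T, ∀ x, tdv T u t x = tdv T v t x := fun t ht x =>
  derivWithin_congr (fun τ hτ => h τ hτ x) (h t ht x)

lemma spd_congr (h : ∀ t ∈ Set.Icc (0 : ℝ) T, ∀ x, u t x = v t x) (i : Fin n) :
    ∀ t ∈ Set.Icc (0 : ℝ) T, ∀ x, spd i u t x = spd i v t x := fun t ht x => by
  rw [spd, spd, show u t = v t from funext (h t ht)]

lemma Cls.congr (h : Cls T lam N s δ u K)
    (hv : ∀ t ∈ Set.Icc (0 : ℝ) T, ∀ x, u t x = v t x) : Cls T lam N s δ v K := by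
  induction N using Nat.strong_induction_on generalizing s δ u v with
  | _ N ih =>
    refine ⟨h.hb.congr hv, fun h1 t ht => ?_, fun i h1 => ?_, fun h1 h2 x => ?_, fun h1 h2 => ?_⟩
    · rw [← show u t = v t from funext (hv t ht)]
      exact h.hdx h1 t ht
    · exact ih (N - 1) (by omega) (h.hx h1 i) (spd_congr hv i)
    · exact (h.hdt h1 h2 x).congr fun t ht => (hv t ht x).symm
    · exact ih (N - 2) (by omega) (h.ht h1 h2) (tdv_congr hv)

lemma Cls.zero : Cls T lam N s δ (0 : ℝ → Spc n → ℝ) 0 := by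
  induction N using Nat.strong_induction_on generalizing s δ with
  | _ N ih =>
    refine ⟨HB.zero, fun _ t _ => differentiable_const _, fun i h1 => ?_,
      fun _ _ x => differentiableOn_const _, fun h1 h2 => ?_⟩
    · refine (ih (N - 1) (by omega)).congr fun t _ x => ?_
      simp [spd, pd]
    · refine (ih (N - 2) (by omega)).congr fun t _ x => ?_
      simp [tdv]

lemma Cls.add (h : Cls T lam N s δ u K) (h' : Cls T lam N s δ v K') :
    Cls T lam N s δ (u + v) (K + K') := by
  induction N using Nat.strong_induction_on generalizing s δ u v with
  | _ N ih =>
    refine ⟨h.hb.add h'.hb, fun h1 t ht => (h.hdx h1 t ht).add (h'.hdx h1 t ht), fun i h1 => ?_,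
      fun h1 h2 x => (h.hdt h1 h2 x).add (h'.hdt h1 h2 x), fun h1 h2 => ?_⟩
    · refine (ih (N - 1) (by omega) (h.hx h1 i) (h'.hx h1 i)).congr fun t ht x => ?_
      simp only [spd, pd, Pi.add_apply]
      rw [fderiv_add (h.hdx h1 t ht x) (h'.hdx h1 t ht x)]
      rfl
    · refine (ih (N - 2) (by omega) (h.ht h1 h2) (h'.ht h1 h2)).congr fun t ht x => ?_
      exact (derivWithin_add (h.hdt h1 h2 x t ht) (h'.hdt h1 h2 x t ht)).symm

lemma Cls.smul (c : ℝ) (h : Cls T lam N s δ u K) :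
    Cls T lam N s δ (fun t x => c * u t x) (|c| * K) := by
  induction N using Nat.strong_induction_on generalizing s δ u with
  | _ N ih =>
    refine ⟨h.hb.smul c, fun h1 t ht => (h.hdx h1 t ht).const_mul c, fun i h1 => ?_,
      fun h1 h2 x => (h.hdt h1 h2 x).const_mul c, fun h1 h2 => ?_⟩
    · refine (ih (N - 1) (by omega) (h.hx h1 i)).congr fun t ht x => ?_
      simp only [spd, pd]
      rw [fderiv_const_mul (h.hdx h1 t ht x)]
      rfl
    · refine (ih (N - 2) (by omega) (h.ht h1 h2)).congr fun t ht x => ?_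
      exact (derivWithin_const_mul c (h.hdt h1 h2 x t ht)).symm

lemma Cls.sub (h : Cls T lam N s δ u K) (h' : Cls T lam N s δ v K') :
    Cls T lam N s δ (u - v) (K + K') := by
  have := h.add (h'.smul (-1))
  rw [abs_neg, abs_one, one_mul] at this
  refine this.congr fun t _ x => ?_
  simp only [Pi.add_apply, Pi.sub_apply]
  ring

lemma Cls.sum {ι : Type*} (S : Finset ι) {w : ι → ℝ → Spc n → ℝ} {k : ι → ℝ}
    (h : ∀ i ∈ S, Cls T lam N s δ (w i) (k i)) :
    Cls T lam N s δ (fun t x => ∑ i ∈ S, w i t x) (∑ i ∈ S, k i) := by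
  induction S using Finset.induction_on with
  | empty =>
    simp only [Finset.sum_empty]
    exact Cls.zero
  | insert i S hi ih =>
    simp only [Finset.sum_insert hi]
    exact (h i (by simp)).add (ih fun j hj => h j (by simp [hj]))

lemma Cls.mul (T lam : ℝ) (N s : ℕ) (δ δ' : ℝ) :
    ∃ C, 0 ≤ C ∧ ∀ (a b : ℝ → Spc n → ℝ) (K K' : ℝ), Cls T lam N s δ a K →
      Cls T lam N s δ' b K' →
      Cls T lam N s (δ + δ') (fun t x => a t x * b t x) (C * (K * K')) := by
  induction N using Nat.strong_induction_on generalizing s δ δ' with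
  | _ N ih =>
    have h1 : ∃ C, 0 ≤ C ∧ (1 ≤ N → ∀ (a b : ℝ → Spc n → ℝ) (K K' : ℝ), Cls T lam N s δ a K →
        Cls T lam N s δ' b K' → ∀ i, Cls T lam (N - 1) s (δ + δ' + 1)
          (spd i fun t x => a t x * b t x) (C * (K * K'))) := by
      by_cases hN : 1 ≤ N
      · obtain ⟨C₁, hC₁, H₁⟩ := ih (N - 1) (by omega) s δ (δ' + 1)
        obtain ⟨C₂, hC₂, H₂⟩ := ih (N - 1) (by omega) s (δ + 1) δ'
        refine ⟨C₁ + C₂, by positivity, fun _ a b K K' ha hb i => ?_⟩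
        have k1 := H₁ a (spd i b) K K' (ha.mono (by omega) le_rfl le_rfl le_rfl) (hb.hx hN i)
        have k2 := H₂ (spd i a) b K K' (ha.hx hN i) (hb.mono (by omega) le_rfl le_rfl le_rfl)
        rw [← add_assoc] at k1
        rw [show δ + 1 + δ' = δ + δ' + 1 by ring] at k2
        rw [add_mul]
        refine (k1.add k2).congr fun t ht x => ?_
        simp only [Pi.add_apply, spd, pd]
        rw [fderiv_fun_mul (ha.hdx hN t ht x) (hb.hdx hN t ht x)]
        simp only [add_apply, smul_apply, smul_eq_mul]
        ring
      · exact ⟨0, le_rfl, fun h => absurd h hN⟩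
    have h2 : ∃ C, 0 ≤ C ∧ (2 ≤ N → 1 ≤ s → ∀ (a b : ℝ → Spc n → ℝ) (K K' : ℝ),
        Cls T lam N s δ a K → Cls T lam N s δ' b K' → Cls T lam (N - 2) (s - 1) (δ + δ')
          (tdv T fun t x => a t x * b t x) (C * (K * K'))) := by
      by_cases hN : 2 ≤ N ∧ 1 ≤ s
      · obtain ⟨C₁, hC₁, H₁⟩ := ih (N - 2) (by omega) (s - 1) δ δ'
        refine ⟨C₁ + C₁, by positivity, fun h h' a b K K' ha hb => ?_⟩
        have k1 := H₁ a (tdv T b) K K' (ha.mono (by omega) (by omega) le_rfl le_rfl) (hb.ht h h')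
        have k2 := H₁ (tdv T a) b K K' (ha.ht h h') (hb.mono (by omega) (by omega) le_rfl le_rfl)
        rw [add_mul]
        refine (k1.add k2).congr fun t ht x => ?_
        simp only [Pi.add_apply, tdv]
        rw [derivWithin_fun_mul (ha.hdt h h' x t ht) (hb.hdt h h' x t ht)]
        ring
      · exact ⟨0, le_rfl, fun h h' => absurd ⟨h, h'⟩ hN⟩
    obtain ⟨C₁, hC₁, H₁⟩ := h1
    obtain ⟨C₂, hC₂, H₂⟩ := h2
    have hC0 : (0 : ℝ) ≤ 1 + 2 ^ |δ'| := by positivity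
    refine ⟨(1 + 2 ^ |δ'|) + C₁ + C₂, by positivity, fun a b K K' ha hb => ?_⟩
    have hKK : 0 ≤ K * K' := mul_nonneg ha.nonneg hb.nonneg
    refine ⟨(ha.hb.mul hb.hb).mono le_rfl ?_,
      fun h t ht => (ha.hdx h t ht).mul (hb.hdx h t ht), fun i h => ?_,
      fun h h' x => (ha.hdt h h' x).mul (hb.hdt h h' x), fun h h' => ?_⟩
    · rw [mul_assoc]
      exact mul_le_mul_of_nonneg_right (by linarith) hKK
    · refine (H₁ h a b K K' ha hb i).mono le_rfl le_rfl le_rfl ?_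
      exact mul_le_mul_of_nonneg_right (by linarith) hKK
    · refine (H₂ h h' a b K K' ha hb).mono le_rfl le_rfl le_rfl ?_
      exact mul_le_mul_of_nonneg_right (by linarith) hKK

end

section

/-! ### From the recursive description to the anisotropic norms -/

variable {T lam δ K : ℝ} {N s : ℕ} {u : ℝ → Spc n → ℝ}

lemma sum_single_eq (x : Spc n) :
    ∑ i, x i • (EuclideanSpace.single i (1 : ℝ) : Spc n) = x := by
  have := (EuclideanSpace.basisFun (Fin n) ℝ).sum_repr x
  simpa using this

lemma fderiv_apply_eq_sum_pd (f : Spc n → ℝ) (x y : Spc n) :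
    fderiv ℝ f x y = ∑ i, y i * pd i f x := by
  conv_lhs => rw [← sum_single_eq y]
  simp [map_sum, pd]

lemma coord_abs_le (x : Spc n) (i : Fin n) : |x i| ≤ ‖x‖ := by
  simpa using PiLp.norm_apply_le x i

lemma norm_fderiv_le_sum_pd (f : Spc n → ℝ) (x : Spc n) :
    ‖fderiv ℝ f x‖ ≤ ∑ i, |pd i f x| := by
  refine ContinuousLinearMap.opNorm_le_bound _ (by positivity) fun y => ?_
  rw [fderiv_apply_eq_sum_pd, Real.norm_eq_abs, Finset.sum_mul]
  refine (Finset.abs_sum_le_sum_abs _ _).trans (Finset.sum_le_sum fun i _ => ?_)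
  rw [abs_mul, mul_comm]
  exact mul_le_mul_of_nonneg_left (coord_abs_le y i) (abs_nonneg _)

/-- A multilinear form is dominated by its values on basis vectors. -/
lemma cmm_norm_le {m : ℕ} (A : ContinuousMultilinearMap ℝ (fun _ : Fin m => Spc n) ℝ) :
    ‖A‖ ≤ ∑ σ : Fin m → Fin n, |A fun l => EuclideanSpace.single (σ l) 1| := by
  refine ContinuousMultilinearMap.opNorm_le_bound (by positivity) fun y => ?_
  have e : y = fun l => ∑ i, y l i • (EuclideanSpace.single i (1 : ℝ) : Spc n) :=
    funext fun l => (sum_single_eq (y l)).symm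
  conv_lhs => rw [e]
  rw [ContinuousMultilinearMap.map_sum, Finset.sum_mul]
  refine (norm_sum_le _ _).trans (Finset.sum_le_sum fun σ _ => ?_)
  rw [ContinuousMultilinearMap.map_smul_univ, norm_smul, Real.norm_eq_abs, Real.norm_eq_abs,
    mul_comm, Finset.abs_prod]
  refine mul_le_mul_of_nonneg_left ?_ (abs_nonneg _)
  exact Finset.prod_le_prod (fun _ _ => abs_nonneg _) fun l _ => coord_abs_le _ _

lemma cmm_abs_apply_le {m : ℕ} (A : ContinuousMultilinearMap ℝ (fun _ : Fin m => Spc n) ℝ)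
    (σ : Fin m → Fin n) : |A fun l => EuclideanSpace.single (σ l) 1| ≤ ‖A‖ := by
  refine (A.le_opNorm _).trans ?_
  simp

/-- Iterated static partial derivatives. -/
def pdL (l : List (Fin n)) (f : Spc n → ℝ) : Spc n → ℝ := l.foldr pd f

/-- Iterated spatial partial derivatives. -/
def spdL (l : List (Fin n)) (u : ℝ → Spc n → ℝ) : ℝ → Spc n → ℝ := l.foldr spd u

lemma spdL_apply (l : List (Fin n)) (u : ℝ → Spc n → ℝ) (t : ℝ) :
    spdL l u t = pdL l (u t) := by
  induction l with
  | nil => rfl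
  | cons i l ih =>
    change spd i (spdL l u) t = pd i (pdL l (u t))
    rw [spd, ih]

lemma iteratedFDeriv_single {m : ℕ} {f : Spc n → ℝ} (hf : ContDiff ℝ m f)
    (σ : Fin m → Fin n) (x : Spc n) :
    iteratedFDeriv ℝ m f x (fun l => EuclideanSpace.single (σ l) 1) =
      pdL (List.ofFn σ) f x := by
  induction m generalizing x with
  | zero => simp [pdL]
  | succ m ih =>
    have hd : Differentiable ℝ (iteratedFDeriv ℝ m f) :=
      hf.differentiable_iteratedFDeriv (by exact_mod_cast Nat.lt_succ_self m)
    rw [iteratedFDeriv_succ_apply_left, List.ofFn_succ]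
    change _ = pd (σ 0) (pdL (List.ofFn fun i => σ i.succ) f) x
    have e : pdL (List.ofFn fun i => σ i.succ) f = fun y =>
        iteratedFDeriv ℝ m f y (fun l => EuclideanSpace.single (σ l.succ) 1) :=
      funext fun y => (ih (hf.of_le (by exact_mod_cast Nat.le_succ m)) _ y).symm
    rw [e, pd, fderiv_continuousMultilinear_apply_const (hd x)]
    rfl

lemma tDeriv_zero (T : ℝ) (u : ℝ → Spc n → ℝ) : tDeriv T 0 u = u := by
  funext t x
  simp [tDeriv]

lemma tDeriv_succ (T : ℝ) (j : ℕ) (u : ℝ → Spc n → ℝ) :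
    tDeriv T (j + 1) u = tDeriv T j (tdv T u) := by
  funext t x
  rw [tDeriv, iteratedDerivWithin_succ']
  rfl

lemma tDeriv_succ' (T : ℝ) (j : ℕ) (u : ℝ → Spc n → ℝ) :
    tDeriv T (j + 1) u = tdv T (tDeriv T j u) := by
  funext t x
  rw [tDeriv, iteratedDerivWithin_succ]
  rfl

lemma Cls.tDeriv (h : Cls T lam N s δ u K) {j : ℕ} (hj : j ≤ s) (hN : 2 * j ≤ N) :
    Cls T lam (N - 2 * j) (s - j) δ (tDeriv T j u) K := by
  induction j generalizing u N s with
  | zero => rw [tDeriv_zero]; exact h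
  | succ j ih =>
    rw [tDeriv_succ]
    have := ih (h.ht (by omega) (by omega)) (by omega) (by omega)
    rwa [show N - 2 - 2 * j = N - 2 * (j + 1) by omega,
      show s - 1 - j = s - (j + 1) by omega] at this

lemma Cls.spdL (h : Cls T lam N s δ u K) (l : List (Fin n)) (hl : l.length ≤ N) :
    Cls T lam (N - l.length) s (δ + l.length) (spdL l u) K := by
  induction l with
  | nil => simpa [NSdeRham.spdL] using h
  | cons i l ih =>
    have := (ih (by simp at hl; omega)).hx (by simp at hl; omega) i
    simp only [List.length_cons, Nat.cast_add, Nat.cast_one]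
    rwa [Nat.sub_sub, add_assoc] at this

lemma HB.continuous_right (hl : 0 < lam) (h : HB T lam δ u K) {t : ℝ}
    (ht : t ∈ Set.Icc (0 : ℝ) T) : Continuous (u t) :=
  continuousOn_univ.1 ((h.continuousOn hl).comp (by fun_prop : ContinuousOn (fun x => (t, x)) _)
    fun x _ => ⟨ht, trivial⟩)

lemma HB.continuousOn_left (hl : 0 < lam) (h : HB T lam δ u K) (x : Spc n) :
    ContinuousOn (fun t => u t x) (Set.Icc 0 T) :=
  (h.continuousOn hl).comp (by fun_prop : ContinuousOn (fun t => (t, x)) _)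
    fun t ht => ⟨ht, trivial⟩

lemma Cls.contDiff (hl : 0 < lam) (h : Cls T lam N s δ u K) {t : ℝ}
    (ht : t ∈ Set.Icc (0 : ℝ) T) : ContDiff ℝ N (u t) := by
  induction N generalizing δ u with
  | zero => exact contDiff_zero.2 (h.hb.continuous_right hl ht)
  | succ N ih =>
    push_cast
    rw [contDiff_succ_iff_fderiv_apply]
    refine ⟨h.hdx (by omega) t ht, fun h => by simp at h, fun y => ?_⟩
    simp only [fderiv_apply_eq_sum_pd]
    refine ContDiff.sum fun i _ => contDiff_const.mul ?_
    exact ih (h.hx (by omega) i)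

lemma Cls.contDiffOn (hT : 0 < T) (hl : 0 < lam) (h : Cls T lam N s δ u K) (hN : 2 * s ≤ N)
    (x : Spc n) : ContDiffOn ℝ s (fun t => u t x) (Set.Icc 0 T) := by
  induction s generalizing N u with
  | zero => exact contDiffOn_zero.2 (h.hb.continuousOn_left hl x)
  | succ s ih =>
    push_cast
    rw [contDiffOn_succ_iff_derivWithin (uniqueDiffOn_Icc hT)]
    exact ⟨h.hdt (by omega) (by omega) x, fun h => by simp at h,
      ih (h.ht (by omega) (by omega)) (by omega)⟩

lemma Cls.mixDeriv (hl : 0 < lam) (h : Cls T lam N s δ u K) {m j : ℕ} (hj : j ≤ s)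
    (hm : m + 2 * j ≤ N) :
    HB T lam (δ + m) (mixDeriv T m j u) ((n : ℝ) ^ m * K) := by
  have hd := h.tDeriv hj (by omega)
  have hc : ∀ t ∈ Set.Icc (0 : ℝ) T, ContDiff ℝ m (NSdeRham.tDeriv T j u t) := fun t ht =>
    (hd.contDiff hl ht).of_le (by exact_mod_cast (by omega : m ≤ N - 2 * j))
  have key := HB.of_components (v := NSdeRham.mixDeriv T m j u)
    (w := fun (σ : Fin m → Fin n) => NSdeRham.spdL (List.ofFn σ) (NSdeRham.tDeriv T j u))
    (T := T) (lam := lam) (δ := δ + m) (K := K) (fun σ => ?_) h.nonneg ?_ ?_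
  · simpa using key
  · have := (hd.spdL (List.ofFn σ) (by simp; omega)).hb
    simpa using this
  · intro t ht x
    refine (cmm_norm_le _).trans (le_of_eq (Finset.sum_congr rfl fun σ _ => ?_))
    rw [spdL_apply, NSdeRham.mixDeriv, iteratedFDeriv_single (hc t ht)]
  · intro t₁ h₁ t₂ h₂ x y
    refine (cmm_norm_le _).trans (le_of_eq (Finset.sum_congr rfl fun σ _ => ?_))
    rw [spdL_apply, spdL_apply, sub_apply, NSdeRham.mixDeriv,
      NSdeRham.mixDeriv, iteratedFDeriv_single (hc t₁ h₁), iteratedFDeriv_single (hc t₂ h₂)]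

lemma Cls.anisoReg {k : ℕ} (hT : 0 < T) (hl : 0 < lam) (h : Cls T lam (2 * s + k) s δ u K) :
    AnisoReg T k s u := by
  refine ⟨fun x => h.contDiffOn hT hl (by omega) x, fun j hj t ht => ?_, fun j m hj hm => ?_⟩
  · have := (h.tDeriv hj (by omega)).contDiff hl ht
    refine this.of_le ?_
    have : ((2 * (s - j) + k : ℕ) : WithTop ℕ∞) ≤ ((2 * s + k - 2 * j : ℕ) : WithTop ℕ∞) := by
      exact_mod_cast (by omega)
    refine le_trans (le_of_eq ?_) this
    norm_cast
  · have hc := (h.mixDeriv hl hj hm).continuousOn hl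
    exact hc.comp_continuous (f := fun p : Set.Icc (0 : ℝ) T × Spc n => ((p.1 : ℝ), p.2))
      (by fun_prop) fun p => ⟨p.1.2, trivial⟩

lemma Cls.eAnisoKS_le (T lam δ : ℝ) (hl : 0 < lam) (k s : ℕ) :
    ∃ C : ℝ, 0 ≤ C ∧ ∀ (u : ℝ → Spc n → ℝ) (K : ℝ), Cls T lam (2 * s + k) s δ u K →
      eAnisoKS T k s lam δ u ≤ ENNReal.ofReal (C * K) := by
  let c : ℕ → ℕ → ℝ := fun b m => (2 ^ |δ + b + m| + (2 ^ |δ + b + m + lam| + 2 * 2 ^ |δ + b + m|)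
    + 1 + 2 ^ |δ + b + m + lam| + 1) * (n : ℝ) ^ (b + m)
  have hc : ∀ b m, 0 ≤ c b m := fun b m => by positivity
  refine ⟨∑ b ∈ Finset.range (k + 1), ∑ m ∈ Finset.range (2 * s + 1),
    ∑ j ∈ Finset.range (s + 1), c b m, ?_, fun u K h => ?_⟩
  · exact Finset.sum_nonneg fun _ _ => Finset.sum_nonneg fun _ _ => Finset.sum_nonneg fun _ _ =>
      hc _ _
  · have hK := h.nonneg
    rw [Finset.sum_mul, ENNReal.ofReal_sum_of_nonneg fun _ _ => mul_nonneg
      (Finset.sum_nonneg fun _ _ => Finset.sum_nonneg fun _ _ => hc _ _) hK]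
    refine Finset.sum_le_sum fun b hb => ?_
    rw [Finset.sum_mul, ENNReal.ofReal_sum_of_nonneg fun _ _ => mul_nonneg
      (Finset.sum_nonneg fun _ _ => hc _ _) hK]
    refine Finset.sum_le_sum fun m hm => ?_
    rw [Finset.sum_mul, ENNReal.ofReal_sum_of_nonneg fun _ _ => mul_nonneg (hc _ _) hK]
    refine Finset.sum_le_sum fun j hj => ?_
    simp only [Finset.mem_range] at hb hm hj
    split_ifs with hmj
    · have := (h.mixDeriv (m := b + m) (j := j) hl (by omega) (by omega))
      rw [Nat.cast_add, ← add_assoc] at this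
      refine (this.eAniso0_le hl).trans (le_of_eq ?_)
      rw [← mul_assoc]
    · positivity

end

section

/-! ### From the anisotropic norms to the recursive description -/

variable {T lam δ K : ℝ} {N s : ℕ} {u v : ℝ → Spc n → ℝ}

lemma norm_single_one (i : Fin n) : ‖(EuclideanSpace.single i (1 : ℝ) : Spc n)‖ = 1 := by simp

lemma hasDerivAt_line {f : Spc n → ℝ} (hf : Differentiable ℝ f) (x : Spc n) (i : Fin n) (r : ℝ) :
    HasDerivAt (fun r : ℝ => f (x + r • EuclideanSpace.single i (1 : ℝ)))
      (pd i f (x + r • EuclideanSpace.single i (1 : ℝ))) r := by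
  have h1 : HasDerivAt (fun r : ℝ => x + r • (EuclideanSpace.single i (1 : ℝ) : Spc n))
      ((1 : ℝ) • EuclideanSpace.single i (1 : ℝ)) r :=
    ((hasDerivAt_id r).smul_const _).const_add x
  rw [one_smul] at h1
  exact (hf (x + r • EuclideanSpace.single i (1 : ℝ))).hasFDerivAt.comp_hasDerivAt r h1

/-- Time and space derivatives commute. -/
lemma hasDerivWithinAt_spd (i : Fin n)
    (hx : ∀ t ∈ Set.Icc (0 : ℝ) T, Differentiable ℝ (v t))
    (ht : ∀ x, DifferentiableOn ℝ (fun t => v t x) (Set.Icc 0 T))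
    (htx : ∀ t ∈ Set.Icc (0 : ℝ) T, Differentiable ℝ (tdv T v t))
    (hc : ContinuousOn (fun p : ℝ × Spc n => spd i (tdv T v) p.1 p.2) (Set.Icc 0 T ×ˢ Set.univ))
    {t₀ : ℝ} (h₀ : t₀ ∈ Set.Icc (0 : ℝ) T) (x : Spc n) :
    HasDerivWithinAt (fun t => spd i v t x) (spd i (tdv T v) t₀ x) (Set.Icc 0 T) t₀ := by
  set c := spd i (tdv T v) t₀ x with hcdef
  set e : Spc n := EuclideanSpace.single i 1 with he
  rw [hasDerivWithinAt_iff_isLittleO, Asymptotics.isLittleO_iff]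
  intro ε hε
  obtain ⟨d, hd, H⟩ := Metric.continuousOn_iff.1 hc (t₀, x) ⟨h₀, trivial⟩ ε hε
  have hball : Metric.ball t₀ d ∩ Set.Icc 0 T ∈ nhdsWithin t₀ (Set.Icc 0 T) :=
    inter_mem (mem_nhdsWithin_of_mem_nhds (Metric.ball_mem_nhds _ hd)) self_mem_nhdsWithin
  have hconv : Convex ℝ (Metric.ball t₀ d ∩ Set.Icc 0 T) :=
    (convex_ball _ _).inter (convex_Icc _ _)
  have hsmall : ∀ t ∈ Metric.ball t₀ d ∩ Set.Icc 0 T, ∀ r ∈ Set.Ico 0 d,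
      |spd i (tdv T v) t (x + r • e) - c| ≤ ε := by
    intro t htm r hr
    refine (H (t, x + r • e) ⟨htm.2, trivial⟩ ?_).le
    rw [Prod.dist_eq]
    refine max_lt htm.1 ?_
    rw [dist_eq_norm, add_sub_cancel_left, norm_smul, norm_single_one, mul_one, Real.norm_eq_abs,
      abs_of_nonneg hr.1]
    exact hr.2
  have hE : ∀ r ∈ Set.Ioo 0 d, ∀ t ∈ Metric.ball t₀ d ∩ Set.Icc 0 T,
      |r⁻¹ * (v t (x + r • e) - v t x) - r⁻¹ * (v t₀ (x + r • e) - v t₀ x) - c * (t - t₀)|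
        ≤ ε * |t - t₀| := by
    intro r hr t htm
    have hder : ∀ t ∈ Metric.ball t₀ d ∩ Set.Icc 0 T,
        HasDerivWithinAt (fun t => r⁻¹ * (v t (x + r • e) - v t x) - c * t)
          (r⁻¹ * (tdv T v t (x + r • e) - tdv T v t x) - c * 1)
          (Metric.ball t₀ d ∩ Set.Icc 0 T) t := by
      intro t htm
      have k1 := ((ht (x + r • e)) t htm.2).hasDerivWithinAt
      have k2 := ((ht x) t htm.2).hasDerivWithinAt
      exact (((k1.sub k2).const_mul r⁻¹).sub
        ((hasDerivWithinAt_id t _).const_mul c)).mono Set.inter_subset_right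
    have hbd : ∀ t ∈ Metric.ball t₀ d ∩ Set.Icc 0 T,
        ‖r⁻¹ * (tdv T v t (x + r • e) - tdv T v t x) - c * 1‖ ≤ ε := by
      intro t htm
      have k := Convex.norm_image_sub_le_of_norm_hasDerivWithin_le (𝕜 := ℝ)
        (f := fun r => tdv T v t (x + r • e) - c * r)
        (f' := fun r => spd i (tdv T v) t (x + r • e) - c * 1) (s := Set.Ico 0 d) (C := ε)
        (x := 0) (y := r)
        (fun r _ => ((hasDerivAt_line (htx t htm.2) x i r).sub
          ((hasDerivAt_id r).const_mul c)).hasDerivWithinAt)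
        (fun r hr => by rw [mul_one]; exact hsmall t htm r hr) (convex_Ico _ _)
        ⟨le_rfl, hd⟩ ⟨hr.1.le, hr.2⟩
      simp only [zero_smul, add_zero, mul_zero, sub_zero, Real.norm_eq_abs, abs_of_pos hr.1] at k
      rw [Real.norm_eq_abs, mul_one]
      have e1 : r⁻¹ * (tdv T v t (x + r • e) - tdv T v t x) - c
          = r⁻¹ * (tdv T v t (x + r • e) - c * r - tdv T v t x) := by
        have := hr.1.ne'
        field_simp
        ring
      rw [e1, abs_mul, abs_of_pos (inv_pos.2 hr.1)]
      calc _ ≤ r⁻¹ * (ε * r) := mul_le_mul_of_nonneg_left k (inv_pos.2 hr.1).le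
        _ = ε := by have := hr.1.ne'; field_simp
    have k := Convex.norm_image_sub_le_of_norm_hasDerivWithin_le (𝕜 := ℝ) hder hbd hconv
      ⟨Metric.mem_ball_self hd, h₀⟩ htm
    rw [Real.norm_eq_abs, Real.norm_eq_abs] at k
    convert k using 2
    ring
  filter_upwards [hball] with t htm
  have lim : ∀ t ∈ Set.Icc (0 : ℝ) T, Tendsto (fun r : ℝ => r⁻¹ * (v t (x + r • e) - v t x))
      (nhdsWithin 0 (Set.Ioi 0)) (nhds (spd i v t x)) := by
    intro t ht
    have k := (hasDerivAt_iff_tendsto_slope_zero.1 (hasDerivAt_line (hx t ht) x i 0)).mono_left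
      (nhdsWithin_mono 0 (fun r (hr : 0 < r) => hr.ne' : Set.Ioi (0 : ℝ) ⊆ {0}ᶜ))
    simp only [zero_smul, add_zero, zero_add, smul_eq_mul] at k
    exact k
  have l1 := (((lim t htm.2).sub (lim t₀ h₀)).sub_const (c * (t - t₀))).abs
  rw [smul_eq_mul, Real.norm_eq_abs, Real.norm_eq_abs, mul_comm _ c]
  refine le_of_tendsto l1 ?_
  filter_upwards [Ioo_mem_nhdsGT hd] with r hr using hE r hr t htm

lemma spdL_append (l : List (Fin n)) (i : Fin n) (u : ℝ → Spc n → ℝ) :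
    spdL (l ++ [i]) u = spdL l (spd i u) := by
  simp [spdL]

lemma spdL_congr (h : ∀ t ∈ Set.Icc (0 : ℝ) T, ∀ x, u t x = v t x) (l : List (Fin n)) :
    ∀ t ∈ Set.Icc (0 : ℝ) T, ∀ x, spdL l u t x = spdL l v t x := by
  induction l with
  | nil => exact h
  | cons i l ih => exact spd_congr ih i

/-- All derivatives, taken first in time and then in space, satisfy Hölder bounds. -/
structure Good (T lam : ℝ) (N s : ℕ) (δ : ℝ) (u : ℝ → Spc n → ℝ) (K : ℝ) : Prop where
  hb : ∀ j ≤ s, ∀ l : List (Fin n), l.length + 2 * j ≤ N →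
    HB T lam (δ + l.length) (spdL l (tDeriv T j u)) K
  dx : ∀ j ≤ s, ∀ l : List (Fin n), l.length + 2 * j + 1 ≤ N → ∀ t ∈ Set.Icc (0 : ℝ) T,
    Differentiable ℝ (spdL l (tDeriv T j u) t)
  dt : ∀ j, j + 1 ≤ s → 2 * (j + 1) ≤ N → ∀ x,
    DifferentiableOn ℝ (fun t => tDeriv T j u t x) (Set.Icc 0 T)

lemma Good.hasDerivWithinAt (hl : 0 < lam) (h : Good T lam N s δ u K) {j : ℕ} (hj : j + 1 ≤ s)
    (hN : 2 * (j + 1) + 1 ≤ N) (i : Fin n) {t : ℝ} (ht : t ∈ Set.Icc (0 : ℝ) T) (x : Spc n) :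
    HasDerivWithinAt (fun t => spd i (tDeriv T j u) t x) (spd i (tDeriv T (j + 1) u) t x)
      (Set.Icc 0 T) t := by
  rw [tDeriv_succ']
  refine hasDerivWithinAt_spd i ?_ (h.dt j hj (by omega)) ?_ ?_ ht x
  · exact h.dx j (by omega) [] (by simp; omega)
  · rw [← tDeriv_succ']
    exact h.dx (j + 1) (by omega) [] (by simp; omega)
  · rw [← tDeriv_succ']
    exact (h.hb (j + 1) (by omega) [i] (by simp; omega)).continuousOn hl

lemma Good.tDeriv_spd (hT : 0 < T) (hl : 0 < lam) (h : Good T lam N s δ u K) {j : ℕ} (hj : j ≤ s)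
    (hN : 2 * j + 1 ≤ N) (i : Fin n) :
    ∀ t ∈ Set.Icc (0 : ℝ) T, ∀ x, spd i (tDeriv T j u) t x = tDeriv T j (spd i u) t x := by
  induction j with
  | zero => intro t _ x; rw [tDeriv_zero, tDeriv_zero]
  | succ j ih =>
    intro t ht x
    rw [tDeriv_succ' T j (spd i u), ← tdv_congr (ih (by omega) (by omega)) t ht x]
    exact ((h.hasDerivWithinAt hl hj hN i ht x).derivWithin (uniqueDiffOn_Icc hT t ht)).symm

lemma Good.spd (hT : 0 < T) (hl : 0 < lam) (h : Good T lam N s δ u K) (hN : 1 ≤ N) (i : Fin n) :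
    Good T lam (N - 1) s (δ + 1) (spd i u) K := by
  refine ⟨fun j hj l hlN => ?_, fun j hj l hlN t ht => ?_, fun j hj hjN x => ?_⟩
  · have k := h.hb j hj (l ++ [i]) (by simp; omega)
    rw [spdL_append, List.length_append, List.length_singleton, Nat.cast_add, Nat.cast_one,
      add_comm (l.length : ℝ) 1, ← add_assoc] at k
    exact k.congr (spdL_congr (h.tDeriv_spd hT hl hj (by omega) i) l)
  · have k := h.dx j hj (l ++ [i]) (by simp; omega) t ht
    rw [spdL_append] at k
    rwa [← show _ = NSdeRham.spdL l (tDeriv T j (NSdeRham.spd i u)) t from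
      funext (spdL_congr (h.tDeriv_spd hT hl hj (by omega) i) l t ht)]
  · refine DifferentiableOn.congr (fun t ht =>
      (h.hasDerivWithinAt hl hj (by omega) i ht x).differentiableWithinAt) fun t ht => ?_
    exact (h.tDeriv_spd hT hl (by omega) (by omega) i t ht x).symm

lemma Good.tdv (h : Good T lam N s δ u K) (hN : 2 ≤ N) (hs : 1 ≤ s) :
    Good T lam (N - 2) (s - 1) δ (tdv T u) K := by
  refine ⟨fun j hj l hlN => ?_, fun j hj l hlN t ht => ?_, fun j hj hjN x => ?_⟩
  · rw [← tDeriv_succ]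
    exact h.hb (j + 1) (by omega) l (by omega)
  · rw [← tDeriv_succ]
    exact h.dx (j + 1) (by omega) l (by omega) t ht
  · rw [← tDeriv_succ]
    exact h.dt (j + 1) (by omega) (by omega) x

lemma Good.cls (hT : 0 < T) (hl : 0 < lam) (h : Good T lam N s δ u K) :
    Cls T lam N s δ u K := by
  induction N using Nat.strong_induction_on generalizing s δ u with
  | _ N ih =>
    refine ⟨?_, fun h1 => ?_, fun i h1 => ih (N - 1) (by omega) (h.spd hT hl h1 i),
      fun h1 h2 => ?_, fun h1 h2 => ih (N - 2) (by omega) (h.tdv h1 h2)⟩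
    · have := h.hb 0 (by omega) [] (by simp)
      simpa [tDeriv_zero, NSdeRham.spdL] using this
    · have := h.dx 0 (by omega) [] (by simp; omega)
      simpa [tDeriv_zero, NSdeRham.spdL] using this
    · have := h.dt 0 (by omega) (by omega)
      simpa [tDeriv_zero] using this

lemma contDiff_pdL {f : Spc n → ℝ} {m : ℕ} (l : List (Fin n))
    (hf : ContDiff ℝ ((m + l.length : ℕ)) f) : ContDiff ℝ m (pdL l f) := by
  induction l generalizing m with
  | nil => simpa [pdL] using hf
  | cons i l ih =>
    have k := ih (m := m + 1) (hf.of_le (by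
      exact_mod_cast (by simp; omega : m + 1 + l.length ≤ m + (i :: l).length)))
    push_cast at k
    exact (contDiff_succ_iff_fderiv_apply.1 k).2.2 _

lemma cls_of_aniso (T lam δ : ℝ) (hT : 0 < T) (hl : 0 < lam) (hl1 : lam ≤ 1) (k s : ℕ) :
    ∃ C : ℝ, 0 ≤ C ∧ ∀ (u : ℝ → Spc n → ℝ) (K : ℝ), 0 ≤ K → AnisoReg T k s u →
      eAnisoKS T k s lam δ u ≤ ENNReal.ofReal K → Cls T lam (2 * s + k) s δ u (C * K) := by
  let c : ℕ → ℝ := fun β => 4 * 3 ^ |δ + β| * 3 ^ |δ + β + lam|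
  have hc : ∀ β, 0 ≤ c β := fun β => by positivity
  refine ⟨∑ β ∈ Finset.range (2 * s + k + 1), c β, Finset.sum_nonneg fun _ _ => hc _,
    fun u K hK hreg hu => ?_⟩
  have hcd : ∀ j ≤ s, ∀ t ∈ Set.Icc (0 : ℝ) T,
      ContDiff ℝ ((2 * (s - j) + k : ℕ)) (tDeriv T j u t) := fun j hj t ht => by
    have := hreg.2.1 j hj t ht
    push_cast
    exact this
  refine Good.cls hT hl ⟨fun j hj l hlN => ?_, fun j hj l hlN t ht => ?_, fun j hj hjN x => ?_⟩
  · obtain ⟨b, m, hb, hbm, hm⟩ : ∃ b m, b ≤ k ∧ l.length = b + m ∧ m + 2 * j ≤ 2 * s := by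
      rcases le_total l.length k with h | h
      · exact ⟨l.length, 0, h, rfl, by omega⟩
      · exact ⟨k, l.length - k, le_rfl, by omega, by omega⟩
    have h1 : eAniso0 T lam (δ + b + m) (mixDeriv T (b + m) j u) ≤ ENNReal.ofReal K := by
      refine le_trans ?_ hu
      have e1 := Finset.single_le_sum (f := fun b : ℕ => ∑ m ∈ Finset.range (2 * s + 1),
        ∑ j ∈ Finset.range (s + 1),
        if m + 2 * j ≤ 2 * s then eAniso0 T lam (δ + b + m) (mixDeriv T (b + m) j u) else 0)
        (fun _ _ => zero_le) (Finset.mem_range.2 (by omega : b < k + 1))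
      have e2 := Finset.single_le_sum (f := fun m : ℕ => ∑ j ∈ Finset.range (s + 1),
        if m + 2 * j ≤ 2 * s then eAniso0 T lam (δ + b + m) (mixDeriv T (b + m) j u) else 0)
        (fun _ _ => zero_le) (Finset.mem_range.2 (by omega : m < 2 * s + 1))
      have e3 := Finset.single_le_sum (f := fun j : ℕ =>
        if m + 2 * j ≤ 2 * s then eAniso0 T lam (δ + b + m) (mixDeriv T (b + m) j u) else 0)
        (fun _ _ => zero_le) (Finset.mem_range.2 (by omega : j < s + 1))
      simp only [if_pos hm] at e3
      exact e3.trans (e2.trans e1)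
    have h2 := HB.of_eAniso0_le hl hl1 hK h1
    rw [add_assoc δ, ← Nat.cast_add, ← hbm] at h2
    have h3 : HB T lam (δ + l.length) (spdL l (tDeriv T j u)) (c l.length * K) := by
      have hval : ∀ t ∈ Set.Icc (0 : ℝ) T, ∀ x, spdL l (tDeriv T j u) t x =
          mixDeriv T l.length j u t x fun a => EuclideanSpace.single (l.get a) 1 := by
        intro t ht x
        rw [mixDeriv, iteratedFDeriv_single, List.ofFn_get, spdL_apply]
        exact (hcd j hj t ht).of_le (by exact_mod_cast (by omega))
      refine h2.of_norm_le (fun t ht x => ?_) fun t₁ h₁ t₂ h₂ x y => ?_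
      · rw [hval t ht x]
        exact cmm_abs_apply_le _ _
      · rw [hval t₁ h₁ x, hval t₂ h₂ y, ← sub_apply]
        exact cmm_abs_apply_le _ _
    refine h3.mono le_rfl (mul_le_mul_of_nonneg_right ?_ hK)
    exact Finset.single_le_sum (f := c) (fun _ _ => hc _)
      (Finset.mem_range.2 (by omega : l.length < 2 * s + k + 1))
  · rw [spdL_apply]
    have := contDiff_pdL (m := 1) l ((hcd j hj t ht).of_le
      (by exact_mod_cast (by omega : 1 + l.length ≤ 2 * (s - j) + k)))
    exact this.differentiable (by simp)
  · exact (hreg.1 x).differentiableOn_iteratedDerivWithin (by exact_mod_cast hj)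
      (uniqueDiffOn_Icc hT)

end

section

/-! ### Gaussian kernels -/

/-- Polynomial multiples of the Gaussian `exp (-a |z|²)`. -/
inductive Kf (a : ℝ) : (Spc n → ℝ) → Prop
  | base : Kf a fun z => Real.exp (-a * ‖z‖ ^ 2)
  | coord (i : Fin n) {φ : Spc n → ℝ} : Kf a φ → Kf a fun z => z i * φ z
  | add {φ ψ : Spc n → ℝ} : Kf a φ → Kf a ψ → Kf a fun z => φ z + ψ z
  | smul (c : ℝ) {φ : Spc n → ℝ} : Kf a φ → Kf a fun z => c * φ z

variable {a : ℝ} {φ ψ : Spc n → ℝ}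

lemma Kf.sum {ι : Type*} {S : Finset ι} {Φ : ι → Spc n → ℝ} (hS : S.Nonempty)
    (h : ∀ i ∈ S, Kf a (Φ i)) : Kf a fun z => ∑ i ∈ S, Φ i z := by
  induction hS using Finset.Nonempty.cons_induction with
  | singleton i => simpa using h i (by simp)
  | cons i S hi hS ih =>
    simp only [Finset.sum_cons]
    exact (h i (by simp)).add (ih fun j hj => h j (by simp [hj]))

lemma differentiable_coord (i : Fin n) : Differentiable ℝ fun z : Spc n => z i :=
  (EuclideanSpace.proj i : Spc n →L[ℝ] ℝ).differentiable

lemma pd_coord (i j : Fin n) (z : Spc n) :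
    pd i (fun z => z j) z = if j = i then 1 else 0 := by
  have : (fun z : Spc n => z j) = (EuclideanSpace.proj j : Spc n →L[ℝ] ℝ) := rfl
  rw [pd, this, ContinuousLinearMap.fderiv]
  simp

lemma differentiable_gauss (a : ℝ) : Differentiable ℝ fun z : Spc n => Real.exp (-a * ‖z‖ ^ 2) :=
  ((differentiable_id.norm_sq ℝ).const_mul _).exp

lemma Kf.differentiable (h : Kf a φ) : Differentiable ℝ φ := by
  induction h with
  | base => exact differentiable_gauss a
  | coord i _ ih => exact (differentiable_coord i).mul ih
  | add _ _ ih ih' => exact ih.add ih'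
  | smul c _ ih => exact ih.const_mul c

lemma Kf.continuous (h : Kf a φ) : Continuous φ := h.differentiable.continuous

lemma pd_gauss (a : ℝ) (i : Fin n) (z : Spc n) :
    pd i (fun z => Real.exp (-a * ‖z‖ ^ 2)) z = -2 * a * (z i * Real.exp (-a * ‖z‖ ^ 2)) := by
  have h1 : HasFDerivAt (fun z : Spc n => ‖z‖ ^ 2) (2 • innerSL ℝ z) z := by
    exact (hasStrictFDerivAt_norm_sq z).hasFDerivAt
  have h2 := ((h1.const_mul (-a)).exp)
  rw [pd, h2.fderiv]
  simp only [smul_apply, nsmul_eq_mul, innerSL_apply_apply, smul_eq_mul,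
    EuclideanSpace.inner_single_right]
  simp
  ring

lemma Kf.pd (h : Kf a φ) (i : Fin n) : Kf a (pd i φ) := by
  induction h with
  | base =>
    rw [show NSdeRham.pd i (fun z : Spc n => Real.exp (-a * ‖z‖ ^ 2)) = _ from
      funext (pd_gauss a i)]
    exact (Kf.base.coord i).smul _
  | @coord j φ h ih =>
    have : NSdeRham.pd i (fun z : Spc n => z j * φ z) = fun z =>
        z j * NSdeRham.pd i φ z + (if j = i then 1 else 0) * φ z := by
      funext z
      rw [← pd_coord i j z, NSdeRham.pd, fderiv_fun_mul (differentiable_coord j z)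
        (h.differentiable z)]
      simp only [add_apply, smul_apply, smul_eq_mul, NSdeRham.pd]
      ring
    rw [this]
    exact (ih.coord j).add (h.smul _)
  | @add φ ψ h h' ih ih' =>
    have : NSdeRham.pd i (fun z : Spc n => φ z + ψ z) = fun z =>
        NSdeRham.pd i φ z + NSdeRham.pd i ψ z := by
      funext z
      rw [NSdeRham.pd, fderiv_fun_add (h.differentiable z) (h'.differentiable z)]
      rfl
    rw [this]
    exact ih.add ih'
  | @smul c φ h ih =>
    have : NSdeRham.pd i (fun z : Spc n => c * φ z) = fun z => c * NSdeRham.pd i φ z := by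
      funext z
      rw [NSdeRham.pd, fderiv_const_mul (h.differentiable z)]
      rfl
    rw [this]
    exact ih.smul c

/-- Rapid decay. -/
lemma Kf.decay (ha : 0 < a) (h : Kf a φ) (N : ℕ) :
    ∃ C, 0 ≤ C ∧ ∀ z, |φ z| * (1 + ‖z‖) ^ N ≤ C := by
  induction h generalizing N with
  | base =>
    refine ⟨N.factorial * Real.exp (1 + 1 / (4 * a)), by positivity, fun z => ?_⟩
    have h1 := Real.pow_div_factorial_le_exp (1 + ‖z‖) (by positivity) N
    rw [div_le_iff₀ (by positivity)] at h1
    rw [abs_of_pos (Real.exp_pos _)]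
    calc Real.exp (-a * ‖z‖ ^ 2) * (1 + ‖z‖) ^ N
        ≤ Real.exp (-a * ‖z‖ ^ 2) * (Real.exp (1 + ‖z‖) * N.factorial) := by gcongr
      _ = N.factorial * Real.exp (-a * ‖z‖ ^ 2 + (1 + ‖z‖)) := by
        rw [Real.exp_add (-a * ‖z‖ ^ 2) (1 + ‖z‖)]; ring
      _ ≤ _ := by
        have : 0 ≤ a * (‖z‖ - 1 / (2 * a)) ^ 2 := by positivity
        have e : a * (‖z‖ - 1 / (2 * a)) ^ 2 = a * ‖z‖ ^ 2 - ‖z‖ + 1 / (4 * a) := by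
          field_simp
          ring
        exact mul_le_mul_of_nonneg_left (Real.exp_le_exp.2 (by linarith)) (by positivity)
  | @coord i φ h ih =>
    obtain ⟨C, hC, H⟩ := ih (N + 1)
    refine ⟨C, hC, fun z => le_trans ?_ (H z)⟩
    rw [abs_mul, pow_succ]
    have h1 : |z i| ≤ 1 + ‖z‖ := (coord_abs_le z i).trans (by linarith)
    calc |z i| * |φ z| * (1 + ‖z‖) ^ N ≤ (1 + ‖z‖) * |φ z| * (1 + ‖z‖) ^ N := by gcongr
      _ = _ := by ring
  | @add φ ψ h h' ih ih' =>
    obtain ⟨C, hC, H⟩ := ih N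
    obtain ⟨C', hC', H'⟩ := ih' N
    refine ⟨C + C', by positivity, fun z => le_trans ?_ (add_le_add (H z) (H' z))⟩
    rw [← add_mul]
    gcongr
    exact abs_add_le _ _
  | @smul c φ h ih =>
    obtain ⟨C, hC, H⟩ := ih N
    refine ⟨|c| * C, by positivity, fun z => ?_⟩
    rw [abs_mul, mul_assoc]
    exact mul_le_mul_of_nonneg_left (H z) (abs_nonneg _)

lemma integrable_inv_pow : Integrable fun z : Spc n => ((1 + ‖z‖) ^ (n + 1))⁻¹ := by
  have := integrable_one_add_norm (E := Spc n) (μ := volume) (r := (n + 1 : ℕ)) (by simp)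
  refine this.congr (Eventually.of_forall fun z => ?_)
  simp only
  rw [Real.rpow_neg (by positivity), Real.rpow_natCast]

lemma Kf.integrable_mul (ha : 0 < a) (h : Kf a φ) (r : ℝ) :
    Integrable fun z => |φ z| * (1 + ‖z‖) ^ r := by
  obtain ⟨C, hC, H⟩ := h.decay ha (⌈r⌉₊ + (n + 1))
  refine (integrable_inv_pow.const_mul C).mono' ?_ (Eventually.of_forall fun z => ?_)
  · refine Continuous.aestronglyMeasurable (h.continuous.abs.mul ?_)
    exact (by fun_prop : Continuous fun z : Spc n => 1 + ‖z‖).rpow_const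
      fun z => Or.inl (by positivity)
  · have h1 : (1 + ‖z‖) ^ r ≤ (1 + ‖z‖) ^ ⌈r⌉₊ := by
      rw [← Real.rpow_natCast]
      exact Real.rpow_le_rpow_of_exponent_le (by linarith [norm_nonneg z]) (Nat.le_ceil r)
    rw [Real.norm_eq_abs, abs_of_nonneg (by positivity), ← div_eq_mul_inv,
      le_div_iff₀ (by positivity)]
    refine le_trans ?_ (H z)
    rw [pow_add (1 + ‖z‖) ⌈r⌉₊ (n + 1), ← mul_assoc]
    exact mul_le_mul_of_nonneg_right (mul_le_mul_of_nonneg_left h1 (abs_nonneg _)) (by positivity)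

lemma Kf.integrable (ha : 0 < a) (h : Kf a φ) : Integrable φ := by
  have := h.integrable_mul ha 0
  simp only [Real.rpow_zero, mul_one] at this
  exact (integrable_norm_iff h.continuous.aestronglyMeasurable).1 this

lemma Kf.norm_fderiv_decay (ha : 0 < a) (h : Kf a φ) (N : ℕ) :
    ∃ C, 0 ≤ C ∧ ∀ z, ‖fderiv ℝ φ z‖ * (1 + ‖z‖) ^ N ≤ C := by
  choose C hC H using fun i => (h.pd i).decay ha N
  refine ⟨∑ i, C i, Finset.sum_nonneg fun i _ => hC i, fun z => ?_⟩
  refine (mul_le_mul_of_nonneg_right (norm_fderiv_le_sum_pd φ z) (by positivity)).trans ?_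
  rw [Finset.sum_mul]
  exact Finset.sum_le_sum fun i _ => H i z

lemma Kf.continuous_fderiv (h : Kf a φ) : Continuous (fderiv ℝ φ) := by
  have e : fderiv ℝ φ = fun z => ∑ i, NSdeRham.pd i φ z •
      (EuclideanSpace.proj i : Spc n →L[ℝ] ℝ) := by
    funext z
    ext y
    rw [fderiv_apply_eq_sum_pd]
    simp [mul_comm]
  rw [e]
  exact continuous_finsetSum _ fun i _ => ((h.pd i).continuous).smul continuous_const

/-! ### Scaled convolutions -/

/-- The convolution of `h` with the kernel `ρ^{-n} φ (·/ρ)`. -/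
def Top (φ h : Spc n → ℝ) (ρ : ℝ) (x : Spc n) : ℝ := ∫ z, φ z * h (x - ρ • z)

/-- Bounded continuous functions. -/
structure BC (h : Spc n → ℝ) (B : ℝ) : Prop where
  cont : Continuous h
  bdd : ∀ y, |h y| ≤ B

lemma BC.nonneg {h : Spc n → ℝ} {B : ℝ} (hh : BC h B) : 0 ≤ B := (abs_nonneg _).trans (hh.bdd 0)

variable {h : Spc n → ℝ} {B : ℝ}

lemma Kf.integrable_top (ha : 0 < a) (hφ : Kf a φ) (hh : BC h B) (ρ : ℝ) (x : Spc n) :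
    Integrable fun z => φ z * h (x - ρ • z) := by
  have hc : Continuous fun z => h (x - ρ • z) := hh.cont.comp (by fun_prop)
  exact (hφ.integrable ha).mul_bdd (c := B) hc.aestronglyMeasurable
    (Eventually.of_forall fun z => hh.bdd _)

lemma Top_eq (φ h : Spc n → ℝ) {ρ : ℝ} (hρ : 0 < ρ) (x : Spc n) :
    Top φ h ρ x = (ρ⁻¹) ^ n * ∫ y, φ (ρ⁻¹ • (x - y)) * h y := by
  have h1 := integral_sub_left_eq_self (fun y : Spc n => φ (ρ⁻¹ • y) * h (x - y)) volume x
  simp only [sub_sub_cancel] at h1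
  have h2 := Measure.integral_comp_inv_smul (volume : Measure (Spc n))
    (fun z => φ z * h (x - ρ • z)) ρ
  simp only [smul_inv_smul₀ hρ.ne'] at h2
  rw [h1, h2, Top, finrank_euclideanSpace_fin, smul_eq_mul, abs_of_pos (by positivity), ← mul_assoc,
    ← mul_pow, inv_mul_cancel₀ hρ.ne', one_pow, one_mul]

/-- The Euler derivative `∑ zᵢ ∂ᵢ φ`. -/
def euler (φ : Spc n → ℝ) (z : Spc n) : ℝ := fderiv ℝ φ z z

/-- Joint differentiability in the scale and the space variable. -/
lemma Kf.hasFDerivAt_scaled (ha : 0 < a) (hφ : Kf a φ) (hh : BC h B) {c₀ : ℝ} (hc₀ : 0 < c₀)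
    (x₀ : Spc n) :
    HasFDerivAt (fun p : ℝ × Spc n => ∫ y, φ (p.1 • (p.2 - y)) * h y)
      (∫ y, h y • (fderiv ℝ φ (c₀ • (x₀ - y))).comp
        (c₀ • ContinuousLinearMap.snd ℝ ℝ (Spc n) +
          (ContinuousLinearMap.fst ℝ ℝ (Spc n)).smulRight (x₀ - y))) (c₀, x₀) ∧
    Integrable (fun y => h y • (fderiv ℝ φ (c₀ • (x₀ - y))).comp
        (c₀ • ContinuousLinearMap.snd ℝ ℝ (Spc n) +
          (ContinuousLinearMap.fst ℝ ℝ (Spc n)).smulRight (x₀ - y))) := by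
  obtain ⟨C, hC, H⟩ := hφ.norm_fderiv_decay ha (n + 2)
  set D : ℝ := 2 + 2 * c₀ + 2 / c₀ with hD
  have hDpos : 0 < D := by positivity
  have hB := hh.nonneg
  let S : Set (ℝ × Spc n) := Set.Ioo (c₀ / 2) (2 * c₀) ×ˢ Metric.ball x₀ 1
  have hS : S ∈ nhds (c₀, x₀) :=
    prod_mem_nhds (Ioo_mem_nhds (by linarith) (by linarith)) (Metric.ball_mem_nhds _ one_pos)
  let F' : ℝ × Spc n → Spc n → ((ℝ × Spc n) →L[ℝ] ℝ) := fun p y =>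
    h y • (fderiv ℝ φ (p.1 • (p.2 - y))).comp
      (p.1 • ContinuousLinearMap.snd ℝ ℝ (Spc n) +
        (ContinuousLinearMap.fst ℝ ℝ (Spc n)).smulRight (p.2 - y))
  have hF'c : Continuous (F' (c₀, x₀)) := by
    have := hφ.continuous_fderiv
    have := hh.cont
    have hs : Continuous fun y : Spc n =>
        (ContinuousLinearMap.fst ℝ ℝ (Spc n)).smulRight (x₀ - y) :=
      (ContinuousLinearMap.smulRightL ℝ (ℝ × Spc n) (Spc n)
        (ContinuousLinearMap.fst ℝ ℝ (Spc n))).continuous.comp (by fun_prop)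
    exact hh.cont.smul ((hφ.continuous_fderiv.comp (by fun_prop)).clm_comp
      (continuous_const.add hs))
  have hbound : ∀ y, ∀ p ∈ S, ‖F' p y‖ ≤ B * D ^ (n + 2) * C * ((1 + ‖x₀ - y‖) ^ (n + 1))⁻¹ := by
    rintro y ⟨c, x⟩ ⟨⟨hc1, hc2⟩, hx⟩
    simp only at hc1 hc2 hx
    have hcpos : 0 < c := by linarith
    set Z := ‖c • (x - y)‖ with hZ
    have hZ' : ‖x - y‖ ≤ 2 / c₀ * Z := by
      rw [hZ, norm_smul, Real.norm_eq_abs, abs_of_pos hcpos]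
      have : 1 ≤ 2 / c₀ * c := by
        rw [div_mul_eq_mul_div, le_div_iff₀ hc₀]
        linarith
      calc ‖x - y‖ = 1 * ‖x - y‖ := (one_mul _).symm
        _ ≤ 2 / c₀ * c * ‖x - y‖ := by gcongr
        _ = _ := by ring
    have hZ0 : 0 ≤ Z := norm_nonneg _
    have hq : 0 < 2 / c₀ := by positivity
    have b1 : c + ‖x - y‖ ≤ D * (1 + Z) := by
      rw [hD]
      nlinarith [mul_nonneg hc₀.le hZ0]
    have b2 : 1 + ‖x₀ - y‖ ≤ D * (1 + Z) := by
      have : ‖x₀ - y‖ ≤ 1 + ‖x - y‖ := by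
        have h1 : ‖x - x₀‖ < 1 := by simpa [dist_eq_norm] using hx
        have h2 : x₀ - y = -(x - x₀) + (x - y) := by abel
        rw [h2]
        refine (norm_add_le _ _).trans ?_
        rw [norm_neg]
        linarith
      rw [hD]
      nlinarith [mul_nonneg hc₀.le hZ0]
    have b3 : ‖F' (c, x) y‖ ≤ B * (‖fderiv ℝ φ (c • (x - y))‖ * (c + ‖x - y‖)) := by
      simp only [F']
      rw [norm_smul]
      refine mul_le_mul (hh.bdd y) ?_ (norm_nonneg _) hB
      refine (ContinuousLinearMap.opNorm_comp_le _ _).trans ?_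
      refine mul_le_mul_of_nonneg_left ?_ (norm_nonneg _)
      refine (norm_add_le _ _).trans (add_le_add ?_ ?_)
      · rw [norm_smul, Real.norm_eq_abs, abs_of_pos hcpos]
        exact mul_le_of_le_one_right hcpos.le (ContinuousLinearMap.norm_snd_le _ _ _)
      · rw [ContinuousLinearMap.norm_smulRight_apply]
        exact mul_le_of_le_one_left (norm_nonneg _) (ContinuousLinearMap.norm_fst_le _ _ _)
    rw [← div_eq_mul_inv, le_div_iff₀ (by positivity)]
    calc ‖F' (c, x) y‖ * (1 + ‖x₀ - y‖) ^ (n + 1)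
        ≤ B * (‖fderiv ℝ φ (c • (x - y))‖ * (D * (1 + Z))) * (D * (1 + Z)) ^ (n + 1) := by
          gcongr
          exact b3.trans (by gcongr)
      _ = B * D ^ (n + 2) * (‖fderiv ℝ φ (c • (x - y))‖ * (1 + Z) ^ (n + 2)) := by
          rw [mul_pow, pow_succ D (n + 1), pow_succ (1 + Z) (n + 1)]; ring
      _ ≤ B * D ^ (n + 2) * C := by
          gcongr
          exact H _
  have hbi : Integrable fun y : Spc n =>
      B * D ^ (n + 2) * C * ((1 + ‖x₀ - y‖) ^ (n + 1))⁻¹ :=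
    (integrable_inv_pow.comp_sub_left x₀).const_mul _
  have hFc : ∀ p : ℝ × Spc n, Continuous fun y => φ (p.1 • (p.2 - y)) * h y := fun p =>
    (hφ.continuous.comp (by fun_prop)).mul hh.cont
  refine ⟨hasFDerivAt_integral_of_dominated_of_fderiv_le (F' := F') hS
    (Eventually.of_forall fun p => (hFc p).aestronglyMeasurable) ?_ hF'c.aestronglyMeasurable
    (Eventually.of_forall hbound) hbi (Eventually.of_forall fun y p _ => ?_), ?_⟩
  · have h1 : Integrable fun y => φ (c₀ • (x₀ - y)) :=
      ((hφ.integrable ha).comp_smul hc₀.ne').comp_sub_left x₀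
    exact h1.mul_bdd (c := B) hh.cont.aestronglyMeasurable (Eventually.of_forall hh.bdd)
  · have h1 : HasFDerivAt (fun p : ℝ × Spc n => p.1 • (p.2 - y))
        (p.1 • ContinuousLinearMap.snd ℝ ℝ (Spc n) +
          (ContinuousLinearMap.fst ℝ ℝ (Spc n)).smulRight (p.2 - y)) p :=
      hasFDerivAt_fst.fun_smul (hasFDerivAt_snd.sub_const y)
    exact ((hφ.differentiable _).hasFDerivAt.comp p h1).mul_const (h y)
  · exact hbi.mono' hF'c.aestronglyMeasurable
      (Eventually.of_forall fun y => hbound y (c₀, x₀) (mem_of_mem_nhds hS))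

end

section

variable {a : ℝ} {φ : Spc n → ℝ} {h : Spc n → ℝ} {B : ℝ}

lemma Kf.zero (a : ℝ) : Kf a (fun _ : Spc n => 0) := by
  simpa using (Kf.base (a := a) (n := n)).smul 0

lemma Kf.sum_univ {Φ : Fin n → Spc n → ℝ} (h : ∀ i, Kf a (Φ i)) :
    Kf a fun z => ∑ i, Φ i z := by
  rcases (Finset.univ : Finset (Fin n)).eq_empty_or_nonempty with h0 | h0
  · rw [h0]
    simpa using Kf.zero a
  · exact Kf.sum h0 fun i _ => h i

lemma euler_eq (φ : Spc n → ℝ) : euler φ = fun z => ∑ i, z i * pd i φ z :=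
  funext fun z => fderiv_apply_eq_sum_pd φ z z

lemma Kf.euler (hφ : Kf a φ) : Kf a (euler φ) := by
  rw [euler_eq]
  exact Kf.sum_univ fun i => (hφ.pd i).coord i

/-- The generator of the dilations `ρ^{-n} φ (·/ρ)`. -/
def dil (φ : Spc n → ℝ) (z : Spc n) : ℝ := -(n : ℝ) * φ z + (-1) * euler φ z

lemma Kf.dil (hφ : Kf a φ) : Kf a (dil φ) := (hφ.smul _).add (hφ.euler.smul _)

lemma Top_add {ψ : Spc n → ℝ} (ha : 0 < a) (hφ : Kf a φ) (hψ : Kf a ψ) (hh : BC h B) (ρ : ℝ)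
    (x : Spc n) : Top (fun z => φ z + ψ z) h ρ x = Top φ h ρ x + Top ψ h ρ x := by
  simp only [Top, add_mul]
  exact integral_add (hφ.integrable_top ha hh ρ x) (hψ.integrable_top ha hh ρ x)

lemma Top_smul (c : ℝ) (φ h : Spc n → ℝ) (ρ : ℝ) (x : Spc n) :
    Top (fun z => c * φ z) h ρ x = c * Top φ h ρ x := by
  simp only [Top, mul_assoc]
  exact integral_const_mul _ _

lemma Kf.hasFDerivAt_Top (ha : 0 < a) (hφ : Kf a φ) (hh : BC h B) {ρ : ℝ} (hρ : 0 < ρ)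
    (x : Spc n) : DifferentiableAt ℝ (Top φ h ρ) x ∧
      ∀ i, NSdeRham.pd i (Top φ h ρ) x = ρ⁻¹ * Top (NSdeRham.pd i φ) h ρ x := by
  obtain ⟨h1, h2⟩ := hφ.hasFDerivAt_scaled ha hh (inv_pos.2 hρ) x
  have h3 := (h1.comp x (HasFDerivAt.prodMk (hasFDerivAt_const (ρ⁻¹) x)
    (hasFDerivAt_id x))).const_mul ((ρ⁻¹) ^ n)
  have e : Top φ h ρ = fun x => (ρ⁻¹) ^ n * ((fun p : ℝ × Spc n =>
      ∫ y, φ (p.1 • (p.2 - y)) * h y) ∘ fun x => (ρ⁻¹, id x)) x :=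
    funext fun x => Top_eq φ h hρ x
  replace h3 : HasFDerivAt (Top φ h ρ) _ x :=
    h3.congr_of_eventuallyEq (Eventually.of_forall (congrFun e))
  refine ⟨h3.differentiableAt, fun i => ?_⟩
  rw [NSdeRham.pd, h3.fderiv, Top_eq _ _ hρ]
  simp only [smul_apply, ContinuousLinearMap.comp_apply, ContinuousLinearMap.prod_apply,
    smul_eq_mul]
  rw [ContinuousLinearMap.integral_apply h2, mul_left_comm, ← integral_const_mul ρ⁻¹]
  refine congrArg _ (integral_congr_ae (Eventually.of_forall fun y => ?_))
  simp [NSdeRham.pd]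
  ring

lemma Kf.hasDerivAt_Top (ha : 0 < a) (hφ : Kf a φ) (hh : BC h B) {ρ : ℝ} (hρ : 0 < ρ)
    (x : Spc n) : HasDerivAt (fun r => Top φ h r x) (ρ⁻¹ * Top (NSdeRham.dil φ) h ρ x) ρ := by
  obtain ⟨h1, h2⟩ := hφ.hasFDerivAt_scaled ha hh (inv_pos.2 hρ) x
  have hinv : HasDerivAt (fun r : ℝ => r⁻¹) (-(ρ ^ 2)⁻¹) ρ := hasDerivAt_inv hρ.ne'
  have h3 := h1.comp_hasDerivAt ρ (hinv.prodMk (hasDerivAt_const ρ x))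
  have h4 := (hinv.fun_pow n).mul h3
  have h5 : HasDerivAt (fun r => Top φ h r x) _ ρ := h4.congr_of_eventuallyEq (by
    filter_upwards [lt_mem_nhds hρ] with r hr
    exact Top_eq φ h hr x)
  convert h5 using 1
  have e1 : Top (NSdeRham.dil φ) h ρ x =
      -(n : ℝ) * Top φ h ρ x + (-1) * Top (NSdeRham.euler φ) h ρ x := by
    rw [← Top_smul, ← Top_smul, ← Top_add ha (hφ.smul _) (hφ.euler.smul _) hh]
    rfl
  rw [e1, Top_eq _ _ hρ, Top_eq _ _ hρ, ContinuousLinearMap.integral_apply h2]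
  have e2 : ∀ y, (h y • (fderiv ℝ φ (ρ⁻¹ • (x - y))).comp
        (ρ⁻¹ • ContinuousLinearMap.snd ℝ ℝ (Spc n) +
          (ContinuousLinearMap.fst ℝ ℝ (Spc n)).smulRight (x - y))) (-(ρ ^ 2)⁻¹, 0) =
      -(ρ⁻¹) * (NSdeRham.euler φ (ρ⁻¹ • (x - y)) * h y) := by
    intro y
    simp [NSdeRham.euler]
    field_simp
  simp only [e2]
  rw [integral_const_mul]
  have e3 : (n : ℝ) * (ρ⁻¹) ^ (n - 1) * -(ρ ^ 2)⁻¹ = -(n * (ρ⁻¹) ^ n * ρ⁻¹) := by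
    rcases Nat.eq_zero_or_pos n with h0 | h0
    · simp [h0]
    · obtain ⟨m, rfl⟩ : ∃ m, n = m + 1 := ⟨n - 1, by omega⟩
      simp only [Nat.add_sub_cancel]
      rw [show (ρ ^ 2)⁻¹ = ρ⁻¹ * ρ⁻¹ by rw [sq, mul_inv]]
      ring
  rw [e3]
  simp only [Function.comp]
  ring

lemma Top_one (φ : Spc n → ℝ) (ρ : ℝ) (x : Spc n) : Top φ (fun _ => 1) ρ x = ∫ z, φ z := by
  simp [Top]

lemma BC.one : BC (fun _ : Spc n => (1 : ℝ)) 1 := ⟨continuous_const, fun _ => by simp⟩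

lemma Kf.integral_pd (ha : 0 < a) (hφ : Kf a φ) (i : Fin n) : ∫ z, NSdeRham.pd i φ z = 0 := by
  have h1 := (hφ.hasFDerivAt_Top ha BC.one one_pos 0).2 i
  rw [Top_one, show Top φ (fun _ => 1) 1 = fun _ => ∫ z, φ z from funext (Top_one φ 1)] at h1
  simpa [NSdeRham.pd] using h1.symm

lemma Kf.integral_dil (ha : 0 < a) (hφ : Kf a φ) : ∫ z, NSdeRham.dil φ z = 0 := by
  have h1 := (hφ.hasDerivAt_Top ha BC.one one_pos 0)
  simp only [Top_one] at h1
  simpa using h1.unique (hasDerivAt_const _ _)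

/-- Static sources: the time slices of `HB`. -/
structure SH (lam δ : ℝ) (h : Spc n → ℝ) (K : ℝ) : Prop where
  cont : Continuous h
  sup : ∀ x, |h x| ≤ K * wt x ^ (-δ)
  space : ∀ x y, Near x y → |h x - h y| ≤ K * wt x ^ (-(δ + lam)) * ‖x - y‖ ^ lam

variable {lam δ K : ℝ}

lemma SH.nonneg (hh : SH lam δ h K) : 0 ≤ K := by
  have := (abs_nonneg _).trans (hh.sup 0)
  simpa [wt_zero] using this

lemma SH.bc (hδ : 0 ≤ δ) (hh : SH lam δ h K) : BC h K := by
  refine ⟨hh.cont, fun x => (hh.sup x).trans (mul_le_of_le_one_right hh.nonneg ?_)⟩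
  exact Real.rpow_le_one_of_one_le_of_nonpos (one_le_wt x) (by linarith)

lemma SH.global (hl : 0 < lam) (hl1 : lam ≤ 1) (hδ : 0 ≤ δ) (hh : SH lam δ h K) (x y : Spc n) :
    |h x - h y| ≤ 6 * K * wt x ^ (-(δ + lam)) * ‖x - y‖ ^ lam * (1 + ‖x - y‖) ^ δ := by
  have hK := hh.nonneg
  set d := ‖x - y‖ with hd
  have hd0 : 0 ≤ d := norm_nonneg _
  have hw := wt_rpow_pos (-(δ + lam)) x
  have h1 : 1 ≤ (1 + d) ^ δ := Real.one_le_rpow (by linarith) hδ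
  by_cases hn : Near x y
  · refine (hh.space x y hn).trans ?_
    rw [← hd]
    have hp : 0 ≤ K * wt x ^ (-(δ + lam)) * d ^ lam := by positivity
    nlinarith
  · simp only [Near, not_or, not_le] at hn
    rw [← hd] at hn
    have h2 : |h x - h y| ≤ 2 * K * wt x ^ (-δ) * (1 + d) ^ δ := by
      have h3 := wt_rpow_le (-δ) x y
      rw [abs_neg, abs_of_nonneg hδ, ← hd] at h3
      have h4 := hh.sup x
      have h5 := hh.sup y
      have hw' := wt_rpow_pos (-δ) x
      calc |h x - h y| ≤ |h x| + |h y| := abs_sub _ _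
        _ ≤ K * wt x ^ (-δ) + K * (wt x ^ (-δ) * (1 + d) ^ δ) :=
          add_le_add h4 (h5.trans (mul_le_mul_of_nonneg_left h3 hK))
        _ ≤ K * wt x ^ (-δ) * (1 + d) ^ δ + K * (wt x ^ (-δ) * (1 + d) ^ δ) :=
          add_le_add (le_mul_of_one_le_right (by positivity) h1) le_rfl
        _ = _ := by ring
    have h6 : wt x ^ lam ≤ 3 * d ^ lam := by
      have h7 : wt x ≤ 3 * d := by
        have := wt_le_wt_add 0 x
        rw [wt_zero, zero_sub, norm_neg] at this
        linarith [hn.1, hn.2]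
      calc wt x ^ lam ≤ (3 * d) ^ lam := Real.rpow_le_rpow (wt_pos x).le h7 hl.le
        _ = 3 ^ lam * d ^ lam := Real.mul_rpow (by norm_num) hd0
        _ ≤ 3 ^ (1 : ℝ) * d ^ lam := by
          refine mul_le_mul_of_nonneg_right ?_ (by positivity)
          exact Real.rpow_le_rpow_of_exponent_le (by norm_num) hl1
        _ = _ := by rw [Real.rpow_one]
    have h8 : wt x ^ (-δ) = wt x ^ (-(δ + lam)) * wt x ^ lam := by
      rw [← Real.rpow_add (wt_pos x)]
      congr 1
      ring
    refine h2.trans ?_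
    rw [h8]
    calc 2 * K * (wt x ^ (-(δ + lam)) * wt x ^ lam) * (1 + d) ^ δ
        ≤ 2 * K * (wt x ^ (-(δ + lam)) * (3 * d ^ lam)) * (1 + d) ^ δ := by gcongr
      _ = _ := by ring

lemma one_add_rpow_le {R ρ δ : ℝ} (hρ : 0 ≤ ρ) (hR : ρ ≤ R) (hδ : 0 ≤ δ) (z : Spc n) :
    (1 + ‖ρ • z‖) ^ δ ≤ (1 + R) ^ δ * (1 + ‖z‖) ^ δ := by
  rw [← Real.mul_rpow (by linarith) (by positivity)]
  refine Real.rpow_le_rpow (by positivity) ?_ hδ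
  have e : ‖ρ • z‖ = ρ * ‖z‖ := by rw [norm_smul, Real.norm_eq_abs, abs_of_nonneg hρ]
  rw [e]
  nlinarith [norm_nonneg z, mul_le_mul_of_nonneg_right hR (norm_nonneg z)]

lemma Kf.Top_bound (ha : 0 < a) (hφ : Kf a φ) (hl : 0 < lam) (hl1 : lam ≤ 1) (hδ : 0 ≤ δ) (R : ℝ) :
    ∃ C, 0 ≤ C ∧ ∀ h K, SH lam δ h K → ∀ ρ, 0 < ρ → ρ ≤ R → ∀ x,
      |Top φ h ρ x| ≤ C * K * wt x ^ (-δ) ∧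
      |Top φ h ρ x - (∫ z, φ z) * h x| ≤ C * K * ρ ^ lam * wt x ^ (-(δ + lam)) := by
  set I₁ := ∫ z : Spc n, |φ z| * (1 + ‖z‖) ^ δ
  set I₂ := ∫ z : Spc n, |φ z| * (1 + ‖z‖) ^ (lam + δ)
  have i₁ := hφ.integrable_mul ha δ
  have i₂ := hφ.integrable_mul ha (lam + δ)
  have hI₁ : 0 ≤ I₁ := integral_nonneg fun z => by positivity
  have hI₂ : 0 ≤ I₂ := integral_nonneg fun z => by positivity
  refine ⟨|1 + R| ^ δ * (I₁ + 6 * I₂), by positivity, fun h K hh ρ hρ hR x => ?_⟩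
  have hK := hh.nonneg
  have hR0 : 0 < R := hρ.trans_le hR
  rw [abs_of_pos (by linarith : 0 < 1 + R)]
  have hbc := hh.bc hδ
  have hintg := hφ.integrable_top ha hbc ρ x
  constructor
  · have hw := wt_rpow_pos (-δ) x
    have : |Top φ h ρ x| ≤ ∫ z, (K * wt x ^ (-δ) * (1 + R) ^ δ) * (|φ z| * (1 + ‖z‖) ^ δ) := by
      rw [← Real.norm_eq_abs]
      refine norm_integral_le_of_norm_le (i₁.const_mul _) (Eventually.of_forall fun z => ?_)
      rw [Real.norm_eq_abs, abs_mul]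
      have h1 := hh.sup (x - ρ • z)
      have h2 := wt_rpow_le (-δ) x (x - ρ • z)
      rw [abs_neg, abs_of_nonneg hδ, sub_sub_cancel] at h2
      have h3 := h2.trans (mul_le_mul_of_nonneg_left (one_add_rpow_le hρ.le hR hδ z) hw.le)
      calc |φ z| * |h (x - ρ • z)| ≤ |φ z| *
            (K * (wt x ^ (-δ) * ((1 + R) ^ δ * (1 + ‖z‖) ^ δ))) := by
            gcongr
            exact h1.trans (by gcongr)
        _ = _ := by ring
    refine this.trans ?_
    rw [integral_const_mul]
    have : 0 ≤ K * wt x ^ (-δ) * (1 + R) ^ δ := by positivity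
    calc K * wt x ^ (-δ) * (1 + R) ^ δ * I₁ ≤ K * wt x ^ (-δ) * (1 + R) ^ δ * (I₁ + 6 * I₂) :=
        mul_le_mul_of_nonneg_left (by linarith) this
      _ = _ := by ring
  · have hw := wt_rpow_pos (-(δ + lam)) x
    have e : Top φ h ρ x - (∫ z, φ z) * h x = ∫ z, (φ z * h (x - ρ • z) - φ z * h x) := by
      rw [integral_sub hintg ((hφ.integrable ha).mul_const _), integral_mul_const, Top]
    rw [e]
    have : |∫ z, (φ z * h (x - ρ • z) - φ z * h x)| ≤
        ∫ z, (6 * K * wt x ^ (-(δ + lam)) * ρ ^ lam * (1 + R) ^ δ) *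
          (|φ z| * (1 + ‖z‖) ^ (lam + δ)) := by
      rw [← Real.norm_eq_abs]
      refine norm_integral_le_of_norm_le (i₂.const_mul _) (Eventually.of_forall fun z => ?_)
      rw [Real.norm_eq_abs, ← mul_sub, abs_mul, abs_sub_comm]
      have h1 := hh.global hl hl1 hδ x (x - ρ • z)
      rw [sub_sub_cancel] at h1
      have h2 : ‖ρ • z‖ ^ lam ≤ ρ ^ lam * (1 + ‖z‖) ^ lam := by
        rw [norm_smul, Real.norm_eq_abs, abs_of_pos hρ, Real.mul_rpow hρ.le (norm_nonneg z)]
        refine mul_le_mul_of_nonneg_left ?_ (by positivity)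
        exact Real.rpow_le_rpow (norm_nonneg z) (by linarith) hl.le
      have h3 := one_add_rpow_le hρ.le hR hδ z
      rw [Real.rpow_add (by positivity)]
      calc |φ z| * |h x - h (x - ρ • z)| ≤ |φ z| *
            (6 * K * wt x ^ (-(δ + lam)) * (ρ ^ lam * (1 + ‖z‖) ^ lam) *
              ((1 + R) ^ δ * (1 + ‖z‖) ^ δ)) := by
            gcongr
            exact h1.trans (by gcongr)
        _ = _ := by ring
    refine this.trans ?_
    rw [integral_const_mul]
    have : 0 ≤ K * wt x ^ (-(δ + lam)) * ρ ^ lam * (1 + R) ^ δ := by positivity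
    calc 6 * K * wt x ^ (-(δ + lam)) * ρ ^ lam * (1 + R) ^ δ * I₂ =
        K * wt x ^ (-(δ + lam)) * ρ ^ lam * (1 + R) ^ δ * (6 * I₂) := by ring
      _ ≤ K * wt x ^ (-(δ + lam)) * ρ ^ lam * (1 + R) ^ δ * (I₁ + 6 * I₂) :=
        mul_le_mul_of_nonneg_left (by linarith) this
      _ = _ := by ring

/-- Joint continuity of the scaled convolutions. -/
lemma Kf.continuous_Top (ha : 0 < a) (hφ : Kf a φ) {g : ℝ → Spc n → ℝ}
    (hg : Continuous fun p : ℝ × Spc n => g p.1 p.2) (hB : ∀ t y, |g t y| ≤ B) :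
    Continuous fun p : ℝ × ℝ × Spc n => Top φ (g p.2.1) p.1 p.2.2 := by
  refine continuous_of_dominated (bound := fun z => |φ z| * B) (fun p => ?_) (fun p => ?_) ?_ ?_
  · refine Continuous.aestronglyMeasurable (hφ.continuous.mul ?_)
    exact hg.comp (by fun_prop : Continuous fun z : Spc n => (p.2.1, p.2.2 - p.1 • z))
  · refine Eventually.of_forall fun z => ?_
    rw [Real.norm_eq_abs, abs_mul]
    exact mul_le_mul_of_nonneg_left (hB _ _) (abs_nonneg _)
  · exact (hφ.integrable ha).abs.mul_const B
  · refine Eventually.of_forall fun z => continuous_const.mul ?_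
    exact hg.comp (by fun_prop : Continuous fun p : ℝ × ℝ × Spc n => (p.2.1, p.2.2 - p.1 • z))

end

section

/-! ### Singular integrals in time -/

lemma exists_min_majorant {b : ℝ} (hb : 0 < b) (hb1 : b < 1 / 2) {d : ℝ} (hd : 0 < d) :
    ∃ m : ℝ → ℝ, Integrable m ∧ (∀ r, 0 ≤ m r) ∧
      (∀ r, 0 < r → ∀ y, y ≤ 2 * r ^ (b - 1) → y ≤ d * r ^ (b - 3 / 2) → y ≤ m r) ∧
      ∫ r, m r = (2 / b + 1 / (1 / 2 - b)) * d ^ (2 * b) := by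
  have hd2 : 0 < d ^ 2 := by positivity
  let m₁ : ℝ → ℝ := (Set.Ioc 0 (d ^ 2)).indicator fun r => 2 * r ^ (b - 1)
  let m₂ : ℝ → ℝ := (Set.Ioi (d ^ 2)).indicator fun r => d * r ^ (b - 3 / 2)
  have i₁ : Integrable m₁ := by
    rw [integrable_indicator_iff measurableSet_Ioc]
    have := (intervalIntegral.intervalIntegrable_rpow' (a := 0) (b := d ^ 2)
      (show -1 < b - 1 by linarith)).1
    exact this.const_mul 2
  have i₂ : Integrable m₂ := by
    rw [integrable_indicator_iff measurableSet_Ioi]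
    exact (integrableOn_Ioi_rpow_of_lt (by linarith) hd2).const_mul d
  have n₁ : ∀ r, 0 ≤ m₁ r := fun r => Set.indicator_nonneg (fun r hr => by
    have := hr.1; positivity) r
  have n₂ : ∀ r, 0 ≤ m₂ r := fun r => Set.indicator_nonneg (fun r hr => by
    have : 0 < r := hd2.trans hr
    positivity) r
  refine ⟨fun r => m₁ r + m₂ r, i₁.add i₂, fun r => add_nonneg (n₁ r) (n₂ r),
    fun r hr y h1 h2 => ?_, ?_⟩
  · by_cases h : r ≤ d ^ 2
    · have : m₁ r = 2 * r ^ (b - 1) :=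
        Set.indicator_of_mem (show r ∈ Set.Ioc 0 (d ^ 2) from ⟨hr, h⟩) _
      linarith [n₂ r]
    · have : m₂ r = d * r ^ (b - 3 / 2) :=
        Set.indicator_of_mem (show r ∈ Set.Ioi (d ^ 2) from not_le.1 h) _
      linarith [n₁ r]
  · rw [integral_add i₁ i₂, integral_indicator measurableSet_Ioc,
      integral_indicator measurableSet_Ioi, integral_const_mul, integral_const_mul,
      integral_Ioi_rpow_of_lt (by linarith) hd2, ← intervalIntegral.integral_of_le hd2.le,
      integral_rpow (Or.inl (by linarith)), Real.zero_rpow (by linarith)]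
    have e1 : (d ^ 2) ^ (b - 1 + 1) = d ^ (2 * b) := by
      rw [← Real.rpow_natCast, ← Real.rpow_mul hd.le]
      congr 1
      push_cast
      ring
    have e2 : d * (d ^ 2) ^ (b - 3 / 2 + 1) = d ^ (2 * b) := by
      rw [← Real.rpow_natCast, ← Real.rpow_mul hd.le, ← Real.rpow_one_add' hd.le]
      · congr 1
        push_cast
        ring
      · push_cast
        intro h
        linarith
    rw [e1, show d * (-(d ^ 2) ^ (b - 3 / 2 + 1) / (b - 3 / 2 + 1)) =
      d * (d ^ 2) ^ (b - 3 / 2 + 1) * (1 / (1 / 2 - b)) by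
        rw [show b - 3 / 2 + 1 = -(1 / 2 - b) by ring, neg_div_neg_eq]; ring, e2]
    rw [show b - 1 + 1 = b by ring]
    ring

lemma singular_integral_le {b : ℝ} (hb : 0 < b) (hb1 : b < 1 / 2) :
    ∃ C, 0 ≤ C ∧ ∀ (c t d M : ℝ) (f : ℝ → ℝ), 0 < d → 0 ≤ M →
      (∀ τ ∈ Set.Ioo c t, |f τ| ≤ M * (2 * (t - τ) ^ (b - 1))) →
      (∀ τ ∈ Set.Ioo c t, |f τ| ≤ M * (d * (t - τ) ^ (b - 3 / 2))) →
      |∫ τ in Set.Ioo c t, f τ| ≤ C * M * d ^ (2 * b) := by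
  have hb2 : 0 < 1 / 2 - b := by linarith
  refine ⟨2 / b + 1 / (1 / 2 - b), by positivity, fun c t d M f hd hM h1 h2 => ?_⟩
  obtain ⟨m, im, nm, hm, hI⟩ := exists_min_majorant hb hb1 hd
  have im' : Integrable fun τ => M * m (t - τ) := (im.comp_sub_left t).const_mul M
  have h3 : ‖∫ τ in Set.Ioo c t, f τ‖ ≤ ∫ τ in Set.Ioo c t, M * m (t - τ) := by
    refine norm_integral_le_of_norm_le im'.integrableOn ?_
    refine (ae_restrict_iff' measurableSet_Ioo).2 (Eventually.of_forall fun τ hτ => ?_)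
    rcases hM.eq_or_lt with h0 | h0
    · simpa [← h0] using h1 τ hτ
    · rw [Real.norm_eq_abs, ← div_le_iff₀' h0]
      refine hm _ (by linarith [hτ.2]) _ ?_ ?_
      · exact (div_le_iff₀' h0).2 (h1 τ hτ)
      · exact (div_le_iff₀' h0).2 (h2 τ hτ)
  refine h3.trans ((setIntegral_le_integral im' (Eventually.of_forall fun τ =>
    mul_nonneg hM (nm _))).trans ?_)
  rw [integral_const_mul, integral_sub_left_eq_self, hI]
  exact le_of_eq (by ring)

lemma integrableOn_singular {b : ℝ} (hb : 0 < b) (c t : ℝ) :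
    IntegrableOn (fun τ => (t - τ) ^ (b - 1)) (Set.Ioo c t) := by
  rcases le_or_gt t c with h | h
  · simp [Set.Ioo_eq_empty (not_lt.2 h)]
  have := (intervalIntegral.intervalIntegrable_rpow' (a := 0) (b := t - c)
      (show -1 < b - 1 by linarith)).comp_sub_left t
  simp only [sub_zero, sub_sub_cancel] at this
  exact this.symm.1.mono_set Set.Ioo_subset_Ioc_self

/-! ### Pointwise bounds for the kernels -/

variable {a : ℝ} {φ : Spc n → ℝ} {h : Spc n → ℝ} {B : ℝ} {lam δ K e : ℝ} {p : ℕ}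

/-- The scaled convolution with the additional singular factor `ρ^{-p}`. -/
def Bk (p : ℕ) (φ h : Spc n → ℝ) (ρ : ℝ) (x : Spc n) : ℝ := (ρ⁻¹) ^ p * Top φ h ρ x

/-- The admissible combinations of singularity and weight. -/
def Adm (p : ℕ) (φ : Spc n → ℝ) (lam δ e : ℝ) : Prop :=
  (p ≤ 1 ∧ e = δ) ∨ (p = 2 ∧ e = δ + lam ∧ ∫ z, φ z = 0)

lemma Adm.of_integral (h : Adm p φ lam δ e) {ψ : Spc n → ℝ}
    (hψ : ∫ z, φ z = 0 → ∫ z, ψ z = 0) : Adm p ψ lam δ e := by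
  rcases h with h | ⟨h1, h2, h3⟩
  · exact Or.inl h
  · exact Or.inr ⟨h1, h2, hψ h3⟩

lemma Kf.Bk_bound (ha : 0 < a) (hφ : Kf a φ) (hl : 0 < lam) (hl1 : lam ≤ 1) (hδ : 0 ≤ δ)
    (hadm : Adm p φ lam δ e) {R : ℝ} (hR : 0 < R) :
    ∃ C, 0 ≤ C ∧ ∀ h K, SH lam δ h K → ∀ ρ, 0 < ρ → ρ ≤ R → ∀ x,
      |Bk p φ h ρ x| ≤ C * K * wt x ^ (-e) * ρ ^ (lam - 2) := by
  obtain ⟨C, hC, H⟩ := hφ.Top_bound ha hl hl1 hδ R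
  refine ⟨C * (1 + R ^ (2 - lam - p)), by positivity, fun h K hh ρ hρ hρR x => ?_⟩
  have hK := hh.nonneg
  have hw := wt_rpow_pos (-e) x
  obtain ⟨h1, h2⟩ := H h K hh ρ hρ hρR x
  rw [Bk, abs_mul, abs_of_pos (by positivity)]
  rcases hadm with ⟨hp, he⟩ | ⟨hp, he, h0⟩
  · subst he
    have h3 : (ρ⁻¹) ^ p ≤ R ^ (2 - lam - p) * ρ ^ (lam - 2) := by
      have hp' : (p : ℝ) ≤ 1 := by exact_mod_cast hp
      calc (ρ⁻¹) ^ p = ρ ^ (2 - lam - p) * ρ ^ (lam - 2) := by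
            rw [← Real.rpow_add hρ, ← Real.rpow_natCast, ← Real.rpow_neg_one, ← Real.rpow_mul hρ.le]
            congr 1
            ring
        _ ≤ _ := by
            refine mul_le_mul_of_nonneg_right ?_ (by positivity)
            exact Real.rpow_le_rpow hρ.le hρR (by linarith)
    calc (ρ⁻¹) ^ p * |Top φ h ρ x| ≤ (R ^ (2 - lam - p) * ρ ^ (lam - 2)) * (C * K * wt x ^ (-e)) :=
          mul_le_mul h3 h1 (abs_nonneg _) (by positivity)
      _ = C * R ^ (2 - lam - p) * K * wt x ^ (-e) * ρ ^ (lam - 2) := by ring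
      _ ≤ _ := by
        refine mul_le_mul_of_nonneg_right (mul_le_mul_of_nonneg_right
          (mul_le_mul_of_nonneg_right ?_ hK) hw.le) (by positivity)
        exact mul_le_mul_of_nonneg_left (by linarith) hC
  · subst hp he
    rw [h0, zero_mul, sub_zero] at h2
    have h3 : (ρ⁻¹) ^ 2 * ρ ^ lam = ρ ^ (lam - 2) := by
      rw [← Real.rpow_natCast, ← Real.rpow_neg_one, ← Real.rpow_mul hρ.le, ← Real.rpow_add hρ]
      congr 1
      push_cast
      ring
    calc (ρ⁻¹) ^ 2 * |Top φ h ρ x| ≤ (ρ⁻¹) ^ 2 * (C * K * ρ ^ lam * wt x ^ (-(δ + lam))) :=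
          mul_le_mul_of_nonneg_left h2 (by positivity)
      _ = C * K * wt x ^ (-(δ + lam)) * ((ρ⁻¹) ^ 2 * ρ ^ lam) := by ring
      _ ≤ _ := by
        rw [h3]
        refine mul_le_mul_of_nonneg_right (mul_le_mul_of_nonneg_right
          (mul_le_mul_of_nonneg_right ?_ hK) hw.le) (by positivity)
        exact le_mul_of_one_le_right hC (by linarith [Real.rpow_nonneg hR.le (2 - lam - (2 : ℕ))])

lemma rpow_sub_three {ρ : ℝ} (hρ : 0 < ρ) (lam : ℝ) : ρ⁻¹ * ρ ^ (lam - 2) = ρ ^ (lam - 3) := by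
  rw [← Real.rpow_neg_one, ← Real.rpow_add hρ]
  congr 1
  ring

lemma Kf.hasDerivAt_Bk (ha : 0 < a) (hφ : Kf a φ) (hh : BC h B) {ρ : ℝ} (hρ : 0 < ρ) (x : Spc n) :
    HasDerivAt (fun r => Bk p φ h r x)
      (ρ⁻¹ * Bk p (fun z => NSdeRham.dil φ z + (-p : ℝ) * φ z) h ρ x) ρ := by
  have hinv : HasDerivAt (fun r : ℝ => r⁻¹) (-(ρ ^ 2)⁻¹) ρ := hasDerivAt_inv hρ.ne'
  have h1 := (hinv.fun_pow p).fun_mul (hφ.hasDerivAt_Top ha hh hρ x)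
  refine h1.congr_deriv ?_
  rw [Bk, Top_add ha hφ.dil (hφ.smul _) hh, Top_smul]
  have e3 : (p : ℝ) * (ρ⁻¹) ^ (p - 1) * -(ρ ^ 2)⁻¹ = -(p * (ρ⁻¹) ^ p * ρ⁻¹) := by
    rcases Nat.eq_zero_or_pos p with h0 | h0
    · simp [h0]
    · obtain ⟨m, rfl⟩ : ∃ m, p = m + 1 := ⟨p - 1, by omega⟩
      simp only [Nat.add_sub_cancel]
      rw [show (ρ ^ 2)⁻¹ = ρ⁻¹ * ρ⁻¹ by rw [sq, mul_inv]]
      ring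
  rw [e3]
  ring

lemma Kf.hasFDerivAt_Bk (ha : 0 < a) (hφ : Kf a φ) (hh : BC h B) {ρ : ℝ} (hρ : 0 < ρ) (x : Spc n) :
    DifferentiableAt ℝ (Bk p φ h ρ) x ∧
      ∀ i, NSdeRham.pd i (Bk p φ h ρ) x = ρ⁻¹ * Bk p (NSdeRham.pd i φ) h ρ x := by
  obtain ⟨h1, h2⟩ := hφ.hasFDerivAt_Top ha hh hρ x
  refine ⟨h1.const_mul _, fun i => ?_⟩
  have := h2 i
  rw [NSdeRham.pd] at this ⊢
  have e : Bk p φ h ρ = fun x => (ρ⁻¹) ^ p * Top φ h ρ x := rfl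
  rw [e, fderiv_const_mul h1, smul_apply, this, Bk, smul_eq_mul]
  ring

lemma Kf.Bk_diff_scale (ha : 0 < a) (hφ : Kf a φ) (hl : 0 < lam) (hl1 : lam ≤ 1) (hδ : 0 ≤ δ)
    (hadm : Adm p φ lam δ e) {R : ℝ} (hR : 0 < R) :
    ∃ C, 0 ≤ C ∧ ∀ h K, SH lam δ h K → ∀ ρ ρ', 0 < ρ → ρ ≤ ρ' → ρ' ≤ R → ∀ x,
      |Bk p φ h ρ' x - Bk p φ h ρ x| ≤
        C * K * wt x ^ (-e) * ((ρ' - ρ) * ρ ^ (lam - 3)) := by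
  have hψ : Kf a fun z => NSdeRham.dil φ z + (-p : ℝ) * φ z := hφ.dil.add (hφ.smul _)
  obtain ⟨C, hC, H⟩ := hψ.Bk_bound ha hl hl1 hδ (hadm.of_integral fun h0 => by
    rw [integral_add (hφ.dil.integrable ha) ((hφ.integrable ha).const_mul _), hφ.integral_dil ha,
      integral_const_mul, h0]
    simp) hR
  refine ⟨C, hC, fun h K hh ρ ρ' hρ hρρ' hR' x => ?_⟩
  have hK := hh.nonneg
  have hw := wt_rpow_pos (-e) x
  have := (convex_Icc ρ ρ').norm_image_sub_le_of_norm_hasDerivWithin_le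
    (f := fun r => Bk p φ h r x) (C := C * K * wt x ^ (-e) * ρ ^ (lam - 3)) (fun r hr =>
      (hφ.hasDerivAt_Bk ha (hh.bc hδ) (hρ.trans_le hr.1) x).hasDerivWithinAt) (fun r hr => ?_)
      (Set.left_mem_Icc.2 hρρ') (Set.right_mem_Icc.2 hρρ')
  · simp only [Real.norm_eq_abs, abs_of_nonneg (sub_nonneg.2 hρρ')] at this
    refine this.trans (le_of_eq (by ring))
  · have hr0 : 0 < r := hρ.trans_le hr.1
    rw [Real.norm_eq_abs, abs_mul, abs_of_pos (inv_pos.2 hr0)]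
    calc r⁻¹ * |Bk p (fun z => NSdeRham.dil φ z + (-p : ℝ) * φ z) h r x|
        ≤ r⁻¹ * (C * K * wt x ^ (-e) * r ^ (lam - 2)) :=
          mul_le_mul_of_nonneg_left (H h K hh r hr0 (hr.2.trans hR') x) (by positivity)
      _ = C * K * wt x ^ (-e) * (r⁻¹ * r ^ (lam - 2)) := by ring
      _ ≤ _ := by
        rw [rpow_sub_three hr0]
        refine mul_le_mul_of_nonneg_left ?_ (by positivity)
        exact Real.rpow_le_rpow_of_nonpos hρ hr.1 (by linarith)

lemma Kf.fderiv_Bk_bound (ha : 0 < a) (hφ : Kf a φ) (hl : 0 < lam) (hl1 : lam ≤ 1) (hδ : 0 ≤ δ)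
    (hadm : Adm p φ lam δ e) {R : ℝ} (hR : 0 < R) :
    ∃ C, 0 ≤ C ∧ ∀ h K, SH lam δ h K → ∀ ρ, 0 < ρ → ρ ≤ R → ∀ x,
      ‖fderiv ℝ (Bk p φ h ρ) x‖ ≤ C * K * wt x ^ (-e) * ρ ^ (lam - 3) := by
  choose C hC H using fun i => (hφ.pd i).Bk_bound ha hl hl1 hδ (hadm.of_integral fun _ =>
    hφ.integral_pd ha i) hR
  refine ⟨∑ i, C i, Finset.sum_nonneg fun i _ => hC i, fun h K hh ρ hρ hρR x => ?_⟩
  refine (norm_fderiv_le_sum_pd _ x).trans ?_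
  simp only [Finset.sum_mul]
  refine Finset.sum_le_sum fun i _ => ?_
  rw [(hφ.hasFDerivAt_Bk ha (hh.bc hδ) hρ x).2 i, abs_mul, abs_of_pos (inv_pos.2 hρ),
    ← rpow_sub_three hρ]
  calc _ ≤ ρ⁻¹ * _ := mul_le_mul_of_nonneg_left (H i h K hh ρ hρ hρR x) (by positivity)
    _ = _ := by ring

lemma Kf.Bk_diff_space (ha : 0 < a) (hφ : Kf a φ) (hl : 0 < lam) (hl1 : lam ≤ 1) (hδ : 0 ≤ δ)
    (hadm : Adm p φ lam δ e) {R : ℝ} (hR : 0 < R) :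
    ∃ C, 0 ≤ C ∧ ∀ h K, SH lam δ h K → ∀ ρ, 0 < ρ → ρ ≤ R → ∀ x y, ‖x - y‖ ≤ 1 →
      |Bk p φ h ρ x - Bk p φ h ρ y| ≤
        C * K * wt x ^ (-e) * (‖x - y‖ * ρ ^ (lam - 3)) := by
  obtain ⟨C, hC, H⟩ := hφ.fderiv_Bk_bound ha hl hl1 hδ hadm hR
  refine ⟨C * 2 ^ |(-e)|, by positivity, fun h K hh ρ hρ hρR x y hxy => ?_⟩
  have hK := hh.nonneg
  have hw := wt_rpow_pos (-e) x
  have := (convex_closedBall x 1).norm_image_sub_le_of_norm_fderiv_le (𝕜 := ℝ)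
    (f := Bk p φ h ρ) (C := C * 2 ^ |(-e)| * K * wt x ^ (-e) * ρ ^ (lam - 3))
    (fun z _ => (hφ.hasFDerivAt_Bk ha (hh.bc hδ) hρ z).1) (fun z hz => ?_)
    (show y ∈ Metric.closedBall x 1 by
      rwa [Metric.mem_closedBall, dist_eq_norm, norm_sub_rev])
    (Metric.mem_closedBall_self one_pos.le)
  · rw [Real.norm_eq_abs] at this
    exact this.trans (le_of_eq (by ring))
  · refine (H h K hh ρ hρ hρR z).trans ?_
    have hz' : Near x z := Or.inl (by rwa [Metric.mem_closedBall, dist_eq_norm, norm_sub_rev] at hz)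
    have := hz'.wt_rpow_le (-e)
    calc C * K * wt z ^ (-e) * ρ ^ (lam - 3)
        ≤ C * K * (wt x ^ (-e) * 2 ^ |(-e)|) * ρ ^ (lam - 3) := by gcongr
      _ = _ := by ring

end

section

/-! ### Parabolic potentials with singular kernels -/

variable {a : ℝ} {φ : Spc n → ℝ} {h : Spc n → ℝ} {lam δ K e T : ℝ} {p : ℕ} {g : ℝ → Spc n → ℝ}

/-- Time-dependent sources defined for all times. -/
structure Src (lam δ : ℝ) (g : ℝ → Spc n → ℝ) (K : ℝ) : Prop where
  cont : Continuous fun q : ℝ × Spc n => g q.1 q.2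
  slice : ∀ τ, SH lam δ (g τ) K

/-- The potential with kernel `r^{-p/2} φ(·/√r)`, `r = t - τ`. -/
def Vp (p : ℕ) (φ : Spc n → ℝ) (g : ℝ → Spc n → ℝ) (t : ℝ) (x : Spc n) : ℝ :=
  ∫ τ in Set.Ioo 0 t, Bk p φ (g τ) (√(t - τ)) x

lemma sqrt_rpow {r : ℝ} (hr : 0 ≤ r) (e : ℝ) : (√r) ^ e = r ^ (e / 2) := by
  rw [Real.sqrt_eq_rpow, ← Real.rpow_mul hr]
  congr 1
  ring

lemma sqrt_rpow_two {r : ℝ} (hr : 0 ≤ r) (lam : ℝ) : (√r) ^ (lam - 2) = r ^ (lam / 2 - 1) := by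
  rw [sqrt_rpow hr]
  congr 1
  ring

lemma sqrt_rpow_three {r : ℝ} (hr : 0 ≤ r) (lam : ℝ) :
    (√r) ^ (lam - 3) = r ^ (lam / 2 - 3 / 2) := by
  rw [sqrt_rpow hr]
  congr 1
  ring

lemma rpow_eq_sqrt_mul {r : ℝ} (hr : 0 < r) (lam : ℝ) :
    r ^ (lam / 2 - 1) = √r * r ^ (lam / 2 - 3 / 2) := by
  rw [Real.sqrt_eq_rpow, ← Real.rpow_add hr]
  congr 1
  ring

lemma Kf.continuousOn_Bk (ha : 0 < a) (hφ : Kf a φ) (hδ : 0 ≤ δ) (hg : Src lam δ g K)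
    (x : Spc n) : ContinuousOn (fun q : ℝ × ℝ => Bk p φ (g q.2) (√q.1) x)
      (Set.Ioi 0 ×ˢ Set.univ) := by
  have h1 := hφ.continuous_Top ha hg.cont fun t y => ((hg.slice t).bc hδ).bdd y
  refine ContinuousOn.mul (ContinuousOn.pow (ContinuousOn.inv₀ (by fun_prop) ?_) _) ?_
  · rintro ⟨r, τ⟩ ⟨hr, -⟩
    exact (Real.sqrt_pos.2 hr).ne'
  · exact (h1.comp (by fun_prop : Continuous fun q : ℝ × ℝ => (√q.1, q.2, x))).continuousOn

lemma Kf.integrableOn_Bk (ha : 0 < a) (hφ : Kf a φ) (hl : 0 < lam) (hl1 : lam ≤ 1) (hδ : 0 ≤ δ)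
    (hadm : Adm p φ lam δ e) (hg : Src lam δ g K) {c t t' : ℝ} (htt : t ≤ t') (x : Spc n) :
    IntegrableOn (fun τ => Bk p φ (g τ) (√(t' - τ)) x) (Set.Ioo c t) := by
  obtain ⟨C, hC, H⟩ := hφ.Bk_bound ha hl hl1 hδ hadm (R := 1 + √(t' - c)) (by positivity)
  have h0 : IntegrableOn (fun τ => C * K * wt x ^ (-e) * (t' - τ) ^ (lam / 2 - 1))
    (Set.Ioo c t') := (integrableOn_singular (half_pos hl) c t').const_mul _
  have h1 := h0.mono_set (Set.Ioo_subset_Ioo_right htt)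
  refine Integrable.mono' h1 ?_ ?_
  · refine ContinuousOn.aestronglyMeasurable ?_ measurableSet_Ioo
    refine (hφ.continuousOn_Bk (p := p) ha hδ hg x).comp
      (by fun_prop : ContinuousOn (fun τ => (t' - τ, τ)) _) fun τ hτ => ⟨?_, trivial⟩
    simp only [Set.mem_Ioi]
    linarith [hτ.2]
  · refine (ae_restrict_iff' measurableSet_Ioo).2 (Eventually.of_forall fun τ hτ => ?_)
    have hr : 0 < t' - τ := by linarith [hτ.2]
    rw [← sqrt_rpow_two hr.le]
    refine H _ _ (hg.slice τ) _ (Real.sqrt_pos.2 hr) ?_ x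
    have : √(t' - τ) ≤ √(t' - c) := Real.sqrt_le_sqrt (by linarith [hτ.1])
    linarith

/-- The basic Schauder estimate. -/
theorem Kf.hb_Vp (ha : 0 < a) (hφ : Kf a φ) (hT : 0 < T) (hl : 0 < lam) (hl1 : lam < 1)
    (hδ : 0 ≤ δ) (hadm : Adm p φ lam δ e) {δ' : ℝ} (hδ' : δ' + lam ≤ e) :
    ∃ C, 0 ≤ C ∧ ∀ g K, Src lam δ g K → HB T lam δ' (Vp p φ g) (C * K) := by
  have hR : 0 < √T := Real.sqrt_pos.2 hT
  obtain ⟨C₀, hC₀, H₀⟩ := singular_integral_le (half_pos hl) (by linarith : lam / 2 < 1 / 2)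
  rw [show 2 * (lam / 2) = lam by ring] at H₀
  obtain ⟨C₁, hC₁, H₁⟩ := hφ.Bk_bound ha hl hl1.le hδ hadm hR
  obtain ⟨C₂, hC₂, H₂⟩ := hφ.Bk_diff_scale ha hl hl1.le hδ hadm hR
  obtain ⟨C₃, hC₃, H₃⟩ := hφ.Bk_diff_space ha hl hl1.le hδ hadm hR
  set D := 1 + (2 : ℝ) ^ |(-e)| with hD
  have hD1 : 1 ≤ D := by
    have : 0 < (2 : ℝ) ^ |(-e)| := by positivity
    linarith
  have hTl : 0 < (√T) ^ lam := by positivity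
  refine ⟨C₀ * ((1 + (√T) ^ lam) * C₁ * D + C₃ + 2 * (C₁ + C₂)), by positivity,
    fun g K hg => ?_⟩
  have hK := (hg.slice 0).nonneg
  have hsqrt : ∀ t ∈ Set.Icc (0 : ℝ) T, ∀ τ, 0 ≤ τ → √(t - τ) ≤ √T := fun t ht τ hτ =>
    Real.sqrt_le_sqrt (by linarith [ht.2])
  have bnd : ∀ t ∈ Set.Icc (0 : ℝ) T, ∀ τ, 0 ≤ τ → τ < t → ∀ x,
      |Bk p φ (g τ) (√(t - τ)) x| ≤ C₁ * K * wt x ^ (-e) * (t - τ) ^ (lam / 2 - 1) := by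
    intro t ht τ h0 hτ x
    have hr : 0 < t - τ := by linarith
    rw [← sqrt_rpow_two hr.le]
    exact H₁ _ _ (hg.slice τ) _ (Real.sqrt_pos.2 hr) (hsqrt t ht τ h0) x
  have rp : ∀ r : ℝ, 0 < r → 0 ≤ r ^ (lam / 2 - 1) := fun r hr => by positivity
  have sup : ∀ t ∈ Set.Icc (0 : ℝ) T, ∀ x,
      |Vp p φ g t x| ≤ C₀ * (C₁ * K * wt x ^ (-e)) * (√T) ^ lam := by
    intro t ht x
    have hw := wt_rpow_pos (-e) x
    refine H₀ 0 t (√T) _ _ hR (by positivity) (fun τ hτ => ?_) fun τ hτ => ?_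
    · refine (bnd t ht τ hτ.1.le hτ.2 x).trans (mul_le_mul_of_nonneg_left ?_ (by positivity))
      linarith [rp (t - τ) (by linarith [hτ.2])]
    · refine (bnd t ht τ hτ.1.le hτ.2 x).trans (mul_le_mul_of_nonneg_left ?_ (by positivity))
      have hr : 0 < t - τ := by linarith [hτ.2]
      rw [rpow_eq_sqrt_mul hr]
      exact mul_le_mul_of_nonneg_right (hsqrt t ht τ hτ.1.le) (by positivity)
  have near : ∀ x y : Spc n, Near x y → wt x ^ (-e) + wt y ^ (-e) ≤ wt x ^ (-e) * D := by
    intro x y hxy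
    have := hxy.wt_rpow_le (-e)
    rw [hD, mul_add, mul_one]
    linarith
  refine ⟨by positivity, fun t ht x => ?_, fun t ht x y hxy => ?_, ?_⟩
  · have hw := wt_rpow_pos (-e) x
    rw [Real.norm_eq_abs]
    calc |Vp p φ g t x| ≤ C₀ * (C₁ * K * wt x ^ (-e)) * (√T) ^ lam := sup t ht x
      _ = C₀ * ((√T) ^ lam * C₁ * 1) * K * wt x ^ (-e) := by ring
      _ ≤ C₀ * ((1 + (√T) ^ lam) * C₁ * D + C₃ + 2 * (C₁ + C₂)) * K * wt x ^ (-δ') := by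
        refine mul_le_mul (mul_le_mul_of_nonneg_right (mul_le_mul_of_nonneg_left ?_ hC₀) hK)
          (wt_rpow_mono (by linarith) x) hw.le (by positivity)
        have : (√T) ^ lam * C₁ * 1 ≤ (1 + (√T) ^ lam) * C₁ * D :=
          mul_le_mul (mul_le_mul_of_nonneg_right (by linarith) hC₁) hD1 zero_le_one (by positivity)
        linarith
  · have hw := wt_rpow_pos (-e) x
    have hw' : wt x ^ (-e) ≤ wt x ^ (-(δ' + lam)) := wt_rpow_mono (by linarith) x
    rw [Real.norm_eq_abs]
    set d := ‖x - y‖ with hd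
    have hd0 : 0 ≤ d := norm_nonneg _
    suffices hs : |Vp p φ g t x - Vp p φ g t y| ≤
        C₀ * ((1 + (√T) ^ lam) * C₁ * D + C₃) * K * wt x ^ (-e) * d ^ lam by
      refine hs.trans (mul_le_mul_of_nonneg_right (mul_le_mul (mul_le_mul_of_nonneg_right
        (mul_le_mul_of_nonneg_left ?_ hC₀) hK) hw' hw.le (by positivity)) (by positivity))
      linarith
    rcases hd0.eq_or_lt with h0 | h0
    · have : x = y := by
        rw [hd] at h0
        exact sub_eq_zero.1 (norm_eq_zero.1 h0.symm)
      subst this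
      rw [sub_self, abs_zero]
      positivity
    rcases le_or_gt d 1 with h1 | h1
    · have hi := fun z => hφ.integrableOn_Bk (c := 0) ha hl hl1.le hδ hadm hg (le_refl t) z
      rw [Vp, Vp, ← integral_sub (hi x) (hi y)]
      refine (H₀ 0 t d ((C₁ * D + C₃) * K * wt x ^ (-e)) _ h0 (by positivity)
        (fun τ hτ => ?_) fun τ hτ => ?_).trans ?_
      · have hr : 0 < t - τ := by linarith [hτ.2]
        have b1 := bnd t ht τ hτ.1.le hτ.2 x
        have b2 := bnd t ht τ hτ.1.le hτ.2 y
        have hp := rp _ hr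
        calc _ ≤ |Bk p φ (g τ) (√(t - τ)) x| + |Bk p φ (g τ) (√(t - τ)) y| := abs_sub _ _
          _ ≤ C₁ * K * (wt x ^ (-e) + wt y ^ (-e)) * (t - τ) ^ (lam / 2 - 1) := by linarith
          _ ≤ C₁ * K * (wt x ^ (-e) * D) * (t - τ) ^ (lam / 2 - 1) := by
            refine mul_le_mul_of_nonneg_right (mul_le_mul_of_nonneg_left (near x y hxy)
              (by positivity)) hp
          _ = C₁ * D * K * wt x ^ (-e) * (t - τ) ^ (lam / 2 - 1) := by ring
          _ ≤ _ := by
            refine mul_le_mul (mul_le_mul_of_nonneg_right (mul_le_mul_of_nonneg_right ?_ hK) hw.le)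
              ?_ hp (by positivity)
            · linarith
            · linarith
      · have hr : 0 < t - τ := by linarith [hτ.2]
        have b3 := H₃ _ _ (hg.slice τ) _ (Real.sqrt_pos.2 hr) (hsqrt t ht τ hτ.1.le) x y h1
        rw [sqrt_rpow_three hr.le] at b3
        refine b3.trans (mul_le_mul_of_nonneg_right (mul_le_mul_of_nonneg_right
          (mul_le_mul_of_nonneg_right ?_ hK) hw.le) (by positivity))
        have : 0 ≤ C₁ * D := by positivity
        linarith
      · have : C₀ * ((C₁ * D + C₃) * K * wt x ^ (-e)) * d ^ lam =
            C₀ * (C₁ * D + C₃) * K * wt x ^ (-e) * d ^ lam := by ring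
        rw [this]
        refine mul_le_mul_of_nonneg_right (mul_le_mul_of_nonneg_right (mul_le_mul_of_nonneg_right
          (mul_le_mul_of_nonneg_left ?_ hC₀) hK) hw.le) (by positivity)
        have : 0 ≤ (√T) ^ lam * C₁ * D := by positivity
        linarith
    · have hd1 : 1 ≤ d ^ lam := Real.one_le_rpow h1.le hl.le
      calc |Vp p φ g t x - Vp p φ g t y| ≤ |Vp p φ g t x| + |Vp p φ g t y| := abs_sub _ _
        _ ≤ C₀ * (C₁ * K * (wt x ^ (-e) + wt y ^ (-e))) * (√T) ^ lam := by
          linarith [sup t ht x, sup t ht y]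
        _ ≤ C₀ * (C₁ * K * (wt x ^ (-e) * D)) * (√T) ^ lam := by
          refine mul_le_mul_of_nonneg_right (mul_le_mul_of_nonneg_left (mul_le_mul_of_nonneg_left
            (near x y hxy) (by positivity)) hC₀) hTl.le
        _ = C₀ * ((√T) ^ lam * C₁ * D) * K * wt x ^ (-e) * 1 := by ring
        _ ≤ _ := by
          refine mul_le_mul (mul_le_mul_of_nonneg_right (mul_le_mul_of_nonneg_right
            (mul_le_mul_of_nonneg_left ?_ hC₀) hK) hw.le) hd1 zero_le_one (by positivity)
          have : 0 ≤ C₁ * D := by positivity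
          linarith
  · have main : ∀ t₁ ∈ Set.Icc (0 : ℝ) T, ∀ t₂ ∈ Set.Icc (0 : ℝ) T, t₁ < t₂ → ∀ x,
        |Vp p φ g t₂ x - Vp p φ g t₁ x| ≤
          C₀ * (2 * (C₁ + C₂)) * K * wt x ^ (-e) * (t₂ - t₁) ^ (lam / 2) := by
      intro t₁ ht₁ t₂ ht₂ h12 x
      have hw := wt_rpow_pos (-e) x
      have hh : 0 < t₂ - t₁ := by linarith
      set d := √(t₂ - t₁) with hd
      have hd0 : 0 < d := Real.sqrt_pos.2 hh
      have i1 := hφ.integrableOn_Bk (c := 0) ha hl hl1.le hδ hadm hg (le_refl t₁) x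
      have i2 := hφ.integrableOn_Bk (c := 0) ha hl hl1.le hδ hadm hg h12.le x
      have i3 := hφ.integrableOn_Bk (c := t₁) ha hl hl1.le hδ hadm hg (le_refl t₂) x
      have i2' := (integrableOn_Ioc_iff_integrableOn_Ioo (by simp)).2 i2
      have e0 : Vp p φ g t₂ x = (∫ τ in Set.Ioo 0 t₁, Bk p φ (g τ) (√(t₂ - τ)) x) +
          ∫ τ in Set.Ioo t₁ t₂, Bk p φ (g τ) (√(t₂ - τ)) x := by
        rw [← integral_Ioc_eq_integral_Ioo (x := (0 : ℝ)), ← setIntegral_union _ measurableSet_Ioo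
          i2' i3, Vp,
          Set.Ioc_union_Ioo_eq_Ioo ht₁.1 h12]
        exact Set.disjoint_left.2 fun τ h1 h2 => absurd h1.2 (not_le.2 h2.1)
      have e1 : Vp p φ g t₂ x - Vp p φ g t₁ x =
          (∫ τ in Set.Ioo 0 t₁, (Bk p φ (g τ) (√(t₂ - τ)) x - Bk p φ (g τ) (√(t₁ - τ)) x)) +
          ∫ τ in Set.Ioo t₁ t₂, Bk p φ (g τ) (√(t₂ - τ)) x := by
        rw [integral_sub i2 i1, e0, Vp]
        ring
      have hM : 0 ≤ (C₁ + C₂) * K * wt x ^ (-e) := by positivity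
      have hM1 : C₁ * K * wt x ^ (-e) ≤ (C₁ + C₂) * K * wt x ^ (-e) :=
        mul_le_mul_of_nonneg_right (mul_le_mul_of_nonneg_right (by linarith) hK) hw.le
      have hM2 : C₂ * K * wt x ^ (-e) ≤ (C₁ + C₂) * K * wt x ^ (-e) :=
        mul_le_mul_of_nonneg_right (mul_le_mul_of_nonneg_right (by linarith) hK) hw.le
      have j1 : |∫ τ in Set.Ioo 0 t₁, (Bk p φ (g τ) (√(t₂ - τ)) x - Bk p φ (g τ) (√(t₁ - τ)) x)| ≤
          C₀ * ((C₁ + C₂) * K * wt x ^ (-e)) * d ^ lam := by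
        refine H₀ 0 t₁ d _ _ hd0 hM (fun τ hτ => ?_) fun τ hτ => ?_
        · have hr : 0 < t₁ - τ := by linarith [hτ.2]
          have b1 := bnd t₁ ht₁ τ hτ.1.le hτ.2 x
          have b2 := bnd t₂ ht₂ τ hτ.1.le (hτ.2.trans h12) x
          have hp := rp _ hr
          have hp2 : (t₂ - τ) ^ (lam / 2 - 1) ≤ (t₁ - τ) ^ (lam / 2 - 1) :=
            Real.rpow_le_rpow_of_nonpos hr (by linarith) (by linarith)
          have b2' := b2.trans (mul_le_mul_of_nonneg_left hp2 (by positivity))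
          calc _ ≤ |Bk p φ (g τ) (√(t₂ - τ)) x| + |Bk p φ (g τ) (√(t₁ - τ)) x| := abs_sub _ _
            _ ≤ C₁ * K * wt x ^ (-e) * (2 * (t₁ - τ) ^ (lam / 2 - 1)) := by linarith
            _ ≤ _ := mul_le_mul_of_nonneg_right hM1 (by positivity)
        · have hr : 0 < t₁ - τ := by linarith [hτ.2]
          have hr2 : 0 < t₂ - τ := by linarith
          have b3 := H₂ _ _ (hg.slice τ) _ (√(t₂ - τ)) (Real.sqrt_pos.2 hr)
            (Real.sqrt_le_sqrt (by linarith)) (hsqrt t₂ ht₂ τ hτ.1.le) x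
          refine b3.trans ?_
          rw [sqrt_rpow_three hr.le]
          have hs : √(t₂ - τ) - √(t₁ - τ) ≤ d := by
            have : √(t₂ - τ) ≤ √(t₁ - τ) + d := by
              rw [hd, Real.sqrt_le_left (by positivity)]
              nlinarith [Real.sq_sqrt hr.le, Real.sq_sqrt hh.le,
                mul_nonneg (Real.sqrt_nonneg (t₁ - τ)) (Real.sqrt_nonneg (t₂ - t₁))]
            linarith
          have hs0 : 0 ≤ √(t₂ - τ) - √(t₁ - τ) :=
            sub_nonneg.2 (Real.sqrt_le_sqrt (by linarith))
          exact mul_le_mul hM2 (mul_le_mul_of_nonneg_right hs (by positivity))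
            (by positivity) hM
      have j2 : |∫ τ in Set.Ioo t₁ t₂, Bk p φ (g τ) (√(t₂ - τ)) x| ≤
          C₀ * ((C₁ + C₂) * K * wt x ^ (-e)) * d ^ lam := by
        refine H₀ t₁ t₂ d _ _ hd0 hM (fun τ hτ => ?_) fun τ hτ => ?_
        · have hr : 0 < t₂ - τ := by linarith [hτ.2]
          refine (bnd t₂ ht₂ τ (by linarith [ht₁.1, hτ.1]) hτ.2 x).trans ?_
          have := rp _ hr
          exact mul_le_mul hM1 (by linarith) this hM
        · have hr : 0 < t₂ - τ := by linarith [hτ.2]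
          refine (bnd t₂ ht₂ τ (by linarith [ht₁.1, hτ.1]) hτ.2 x).trans ?_
          refine mul_le_mul hM1 ?_ (rp _ hr) hM
          rw [rpow_eq_sqrt_mul hr]
          refine mul_le_mul_of_nonneg_right (Real.sqrt_le_sqrt ?_) (by positivity)
          linarith [hτ.1]
      rw [e1]
      refine (abs_add_le _ _).trans ((add_le_add j1 j2).trans (le_of_eq ?_))
      rw [hd, sqrt_rpow hh.le]
      ring
    have fin : ∀ x : Spc n, ∀ r : ℝ, 0 ≤ r → C₀ * (2 * (C₁ + C₂)) * K * wt x ^ (-e) * r ≤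
        C₀ * ((1 + (√T) ^ lam) * C₁ * D + C₃ + 2 * (C₁ + C₂)) * K * wt x ^ (-δ') * r := by
      intro x r hr
      have hw := wt_rpow_pos (-e) x
      refine mul_le_mul_of_nonneg_right (mul_le_mul (mul_le_mul_of_nonneg_right
        (mul_le_mul_of_nonneg_left ?_ hC₀) hK) (wt_rpow_mono (by linarith) x) hw.le
        (by positivity)) hr
      have : 0 ≤ (1 + (√T) ^ lam) * C₁ * D := by positivity
      linarith
    intro t₁ ht₁ t₂ ht₂ x
    rw [Real.norm_eq_abs]
    rcases lt_trichotomy t₁ t₂ with h12 | h12 | h12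
    · rw [abs_sub_comm, abs_sub_comm t₁ t₂, abs_of_pos (by linarith : 0 < t₂ - t₁)]
      have hh : 0 < t₂ - t₁ := by linarith
      exact (main t₁ ht₁ t₂ ht₂ h12 x).trans (fin x _ (by positivity))
    · have hw := wt_rpow_pos (-δ') x
      rw [h12, sub_self, abs_zero]
      positivity
    · have hh : 0 < t₁ - t₂ := by linarith
      rw [abs_of_pos hh]
      exact (main t₂ ht₂ t₁ ht₁ h12 x).trans (fin x _ (by positivity))

end

section

/-! ### Space derivatives of heat potentials -/

variable {a : ℝ} {φ : Spc n → ℝ} {h : Spc n → ℝ} {lam δ K B e T μ : ℝ} {p : ℕ}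
  {g : ℝ → Spc n → ℝ}

lemma Bk_succ (φ h : Spc n → ℝ) (ρ : ℝ) (x : Spc n) :
    Bk (p + 1) φ h ρ x = ρ⁻¹ * Bk p φ h ρ x := by
  simp only [Bk]
  ring

/-- Space derivatives of potentials with at most weakly singular kernels. -/
lemma Kf.hasFDerivAt_Vp (ha : 0 < a) (hφ : Kf a φ) (hl : 0 < lam) (hl1 : lam ≤ 1) (hδ : 0 ≤ δ)
    (hp : p ≤ 1) (hg : Src lam δ g K) (t : ℝ) (x : Spc n) :
    DifferentiableAt ℝ (Vp p φ g t) x ∧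
      ∀ i, NSdeRham.pd i (Vp p φ g t) x = Vp (p + 1) (NSdeRham.pd i φ) g t x := by
  have hK := (hg.slice 0).nonneg
  have hadm : ∀ i, ∃ e, 0 ≤ e ∧ Adm (p + 1) (NSdeRham.pd i φ) lam δ e := by
    intro i
    rcases Nat.le_one_iff_eq_zero_or_eq_one.1 hp with rfl | rfl
    · exact ⟨δ, hδ, Or.inl ⟨le_refl _, rfl⟩⟩
    · exact ⟨δ + lam, by positivity, Or.inr ⟨rfl, rfl, hφ.integral_pd ha i⟩⟩
  choose e he hadm using hadm
  choose C hC H using fun i => (hφ.pd i).Bk_bound ha hl hl1 hδ (hadm i) (R := 1 + √t)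
    (by positivity)
  have hintg : ∀ i x, IntegrableOn (fun τ => Bk (p + 1) (NSdeRham.pd i φ) (g τ) (√(t - τ)) x)
      (Set.Ioo 0 t) := fun i x =>
    (hφ.pd i).integrableOn_Bk ha hl hl1 hδ (hadm i) hg le_rfl x
  have hintg0 : ∀ x, IntegrableOn (fun τ => Bk p φ (g τ) (√(t - τ)) x) (Set.Ioo 0 t) := fun x =>
    hφ.integrableOn_Bk ha hl hl1 hδ (Or.inl ⟨hp, rfl⟩) hg le_rfl x
  have hpd : ∀ τ ∈ Set.Ioo 0 t, ∀ x, DifferentiableAt ℝ (Bk p φ (g τ) (√(t - τ))) x ∧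
      ∀ i, NSdeRham.pd i (Bk p φ (g τ) (√(t - τ))) x =
        Bk (p + 1) (NSdeRham.pd i φ) (g τ) (√(t - τ)) x := by
    intro τ hτ x
    have hr : 0 < √(t - τ) := Real.sqrt_pos.2 (by linarith [hτ.2])
    obtain ⟨h1, h2⟩ := hφ.hasFDerivAt_Bk (p := p) ha ((hg.slice τ).bc hδ) hr x
    exact ⟨h1, fun i => by rw [h2, Bk_succ]⟩
  have hbd : ∀ τ ∈ Set.Ioo 0 t, ∀ y, ‖fderiv ℝ (Bk p φ (g τ) (√(t - τ))) y‖ ≤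
      (∑ i, C i * K) * (t - τ) ^ (lam / 2 - 1) := by
    intro τ hτ y
    have hr : 0 < t - τ := by linarith [hτ.2]
    refine (norm_fderiv_le_sum_pd _ _).trans ?_
    rw [Finset.sum_mul]
    refine Finset.sum_le_sum fun i _ => ?_
    rw [(hpd τ hτ y).2, ← sqrt_rpow_two hr.le]
    have h2 : √(t - τ) ≤ 1 + √t := by
      have : √(t - τ) ≤ √t := Real.sqrt_le_sqrt (by linarith [hτ.1])
      linarith
    refine (H i _ _ (hg.slice τ) _ (Real.sqrt_pos.2 hr) h2 y).trans ?_
    have hw : wt y ^ (-(e i)) ≤ 1 :=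
      Real.rpow_le_one_of_one_le_of_nonpos (one_le_wt y) (by linarith [he i])
    have := hC i
    refine mul_le_mul_of_nonneg_right ?_ (by positivity)
    exact mul_le_of_le_one_right (by positivity) hw
  have hmeas : AEStronglyMeasurable (fun τ => fderiv ℝ (Bk p φ (g τ) (√(t - τ))) x)
      (volume.restrict (Set.Ioo 0 t)) := by
    have h1 : AEStronglyMeasurable (fun τ => ∑ i, Bk (p + 1) (NSdeRham.pd i φ) (g τ)
        (√(t - τ)) x • (EuclideanSpace.proj i : Spc n →L[ℝ] ℝ))
        (volume.restrict (Set.Ioo 0 t)) :=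
      Finset.aestronglyMeasurable_fun_sum _ fun i _ => (hintg i x).1.smul_const _
    refine h1.congr ((ae_restrict_iff' measurableSet_Ioo).2 (Eventually.of_forall fun τ hτ => ?_))
    ext y
    simp only [fderiv_apply_eq_sum_pd, (hpd τ hτ x).2, sum_apply, smul_apply, PiLp.proj_apply,
      smul_eq_mul]
    exact Finset.sum_congr rfl fun i _ => mul_comm _ _
  have hbi : Integrable (fun τ => (∑ i, C i * K) * (t - τ) ^ (lam / 2 - 1))
      (volume.restrict (Set.Ioo 0 t)) := (integrableOn_singular (half_pos hl) 0 t).const_mul _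
  have key : HasFDerivAt (Vp p φ g t)
      (∫ τ in Set.Ioo 0 t, fderiv ℝ (Bk p φ (g τ) (√(t - τ))) x) x :=
    hasFDerivAt_integral_of_dominated_of_fderiv_le
      (F' := fun x τ => fderiv ℝ (Bk p φ (g τ) (√(t - τ))) x) univ_mem
      (Eventually.of_forall fun x => (hintg0 x).1) (hintg0 x) hmeas
      ((ae_restrict_iff' measurableSet_Ioo).2 (Eventually.of_forall fun τ hτ y _ => hbd τ hτ y))
      hbi ((ae_restrict_iff' measurableSet_Ioo).2 (Eventually.of_forall fun τ hτ y _ =>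
        (hpd τ hτ y).1.hasFDerivAt))
  have hD : Integrable (fun τ => fderiv ℝ (Bk p φ (g τ) (√(t - τ))) x)
      (volume.restrict (Set.Ioo 0 t)) := hbi.mono' hmeas
    ((ae_restrict_iff' measurableSet_Ioo).2 (Eventually.of_forall fun τ hτ => hbd τ hτ x))
  refine ⟨key.differentiableAt, fun i => ?_⟩
  rw [NSdeRham.pd, key.fderiv, ContinuousLinearMap.integral_apply hD]
  exact setIntegral_congr_fun measurableSet_Ioo fun τ hτ => (hpd τ hτ x).2 i

lemma Kf.differentiable_Vp (ha : 0 < a) (hφ : Kf a φ) (hl : 0 < lam) (hl1 : lam ≤ 1) (hδ : 0 ≤ δ)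
    (hp : p ≤ 1) (hg : Src lam δ g K) (t : ℝ) : Differentiable ℝ (Vp p φ g t) := fun x =>
  (hφ.hasFDerivAt_Vp ha hl hl1 hδ hp hg t x).1

lemma Kf.spd_Vp (ha : 0 < a) (hφ : Kf a φ) (hl : 0 < lam) (hl1 : lam ≤ 1) (hδ : 0 ≤ δ)
    (hp : p ≤ 1) (hg : Src lam δ g K) (i : Fin n) :
    spd i (Vp p φ g) = Vp (p + 1) (NSdeRham.pd i φ) g := by
  funext t x
  exact (hφ.hasFDerivAt_Vp ha hl hl1 hδ hp hg t x).2 i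

/-- Moving a derivative from the kernel to the source. -/
lemma Kf.Bk_one_pd (ha : 0 < a) (hφ : Kf a φ) (hh : BC h B) (hd : Differentiable ℝ h) (i : Fin n)
    {B' : ℝ} (hh' : BC (NSdeRham.pd i h) B') {ρ : ℝ} (hρ : 0 < ρ) (x : Spc n) :
    Bk 1 (NSdeRham.pd i φ) h ρ x = Top φ (NSdeRham.pd i h) ρ x := by
  obtain ⟨h1, h2⟩ := hφ.hasFDerivAt_Top ha hh hρ x
  have hD : ∀ z, ∀ r : ℝ, HasDerivAt
      (fun r : ℝ => φ z * h (x + r • EuclideanSpace.single i 1 - ρ • z))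
      (φ z * NSdeRham.pd i h (x + r • EuclideanSpace.single i 1 - ρ • z)) r := by
    intro z r
    have := (hasDerivAt_line hd (x - ρ • z) i r).const_mul (φ z)
    have e : ∀ r : ℝ, x + r • EuclideanSpace.single i (1 : ℝ) - ρ • z =
        x - ρ • z + r • EuclideanSpace.single i 1 := fun r => by abel
    simp only [e]
    exact this
  have hD1 : HasDerivAt (fun r : ℝ => Top φ h ρ (x + r • EuclideanSpace.single i 1))
      (Top φ (NSdeRham.pd i h) ρ (x + (0 : ℝ) • EuclideanSpace.single i 1)) 0 := by
    refine (hasDerivAt_integral_of_dominated_loc_of_deriv_le (s := Set.univ) (𝕜 := ℝ)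
      (bound := fun z => |φ z| * B') univ_mem
      (Eventually.of_forall fun r => (hφ.integrable_top ha hh ρ _).1)
      (hφ.integrable_top ha hh ρ _) (hφ.integrable_top ha hh' ρ _).1
      (Eventually.of_forall fun z r _ => ?_) ?_ (Eventually.of_forall fun z r _ => hD z r)).2
    · rw [norm_mul, Real.norm_eq_abs, Real.norm_eq_abs]
      exact mul_le_mul_of_nonneg_left (hh'.bdd _) (abs_nonneg _)
    · exact (hφ.integrable ha).abs.mul_const _
  have hD2 : HasDerivAt (fun r : ℝ => Top φ h ρ (x + r • EuclideanSpace.single i 1))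
      (NSdeRham.pd i (Top φ h ρ) x) 0 := by
    have e0 : x + (0 : ℝ) • EuclideanSpace.single i 1 = x := by simp
    have h3 : HasFDerivAt (Top φ h ρ) (fderiv ℝ (Top φ h ρ) x)
      (x + (0 : ℝ) • EuclideanSpace.single i 1) := by rw [e0]; exact h1.hasFDerivAt
    have h4 : HasDerivAt (fun r : ℝ => x + r • EuclideanSpace.single i (1 : ℝ))
        (EuclideanSpace.single i 1) 0 := by
      simpa using ((hasDerivAt_id (0 : ℝ)).smul_const (EuclideanSpace.single i (1 : ℝ))).const_add x
    exact h3.comp_hasDerivAt (0 : ℝ) h4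
  have := hD2.unique hD1
  rw [h2, zero_smul, add_zero] at this
  rw [Bk, pow_one, this]

/-! ### The heat potential as a potential with Gaussian kernel -/

/-- The Gaussian profile of the heat kernel. -/
def gauss (μ : ℝ) (z : Spc n) : ℝ :=
  (4 * Real.pi * μ) ^ (-(n : ℝ) / 2) * Real.exp (-(4 * μ)⁻¹ * ‖z‖ ^ 2)

lemma Kf.gauss (μ : ℝ) : Kf (n := n) (4 * μ)⁻¹ (gauss μ) := Kf.base.smul _

lemma integral_gauss (hμ : 0 < μ) : ∫ z : Spc n, gauss μ z = 1 := by
  simp only [gauss]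
  rw [integral_const_mul, GaussianFourier.integral_rexp_neg_mul_sq_norm (by positivity),
    finrank_euclideanSpace_fin, div_inv_eq_mul, show Real.pi * (4 * μ) = 4 * Real.pi * μ by ring,
    ← Real.rpow_add (by positivity), neg_div, neg_add_cancel, Real.rpow_zero]

lemma heatKer_eq (hμ : 0 < μ) {r : ℝ} (hr : 0 < r) (z : Spc n) :
    heatKer μ z r = (√r)⁻¹ ^ n * gauss μ ((√r)⁻¹ • z) := by
  have hs := Real.sqrt_pos.2 hr
  rw [heatKer, if_pos hr, gauss, Real.mul_rpow (by positivity) hr.le, norm_smul,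
    norm_inv, Real.norm_of_nonneg hs.le, mul_pow, inv_pow, inv_pow (√r) 2, Real.sq_sqrt hr.le]
  have h1 : r ^ (-(n : ℝ) / 2) = ((√r) ^ n)⁻¹ := by
    rw [← Real.rpow_natCast, sqrt_rpow hr.le, neg_div, Real.rpow_neg hr.le]
  rw [h1, show -‖z‖ ^ 2 / (4 * μ * r) = -(4 * μ)⁻¹ * (r⁻¹ * ‖z‖ ^ 2) by field_simp]
  ring

lemma volPot_eq (hμ : 0 < μ) (g : ℝ → Spc n → ℝ) : volPot μ g = Vp 0 (gauss μ) g := by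
  funext t x
  rw [volPot, Vp, integral_Ioc_eq_integral_Ioo]
  refine setIntegral_congr_fun measurableSet_Ioo fun τ hτ => ?_
  have hr : 0 < t - τ := by linarith [hτ.2]
  simp only [Bk, pow_zero, one_mul]
  rw [Top_eq _ _ (Real.sqrt_pos.2 hr), ← integral_const_mul]
  refine integral_congr_ae (Eventually.of_forall fun y => ?_)
  simp only [heatKer_eq hμ hr]
  ring

/-- Extension of a time-dependent function on `[0,T]` to all times. -/
def clamp (T : ℝ) (g : ℝ → Spc n → ℝ) (t : ℝ) : Spc n → ℝ := g (max 0 (min t T))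

lemma clamp_mem (hT : 0 < T) (t : ℝ) : max 0 (min t T) ∈ Set.Icc 0 T :=
  ⟨le_max_left _ _, max_le hT.le (min_le_right _ _)⟩

lemma clamp_of_mem {t : ℝ} (ht : t ∈ Set.Icc 0 T) (g : ℝ → Spc n → ℝ) : clamp T g t = g t := by
  rw [clamp, min_eq_left ht.2, max_eq_right ht.1]

lemma HB.src (hT : 0 < T) (hl : 0 < lam) (h : HB T lam δ g K) : Src lam δ (clamp T g) K where
  cont := by
    refine (h.continuousOn hl).comp_continuous
      (by fun_prop : Continuous fun q : ℝ × Spc n => (max 0 (min q.1 T), q.2)) fun q => ?_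
    exact ⟨clamp_mem hT _, trivial⟩
  slice τ := ⟨h.continuous_right hl (clamp_mem hT τ), fun x => h.sup _ (clamp_mem hT τ) x,
    fun x y hxy => h.space _ (clamp_mem hT τ) x y hxy⟩

lemma Vp_clamp (p : ℕ) (φ : Spc n → ℝ) (g : ℝ → Spc n → ℝ) {t : ℝ} (ht : t ≤ T) (x : Spc n) :
    Vp p φ (clamp T g) t x = Vp p φ g t x := by
  refine setIntegral_congr_fun measurableSet_Ioo fun τ hτ => ?_
  simp only [clamp_of_mem (T := T) ⟨hτ.1.le, hτ.2.le.trans ht⟩]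

end

section

/-! ### The time derivative of heat potentials -/

variable {a : ℝ} {φ : Spc n → ℝ} {h : Spc n → ℝ} {lam δ K B e T μ : ℝ} {p : ℕ}
  {g : ℝ → Spc n → ℝ}

lemma Kf.hasDerivAt_Top_sqrt (ha : 0 < a) (hφ : Kf a φ) (hh : BC h B) {τ s : ℝ} (hs : τ < s)
    (x : Spc n) : HasDerivAt (fun s => Top φ h (√(s - τ)) x)
      (1 / 2 * Bk 2 (NSdeRham.dil φ) h (√(s - τ)) x) s := by
  have hr : 0 < s - τ := by linarith
  have hρ := Real.sqrt_pos.2 hr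
  have h1 : HasDerivAt (fun s => √(s - τ)) (1 / (2 * √(s - τ))) s :=
    ((hasDerivAt_id s).sub_const τ).sqrt hr.ne'
  have h2 := (hφ.hasDerivAt_Top ha hh hρ x).comp s h1
  refine h2.congr_deriv ?_
  rw [Bk]
  field_simp

lemma Kf.continuous_Top_sqrt (ha : 0 < a) (hφ : Kf a φ) (hh : BC h B) (τ : ℝ) (x : Spc n) :
    Continuous fun s => Top φ h (√(s - τ)) x := by
  have h1 := hφ.continuous_Top (g := fun _ => h) ha (hh.cont.comp continuous_snd)
    (fun _ y => hh.bdd y)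
  exact h1.comp (by fun_prop : Continuous fun s : ℝ => (√(s - τ), (0 : ℝ), x))

lemma Top_zero (φ h : Spc n → ℝ) (x : Spc n) : Top φ h 0 x = (∫ z, φ z) * h x := by
  simp only [Top, zero_smul, sub_zero]
  exact integral_mul_const _ _

lemma integrable_indicator_rpow {b : ℝ} (hb : 0 < b) (t : ℝ) :
    Integrable ((Set.Ioo 0 t).indicator fun r => r ^ (b - 1)) := by
  refine (integrable_indicator_iff measurableSet_Ioo).2 ?_
  rcases le_or_gt t 0 with ht | ht
  · simp [Set.Ioo_eq_empty (not_lt.2 ht)]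
  · exact (intervalIntegral.integrableOn_Ioo_rpow_iff ht).2 (by linarith)

/-- The majorant of the double integral in the time derivative formula. -/
lemma integrable_double_majorant {b : ℝ} (hb : 0 < b) (t : ℝ) :
    Integrable (fun q : ℝ × ℝ => (Set.Ioo 0 t).indicator (fun _ => (1 : ℝ)) q.2 *
      (Set.Ioo 0 t).indicator (fun r => r ^ (b - 1)) (q.1 - q.2)) (volume.prod volume) := by
  have h1 : Integrable ((Set.Ioo 0 t).indicator fun _ => (1 : ℝ)) :=
    (integrable_indicator_iff measurableSet_Ioo).2 (by simp)
  exact h1.convolution_integrand (ContinuousLinearMap.mul ℝ ℝ)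
    (integrable_indicator_rpow hb t)

/-- The Fubini theorem on a triangle for kernels with an integrable singularity on the diagonal. -/
lemma integral_triangle_swap {F : ℝ → ℝ → ℝ} {t b M : ℝ} (hb : 0 < b) (hM : 0 ≤ M)
    (hF : ContinuousOn (Function.uncurry F) {q | q.2 < q.1})
    (hB : ∀ s τ, 0 < τ → τ < s → s < t → ‖F s τ‖ ≤ M * (s - τ) ^ (b - 1)) :
    (∀ τ ∈ Set.Ioo 0 t, IntegrableOn (fun s => F s τ) (Set.Ioo τ t)) ∧
    IntegrableOn (fun s => ∫ τ in Set.Ioo 0 s, F s τ) (Set.Ioo 0 t) ∧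
    ∫ s in Set.Ioo 0 t, ∫ τ in Set.Ioo 0 s, F s τ =
      ∫ τ in Set.Ioo 0 t, ∫ s in Set.Ioo τ t, F s τ := by
  let U : Set (ℝ × ℝ) := {q | q.2 < q.1} ∩ (Set.Ioo 0 t ×ˢ Set.Ioo 0 t)
  have hU : MeasurableSet U := (measurableSet_lt measurable_snd measurable_fst).inter
    (measurableSet_Ioo.prod measurableSet_Ioo)
  have hFc : ContinuousOn (Function.uncurry F) U := hF.mono Set.inter_subset_left
  have hintg : Integrable (U.indicator (Function.uncurry F)) (volume.prod volume) := by
    refine ((integrable_double_majorant hb t).const_mul M).mono'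
      ((aestronglyMeasurable_indicator_iff hU).2 (hFc.aestronglyMeasurable hU))
      (Eventually.of_forall fun q => ?_)
    rcases em (q ∈ U) with hq | hq
    · have h1 : q.2 < q.1 := hq.1
      have h2 := hq.2.1
      have h3 := hq.2.2
      have hr : 0 < q.1 - q.2 := by linarith
      rw [Set.indicator_of_mem hq, Set.indicator_of_mem h3, Set.indicator_of_mem
        (show q.1 - q.2 ∈ Set.Ioo 0 t from ⟨hr, by linarith [h2.2, h3.1]⟩), one_mul]
      exact hB _ _ h3.1 h1 h2.2
    · rw [Set.indicator_of_notMem hq, norm_zero]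
      refine mul_nonneg hM (mul_nonneg ?_ ?_)
      · exact Set.indicator_nonneg (fun _ _ => zero_le_one) _
      · exact Set.indicator_nonneg (fun r hr => Real.rpow_nonneg hr.1.le _) _
  have e1 : ∀ s, ∫ τ, U.indicator (Function.uncurry F) (s, τ) =
      (Set.Ioo 0 t).indicator (fun s => ∫ τ in Set.Ioo 0 s, F s τ) s := by
    intro s
    by_cases hs : s ∈ Set.Ioo 0 t
    · rw [Set.indicator_of_mem hs, ← integral_indicator measurableSet_Ioo]
      refine integral_congr_ae (Eventually.of_forall fun τ => ?_)
      by_cases hτ : τ ∈ Set.Ioo 0 s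
      · have : (s, τ) ∈ U := ⟨hτ.2, hs, hτ.1, hτ.2.trans hs.2⟩
        simp only [Set.indicator_of_mem this, Set.indicator_of_mem hτ, Function.uncurry_apply_pair]
      · have : (s, τ) ∉ U := fun h => hτ ⟨h.2.2.1, h.1⟩
        simp only [Set.indicator_of_notMem this, Set.indicator_of_notMem hτ]
    · rw [Set.indicator_of_notMem hs]
      have : ∀ τ, (s, τ) ∉ U := fun τ h => hs h.2.1
      simp [this]
  have e2 : ∀ τ, ∫ s, U.indicator (Function.uncurry F) (s, τ) =
      (Set.Ioo 0 t).indicator (fun τ => ∫ s in Set.Ioo τ t, F s τ) τ := by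
    intro τ
    by_cases hτ : τ ∈ Set.Ioo 0 t
    · rw [Set.indicator_of_mem hτ, ← integral_indicator measurableSet_Ioo]
      refine integral_congr_ae (Eventually.of_forall fun s => ?_)
      by_cases hs : s ∈ Set.Ioo τ t
      · have : (s, τ) ∈ U := ⟨hs.1, ⟨hτ.1.trans hs.1, hs.2⟩, hτ⟩
        simp only [Set.indicator_of_mem this, Set.indicator_of_mem hs, Function.uncurry_apply_pair]
      · have : (s, τ) ∉ U := fun h => hs ⟨h.1, h.2.1.2⟩
        simp only [Set.indicator_of_notMem this, Set.indicator_of_notMem hs]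
    · rw [Set.indicator_of_notMem hτ]
      have : ∀ s, (s, τ) ∉ U := fun s h => hτ h.2.2
      simp [this]
  have hsw := integral_integral_swap (f := fun s τ => U.indicator (Function.uncurry F) (s, τ)) hintg
  have hil := hintg.integral_prod_left
  simp only [e1] at hil
  simp only [e1, e2, integral_indicator measurableSet_Ioo] at hsw
  refine ⟨fun τ hτ => ?_, (integrable_indicator_iff measurableSet_Ioo).1 hil, hsw⟩
  have h0 := ((integrable_indicator_rpow hb (t - τ)).comp_sub_right τ).const_mul M
  refine h0.integrableOn.mono' ?_ ((ae_restrict_iff' measurableSet_Ioo).2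
    (Eventually.of_forall fun s hs => ?_))
  · refine ContinuousOn.aestronglyMeasurable ?_ measurableSet_Ioo
    exact hF.comp (by fun_prop : ContinuousOn (fun s : ℝ => (s, τ)) _) fun s hs => hs.1
  · rw [Set.indicator_of_mem (show s - τ ∈ Set.Ioo 0 (t - τ) from
      ⟨by linarith [hs.1], by linarith [hs.2]⟩)]
    exact hB s τ hτ.1 hs.1 hs.2

/-- The integrated form of the time derivative formula. -/
lemma Kf.integral_Vp_two (ha : 0 < a) (hφ : Kf a φ) (hl : 0 < lam) (hl1 : lam ≤ 1) (hδ : 0 ≤ δ)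
    (hg : Src lam δ g K) (t : ℝ) (x : Spc n) :
    IntegrableOn (fun s => 1 / 2 * Vp 2 (NSdeRham.dil φ) g s x) (Set.Ioo 0 t) ∧
    ∫ s in Set.Ioo 0 t, 1 / 2 * Vp 2 (NSdeRham.dil φ) g s x =
      Vp 0 φ g t x - ∫ τ in Set.Ioo 0 t, (∫ z, φ z) * g τ x := by
  have hK := (hg.slice 0).nonneg
  have hadm : Adm 2 (NSdeRham.dil φ) lam δ (δ + lam) := Or.inr ⟨rfl, rfl, hφ.integral_dil ha⟩
  obtain ⟨C, hC, H⟩ := hφ.dil.Bk_bound ha hl hl1 hδ hadm (R := 1 + √t) (by positivity)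
  obtain ⟨h1, h2, h3⟩ := integral_triangle_swap (t := t) (b := lam / 2) (M := C * K)
    (F := fun s τ => 1 / 2 * Bk 2 (NSdeRham.dil φ) (g τ) (√(s - τ)) x) (half_pos hl)
    (by positivity)
    (by
      refine ContinuousOn.mul continuousOn_const ?_
      refine (hφ.dil.continuousOn_Bk (p := 2) ha hδ hg x).comp
        (by fun_prop : ContinuousOn (fun q : ℝ × ℝ => (q.1 - q.2, q.2)) _)
        fun q hq => ⟨?_, trivial⟩
      simpa using hq)
    (by
      intro s τ h1 h2 h3
      have hr : 0 < s - τ := by linarith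
      rw [Real.norm_eq_abs, abs_mul, ← sqrt_rpow_two hr.le]
      have h4 : √(s - τ) ≤ 1 + √t := by
        have : √(s - τ) ≤ √t := Real.sqrt_le_sqrt (by linarith)
        linarith
      have h5 := H _ _ (hg.slice τ) _ (Real.sqrt_pos.2 hr) h4 x
      have hw : wt x ^ (-(δ + lam)) ≤ 1 :=
        Real.rpow_le_one_of_one_le_of_nonpos (one_le_wt x) (by linarith)
      have h6 : C * K * wt x ^ (-(δ + lam)) * √(s - τ) ^ (lam - 2) ≤
          C * K * √(s - τ) ^ (lam - 2) :=
        mul_le_mul_of_nonneg_right (mul_le_of_le_one_right (by positivity) hw) (by positivity)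
      rw [abs_of_pos (by norm_num : (0 : ℝ) < 1 / 2)]
      have := abs_nonneg (Bk 2 (NSdeRham.dil φ) (g τ) (√(s - τ)) x)
      linarith)
  have e1 : ∀ s, ∫ τ in Set.Ioo 0 s, 1 / 2 * Bk 2 (NSdeRham.dil φ) (g τ) (√(s - τ)) x =
      1 / 2 * Vp 2 (NSdeRham.dil φ) g s x := fun s => integral_const_mul _ _
  simp only [e1] at h2 h3
  refine ⟨h2, h3.trans ?_⟩
  have e2 : ∀ τ ∈ Set.Ioo 0 t,
      ∫ s in Set.Ioo τ t, 1 / 2 * Bk 2 (NSdeRham.dil φ) (g τ) (√(s - τ)) x =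
        Bk 0 φ (g τ) (√(t - τ)) x - (∫ z, φ z) * g τ x := by
    intro τ hτ
    have hbc := (hg.slice τ).bc hδ
    have h4 := intervalIntegral.integral_eq_sub_of_hasDerivAt_of_le hτ.2.le
      (hφ.continuous_Top_sqrt ha hbc τ x).continuousOn
      (fun s hs => hφ.hasDerivAt_Top_sqrt ha hbc hs.1 x)
      ((intervalIntegrable_iff_integrableOn_Ioo_of_le hτ.2.le).2 (h1 τ hτ))
    rw [sub_self, Real.sqrt_zero, Top_zero, intervalIntegral.integral_of_le hτ.2.le,
      integral_Ioc_eq_integral_Ioo] at h4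
    rw [h4, Bk, pow_zero, one_mul]
  have hgc : Continuous fun τ => (∫ z, φ z) * g τ x :=
    continuous_const.mul (hg.cont.comp (by fun_prop : Continuous fun τ : ℝ => (τ, x)))
  rw [setIntegral_congr_fun measurableSet_Ioo e2, integral_sub, Vp]
  · exact hφ.integrableOn_Bk ha hl hl1 hδ (Or.inl ⟨zero_le_one, rfl⟩) hg le_rfl x
  · exact (hgc.integrableOn_Icc (a := 0) (b := t)).mono_set Set.Ioo_subset_Icc_self

/-- The time derivative of a heat potential. -/
theorem Kf.hasDerivWithinAt_Vp (ha : 0 < a) (hφ : Kf a φ) (hT : 0 < T) (hl : 0 < lam)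
    (hl1 : lam < 1) (hδ : 0 ≤ δ) (hg : Src lam δ g K) (x : Spc n) {t : ℝ} (ht : t ∈ Set.Icc 0 T) :
    HasDerivWithinAt (fun t => Vp 0 φ g t x)
      ((∫ z, φ z) * g t x + 1 / 2 * Vp 2 (NSdeRham.dil φ) g t x) (Set.Icc 0 T) t := by
  obtain ⟨C, hC, H⟩ := hφ.dil.hb_Vp (p := 2) (δ' := δ) ha hT hl hl1 hδ
    (Or.inr ⟨rfl, rfl, hφ.integral_dil ha⟩) le_rfl
  set Q : ℝ → ℝ := fun s => (∫ z, φ z) * g s x + 1 / 2 * Vp 2 (NSdeRham.dil φ) g s x with hQ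
  have hgc : Continuous fun τ => (∫ z, φ z) * g τ x :=
    continuous_const.mul (hg.cont.comp (by fun_prop : Continuous fun τ : ℝ => (τ, x)))
  have hQc : ContinuousOn Q (Set.Icc 0 T) :=
    hgc.continuousOn.add (continuousOn_const.mul ((H g K hg).continuousOn_left hl x))
  have hP : ∀ s ∈ Set.Icc 0 T, Vp 0 φ g s x = ∫ r in (0 : ℝ)..s, Q r := by
    intro s hs
    obtain ⟨h1, h2⟩ := hφ.integral_Vp_two ha hl hl1.le hδ hg s x
    rw [intervalIntegral.integral_of_le hs.1, integral_Ioc_eq_integral_Ioo, hQ, integral_add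
      ((hgc.integrableOn_Icc (a := 0) (b := s)).mono_set Set.Ioo_subset_Icc_self) h1, h2]
    ring
  set Q' : ℝ → ℝ := Set.IccExtend hT.le ((Set.Icc 0 T).domRestrict Q) with hQ'
  have hQ'c : Continuous Q' := (continuousOn_iff_continuous_domRestrict.1 hQc).Icc_extend'
  have hQQ : ∀ s ∈ Set.Icc 0 T, Q' s = Q s := fun s hs => by
    rw [hQ', Set.IccExtend_of_mem _ _ hs, Set.domRestrict_apply]
  have hd := (hQ'c.integral_hasStrictDerivAt 0 t).hasDerivAt.hasDerivWithinAt (s := Set.Icc 0 T)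
  rw [hQQ t ht] at hd
  have hP' : ∀ s ∈ Set.Icc 0 T, Vp 0 φ g s x = ∫ r in (0 : ℝ)..s, Q' r := by
    intro s hs
    rw [hP s hs]
    refine intervalIntegral.integral_congr fun r hr => ?_
    rw [Set.uIcc_of_le hs.1] at hr
    exact (hQQ r ⟨hr.1, hr.2.trans hs.2⟩).symm
  exact hd.congr hP' (hP' t ht)

lemma Kf.Vp_sum (ha : 0 < a) {Φ : Fin n → Spc n → ℝ} (hΦ : ∀ i, Kf a (Φ i)) (hl : 0 < lam)
    (hl1 : lam ≤ 1) (hδ : 0 ≤ δ) (hadm : ∀ i, Adm p (Φ i) lam δ e) (hg : Src lam δ g K)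
    (c : ℝ) (t : ℝ) (x : Spc n) :
    Vp p (fun z => c * ∑ i, Φ i z) g t x = c * ∑ i, Vp p (Φ i) g t x := by
  have hi : ∀ i ∈ Finset.univ, Integrable (fun τ => Bk p (Φ i) (g τ) (√(t - τ)) x)
      (volume.restrict (Set.Ioo 0 t)) := fun i _ =>
    (hΦ i).integrableOn_Bk ha hl hl1 hδ (hadm i) hg le_rfl x
  rw [show (∑ i, Vp p (Φ i) g t x) =
      ∑ i, ∫ τ in Set.Ioo 0 t, Bk p (Φ i) (g τ) (√(t - τ)) x from rfl, Vp,
    ← integral_finsetSum _ hi, ← integral_const_mul c]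
  refine integral_congr_ae (Eventually.of_forall fun τ => ?_)
  simp only [Bk, Top]
  have hj : ∀ i ∈ Finset.univ, Integrable fun z => Φ i z * g τ (x - √(t - τ) • z) := fun i _ =>
    (hΦ i).integrable_top ha ((hg.slice τ).bc hδ) _ x
  rw [← Finset.mul_sum, ← integral_finsetSum _ hj, mul_left_comm, ← integral_const_mul c]
  refine congrArg _ (integral_congr_ae (Eventually.of_forall fun z => ?_))
  simp only [Finset.sum_mul, mul_assoc]

lemma dil_gauss (hμ : 0 < μ) :
    dil (n := n) (gauss μ) = fun z => (2 * μ) * ∑ i, pd i (pd i (gauss μ)) z := by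
  have h1 : ∀ i, pd i (gauss (n := n) μ) = fun z => -2 * (4 * μ)⁻¹ * (z i * gauss μ z) := by
    intro i
    funext z
    have hd : DifferentiableAt ℝ (fun z : Spc n => Real.exp (-(4 * μ)⁻¹ * ‖z‖ ^ 2)) z :=
      differentiable_gauss _ z
    have h2 := pd_gauss (4 * μ)⁻¹ i z
    rw [pd] at h2 ⊢
    rw [show gauss (n := n) μ = fun z => (4 * Real.pi * μ) ^ (-(n : ℝ) / 2) *
      Real.exp (-(4 * μ)⁻¹ * ‖z‖ ^ 2) from rfl, fderiv_const_mul hd, smul_apply, h2, smul_eq_mul]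
    ring
  have h2 : ∀ i z, pd i (pd i (gauss (n := n) μ)) z =
      -2 * (4 * μ)⁻¹ * (gauss μ z + z i * (-2 * (4 * μ)⁻¹ * (z i * gauss μ z))) := by
    intro i z
    have hG : DifferentiableAt ℝ (gauss (n := n) μ) z := (Kf.gauss μ).differentiable z
    have hm : DifferentiableAt ℝ (fun z : Spc n => z i * gauss μ z) z :=
      ((Kf.gauss μ).coord i).differentiable z
    rw [h1 i, pd, fderiv_const_mul hm, smul_apply, smul_eq_mul]
    have h3 : fderiv ℝ (fun z : Spc n => z i * gauss μ z) z (EuclideanSpace.single i 1) =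
        gauss μ z + z i * pd i (gauss μ) z := by
      have h4 := pd_coord i i z
      rw [pd, if_pos rfl] at h4
      rw [fderiv_fun_mul (differentiable_coord i z) hG, add_apply, smul_apply, smul_apply, h4, pd]
      simp only [smul_eq_mul]
      ring
    rw [h3, h1 i]
  funext z
  rw [dil, euler_eq]
  simp only [h2]
  simp only [h1]
  rw [← Finset.mul_sum, Finset.sum_add_distrib, Finset.sum_const, Finset.card_univ,
    Fintype.card_fin, nsmul_eq_mul]
  simp only [show ∀ i : Fin n, z i * (-2 * (4 * μ)⁻¹ * (z i * gauss μ z)) =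
    -2 * (4 * μ)⁻¹ * (z i * (z i * gauss μ z)) from fun i => by ring]
  rw [← Finset.mul_sum]
  field_simp
  ring

end

section

/-! ### The volume heat potential in the anisotropic scale -/

variable {lam δ K T μ : ℝ} {N s : ℕ} {g : ℝ → Spc n → ℝ}

lemma volPot_eq_clamp (hμ : 0 < μ) (g : ℝ → Spc n → ℝ) :
    ∀ t ∈ Set.Icc (0 : ℝ) T, ∀ x, Vp 0 (gauss μ) (clamp T g) t x = volPot μ g t x :=
  fun t ht x => by rw [Vp_clamp _ _ _ ht.2, volPot_eq hμ]

lemma Kf.pd_pd_adm {a : ℝ} {φ : Spc n → ℝ} (ha : 0 < a) (hφ : Kf a φ) (i j : Fin n) :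
    Adm 2 (NSdeRham.pd j (NSdeRham.pd i φ)) lam δ (δ + lam) :=
  Or.inr ⟨rfl, rfl, (hφ.pd i).integral_pd ha j⟩

lemma volPot_hb (T : ℝ) (hT : 0 < T) (hl : 0 < lam) (hl1 : lam < 1) (hδ : 0 ≤ δ) (hμ : 0 < μ) :
    ∃ C, 0 ≤ C ∧ ∀ (g : ℝ → Spc n → ℝ) K, HB T lam δ g K →
      HB T lam (δ - 2) (volPot μ g) (C * K) := by
  have ha : 0 < (4 * μ)⁻¹ := by positivity
  obtain ⟨C, hC, H⟩ := (Kf.gauss (n := n) μ).hb_Vp ha hT hl hl1 hδ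
    (p := 0) (e := δ) (δ' := δ - 2) (Or.inl ⟨zero_le_one, rfl⟩) (by linarith)
  exact ⟨C, hC, fun g K hg => (H _ _ (hg.src hT hl)).congr (volPot_eq_clamp hμ g)⟩

lemma volPot_differentiable (hT : 0 < T) (hl : 0 < lam) (hl1 : lam < 1) (hδ : 0 ≤ δ)
    (hμ : 0 < μ) (hg : HB T lam δ g K) : ∀ t ∈ Set.Icc 0 T, Differentiable ℝ (volPot μ g t) := by
  intro t ht
  rw [← show Vp 0 (gauss μ) (clamp T g) t = volPot μ g t from
    funext (volPot_eq_clamp hμ g t ht)]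
  exact (Kf.gauss (n := n) μ).differentiable_Vp (by positivity) hl hl1.le hδ zero_le_one
    (hg.src hT hl) t

lemma spd_volPot_eq (hT : 0 < T) (hl : 0 < lam) (hl1 : lam < 1) (hδ : 0 ≤ δ)
    (hμ : 0 < μ) (hg : HB T lam δ g K) (i : Fin n) :
    ∀ t ∈ Set.Icc 0 T, ∀ x,
      Vp 1 (pd i (gauss μ)) (clamp T g) t x = spd i (volPot μ g) t x := by
  intro t ht x
  rw [← spd_congr (volPot_eq_clamp hμ g) i t ht x,
    (Kf.gauss (n := n) μ).spd_Vp (by positivity) hl hl1.le hδ zero_le_one (hg.src hT hl)]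

lemma spd_spd_volPot_eq (hT : 0 < T) (hl : 0 < lam) (hl1 : lam < 1) (hδ : 0 ≤ δ)
    (hμ : 0 < μ) (hg : HB T lam δ g K) (i j : Fin n) :
    ∀ t ∈ Set.Icc 0 T, ∀ x,
      Vp 2 (pd j (pd i (gauss μ))) (clamp T g) t x = spd j (spd i (volPot μ g)) t x := by
  intro t ht x
  rw [← spd_congr (spd_volPot_eq hT hl hl1 hδ hμ hg i) j t ht x,
    ((Kf.gauss (n := n) μ).pd i).spd_Vp (by positivity) hl hl1.le hδ le_rfl (hg.src hT hl)]

lemma spd_volPot (hT : 0 < T) (hl : 0 < lam) (hl1 : lam < 1) (hδ : 0 ≤ δ)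
    (hμ : 0 < μ) (hg : HB T lam δ g K) (hd : ∀ t ∈ Set.Icc 0 T, Differentiable ℝ (g t)) (i : Fin n)
    (hg' : HB T lam (δ + 1) (spd i g) K) :
    ∀ t ∈ Set.Icc 0 T, ∀ x, volPot μ (spd i g) t x = spd i (volPot μ g) t x := by
  intro t ht x
  rw [← spd_volPot_eq hT hl hl1 hδ hμ hg i t ht x, ← volPot_eq_clamp hμ (spd i g) t ht x]
  refine setIntegral_congr_fun measurableSet_Ioo fun τ hτ => ?_
  have h1 := (hg.src hT hl).slice τ
  have h2 := (hg'.src hT hl).slice τ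
  have h3 := (Kf.gauss (n := n) μ).Bk_one_pd (by positivity) (h1.bc hδ)
    (hd _ (clamp_mem hT τ)) i (h2.bc (by linarith))
    (Real.sqrt_pos.2 (sub_pos.2 hτ.2)) x
  simp only [Bk] at h3 ⊢
  rw [h3, pow_zero, one_mul]
  rfl

lemma hasDerivWithinAt_volPot (hT : 0 < T) (hl : 0 < lam) (hl1 : lam < 1) (hδ : 0 ≤ δ)
    (hμ : 0 < μ) (hg : HB T lam δ g K) (x : Spc n) {t : ℝ} (ht : t ∈ Set.Icc 0 T) :
    HasDerivWithinAt (fun t => volPot μ g t x)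
      (g t x + μ * ∑ i, spd i (spd i (volPot μ g)) t x) (Set.Icc 0 T) t := by
  have ha : 0 < (4 * μ)⁻¹ := by positivity
  have h1 := (Kf.gauss (n := n) μ).hasDerivWithinAt_Vp ha hT hl hl1 hδ (hg.src hT hl) x ht
  rw [integral_gauss hμ, one_mul, clamp_of_mem ht, dil_gauss hμ,
    Kf.Vp_sum ha (fun i => ((Kf.gauss (n := n) μ).pd i).pd i) hl hl1.le hδ
      (fun i => (Kf.gauss (n := n) μ).pd_pd_adm ha i i) (hg.src hT hl)] at h1
  have h2 : ∑ i, spd i (spd i (volPot μ g)) t x =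
      ∑ i, Vp 2 (pd i (pd i (gauss μ))) (clamp T g) t x :=
    Finset.sum_congr rfl fun i _ => (spd_spd_volPot_eq hT hl hl1 hδ hμ hg i i t ht x).symm
  rw [h2]
  refine (h1.congr_deriv (by ring)).congr (fun τ hτ => ?_) ?_
  · exact (volPot_eq_clamp hμ g τ hτ x).symm
  · exact (volPot_eq_clamp hμ g t ht x).symm

lemma spd_volPot_cls_one (T : ℝ) (hT : 0 < T) (hl : 0 < lam) (hl1 : lam < 1) (hδ : 0 ≤ δ)
    (hμ : 0 < μ) (s : ℕ) (i : Fin n) :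
    ∃ C, 0 ≤ C ∧ ∀ (g : ℝ → Spc n → ℝ) K, HB T lam δ g K →
      Cls T lam 1 s (δ - 2 + 1) (spd i (volPot μ g)) (C * K) := by
  have ha : 0 < (4 * μ)⁻¹ := by positivity
  have hG := Kf.gauss (n := n) μ
  obtain ⟨C, hC, H⟩ := (hG.pd i).hb_Vp ha hT hl hl1 hδ
    (p := 1) (e := δ) (δ' := δ - 2 + 1) (Or.inl ⟨le_rfl, rfl⟩) (by linarith)
  have h2 : ∀ j, ∃ C, 0 ≤ C ∧ ∀ g K, Src lam δ g K →
      HB T lam (δ - 2 + 1 + 1) (Vp 2 (pd j (pd i (gauss μ))) g) (C * K) := fun j =>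
    ((hG.pd i).pd j).hb_Vp ha hT hl hl1 hδ (hG.pd_pd_adm ha i j) (by linarith)
  choose D hD HD using h2
  have hD0 : 0 ≤ ∑ j, D j := Finset.sum_nonneg fun j _ => hD j
  refine ⟨C + ∑ j, D j, by positivity, fun g K hg => ?_⟩
  have hK := hg.nonneg
  have e1 := spd_volPot_eq hT hl hl1 hδ hμ hg i
  refine Cls.congr (u := Vp 1 (pd i (gauss μ)) (clamp T g)) ⟨?_, fun _ t _ => ?_, fun j _ => ?_,
    fun h => absurd h (by norm_num), fun h => absurd h (by norm_num)⟩ e1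
  · exact (H _ _ (hg.src hT hl)).mono le_rfl (mul_le_mul_of_nonneg_right (by linarith) hK)
  · exact (hG.pd i).differentiable_Vp ha hl hl1.le hδ le_rfl (hg.src hT hl) t
  · rw [(hG.pd i).spd_Vp ha hl hl1.le hδ le_rfl (hg.src hT hl)]
    refine ⟨(HD j _ _ (hg.src hT hl)).mono le_rfl (mul_le_mul_of_nonneg_right ?_ hK),
      fun h => absurd h (by norm_num), fun _ h => absurd h (by norm_num),
      fun h => absurd h (by norm_num), fun h => absurd h (by norm_num)⟩
    have := Finset.single_le_sum (f := D) (fun j _ => hD j) (Finset.mem_univ j)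
    linarith

/-- Bounds for the space derivatives of the heat potential give bounds for the potential. -/
lemma volPot_cls_of_spd (T : ℝ) (hT : 0 < T) (hl : 0 < lam) (hl1 : lam < 1) (hμ : 0 < μ)
    (N s : ℕ) (hδ : 0 ≤ δ)
    (hx : ∀ i, ∃ C, 0 ≤ C ∧ ∀ (g : ℝ → Spc n → ℝ) K, Cls T lam N s δ g K →
      Cls T lam (N + 2 - 1) (s + 1) (δ - 2 + 1) (spd i (volPot μ g)) (C * K)) :
    ∃ C, 0 ≤ C ∧ ∀ (g : ℝ → Spc n → ℝ) K, Cls T lam N s δ g K →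
      Cls T lam (N + 2) (s + 1) (δ - 2) (volPot μ g) (C * K) := by
  choose D hD HD using hx
  obtain ⟨C, hC, H⟩ := volPot_hb (n := n) T hT hl hl1 hδ hμ
  have hD0 : 0 ≤ ∑ j, D j := Finset.sum_nonneg fun j _ => hD j
  refine ⟨C + (1 + |μ|) * ∑ j, D j + 1, by positivity, fun g K hg => ?_⟩
  have hK := hg.nonneg
  have hμD : 0 ≤ |μ| * ∑ j, D j := by positivity
  refine ⟨(H g K hg.hb).mono le_rfl (mul_le_mul_of_nonneg_right (by linarith) hK),
    fun _ => volPot_differentiable hT hl hl1 hδ hμ hg.hb, fun i _ => ?_,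
    fun _ _ x t ht =>
      (hasDerivWithinAt_volPot hT hl hl1 hδ hμ hg.hb x ht).differentiableWithinAt,
    fun _ _ => ?_⟩
  · refine (HD i g K hg).mono le_rfl le_rfl le_rfl (mul_le_mul_of_nonneg_right ?_ hK)
    have := Finset.single_le_sum (f := D) (fun j _ => hD j) (Finset.mem_univ i)
    linarith
  · have h1 : Cls T lam N s (δ - 2 + 1 + 1)
        (fun t x => ∑ i, spd i (spd i (volPot μ g)) t x) (∑ i, D i * K) := by
      refine Cls.sum _ fun i _ => ((HD i g K hg).hx (by omega) i).mono ?_ ?_ le_rfl le_rfl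
      · omega
      · omega
    have h2 := (hg.mono le_rfl le_rfl (by linarith : δ - 2 ≤ δ) le_rfl).add
      ((h1.smul μ).mono le_rfl le_rfl (by linarith : δ - 2 ≤ δ - 2 + 1 + 1) le_rfl)
    refine (h2.congr fun t ht x => ?_).mono (by omega) (by omega) le_rfl ?_
    · exact ((hasDerivWithinAt_volPot hT hl hl1 hδ hμ hg.hb x ht).derivWithin
        (uniqueDiffOn_Icc hT t ht)).symm
    · rw [← Finset.sum_mul]
      have := mul_nonneg hC hK
      have := mul_nonneg hD0 hK
      nlinarith

/-- The heat potential gains two orders of smoothness at the cost of two orders of decay. -/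
lemma volPot_cls (T : ℝ) (hT : 0 < T) (hl : 0 < lam) (hl1 : lam < 1) (hμ : 0 < μ) (N s : ℕ)
    (hδ : 0 ≤ δ) : ∃ C, 0 ≤ C ∧ ∀ (g : ℝ → Spc n → ℝ) K, Cls T lam N s δ g K →
      Cls T lam (N + 2) (s + 1) (δ - 2) (volPot μ g) (C * K) := by
  induction N generalizing δ with
  | zero =>
    refine volPot_cls_of_spd T hT hl hl1 hμ 0 s hδ fun i => ?_
    obtain ⟨C, hC, H⟩ := spd_volPot_cls_one T hT hl hl1 hδ hμ (s + 1) i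
    exact ⟨C, hC, fun g K hg => H g K hg.hb⟩
  | succ N ih =>
    refine volPot_cls_of_spd T hT hl hl1 hμ (N + 1) s hδ fun i => ?_
    obtain ⟨C, hC, H⟩ := ih (δ := δ + 1) (by linarith)
    refine ⟨C, hC, fun g K hg => ?_⟩
    have h1 := H _ _ (hg.hx (by omega) i)
    rw [show δ + 1 - 2 = δ - 2 + 1 by ring] at h1
    exact h1.congr (spd_volPot hT hl hl1 hδ hμ hg.hb (hg.hdx (by omega)) i
      (hg.hx (by omega) i).hb)

end

section

/-! ### The nonlinearity -/

variable {lam δ K K' T μ : ℝ} {N s q : ℕ} {f g : ℝ → Spc n → ℝ}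

lemma volPot_congr (h : ∀ t ∈ Set.Icc (0 : ℝ) T, ∀ x, f t x = g t x) :
    ∀ t ∈ Set.Icc (0 : ℝ) T, ∀ x, volPot μ f t x = volPot μ g t x := fun t ht x => by
  refine setIntegral_congr_fun measurableSet_Ioc fun τ hτ => ?_
  simp only [h τ ⟨hτ.1.le, hτ.2.trans ht.2⟩]

lemma HB.bc_clamp (hT : 0 < T) (hl : 0 < lam) (hδ : 0 ≤ δ) (hf : HB T lam δ f K) (τ : ℝ) :
    BC (clamp T f τ) K := ((hf.src hT hl).slice τ).bc hδ

lemma volPot_add (hT : 0 < T) (hl : 0 < lam) (hl1 : lam < 1) (hδ : 0 ≤ δ) (hμ : 0 < μ)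
    (hf : HB T lam δ f K) (hg : HB T lam δ g K') :
    ∀ t ∈ Set.Icc (0 : ℝ) T, ∀ x, volPot μ (f + g) t x = volPot μ f t x + volPot μ g t x := by
  intro t ht x
  have ha : 0 < (4 * μ)⁻¹ := by positivity
  have hG := Kf.gauss (n := n) μ
  have hadm : Adm 0 (gauss (n := n) μ) lam δ δ := Or.inl ⟨zero_le_one, rfl⟩
  rw [← volPot_eq_clamp hμ (f + g) t ht x, ← volPot_eq_clamp hμ f t ht x,
    ← volPot_eq_clamp hμ g t ht x]
  have i1 := hG.integrableOn_Bk ha hl hl1.le hδ hadm (hf.src hT hl) (c := 0) le_rfl x (t := t)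
  have i2 := hG.integrableOn_Bk ha hl hl1.le hδ hadm (hg.src hT hl) (c := 0) le_rfl x (t := t)
  rw [Vp, Vp, Vp, ← integral_add i1 i2]
  refine integral_congr_ae (Eventually.of_forall fun τ => ?_)
  simp only [Bk, pow_zero, one_mul, Top]
  rw [← integral_add (hG.integrable_top ha (hf.bc_clamp hT hl hδ τ) _ x)
    (hG.integrable_top ha (hg.bc_clamp hT hl hδ τ) _ x)]
  refine integral_congr_ae (Eventually.of_forall fun z => ?_)
  simp only [clamp, Pi.add_apply, mul_add]

lemma Cls.signed_dite {P : Prop} [Decidable P] (c : P → ℕ) (w : P → ℝ → Spc n → ℝ) (hK : 0 ≤ K)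
    (h : ∀ hP, Cls T lam N s δ (w hP) K) :
    Cls T lam N s δ (fun t x => if hP : P then (-1 : ℝ) ^ c hP * w hP t x else 0) K := by
  by_cases hP : P
  · simp only [hP, dite_true]
    have h1 := (h hP).smul ((-1) ^ c hP)
    rwa [abs_pow, abs_neg, abs_one, one_pow, one_mul] at h1
  · simp only [hP, dite_false]
    exact Cls.zero.mono le_rfl le_rfl le_rfl hK

lemma Cls.sum_fin {w : Fin n → ℝ → Spc n → ℝ} (h : ∀ i, Cls T lam N s δ (w i) K) :
    Cls T lam N s δ (fun t x => ∑ i, w i t x) (n * K) := by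
  have h1 := Cls.sum (k := fun _ => K) Finset.univ fun i _ => h i
  rwa [Finset.sum_const, Finset.card_univ, Fintype.card_fin, nsmul_eq_mul] at h1

lemma Cls.dT {u : FormT n q} (hK : 0 ≤ K) (hu : ∀ I, Cls T lam (N + 1) s δ (u I) K)
    (J : Idx n (q + 1)) : Cls T lam N s (δ + 1) (NSdeRham.dT u J) (n * K) :=
  Cls.sum_fin fun i => Cls.signed_dite (fun _ => (J.1.filter fun j => j < i).card)
    (fun h => spd i (u ⟨J.1.erase i, by simp [Finset.card_erase_of_mem h, J.2]⟩)) hK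
    fun _ => (hu _).hx (by omega) _

lemma Cls.dLowT {u : FormT n (q - 1)} (hK : 0 ≤ K) (hu : ∀ I, Cls T lam (N + 1) s δ (u I) K)
    (J : Idx n q) : Cls T lam N s (δ + 1) (NSdeRham.dLowT u J) (n * K) :=
  Cls.sum_fin fun i => Cls.signed_dite (P := i ∈ J.1 ∧ (J.1.erase i).card = q - 1)
    (fun _ => (J.1.filter fun j => j < i).card) (fun h => spd i (u ⟨J.1.erase i, h.2⟩)) hK
    fun _ => (hu _).hx (by omega) _

lemma Cls.coDT {u : FormT n q} (hK : 0 ≤ K) (hu : ∀ I, Cls T lam (N + 1) s δ (u I) K)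
    (J : Idx n (q - 1)) : Cls T lam N s (δ + 1) (NSdeRham.coDT u J) (n * K) := by
  have h1 : Cls T lam N s (δ + 1) (fun t x => ∑ i : Fin n,
      if h : i ∉ J.1 ∧ (insert i J.1).card = q then
        (-1 : ℝ) ^ (J.1.filter fun j => j < i).card * spd i (u ⟨insert i J.1, h.2⟩) t x
      else 0) (n * K) :=
    Cls.sum_fin fun i => Cls.signed_dite (P := i ∉ J.1 ∧ (insert i J.1).card = q)
      (fun _ => (J.1.filter fun j => j < i).card) (fun h => spd i (u ⟨insert i J.1, h.2⟩)) hK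
      fun _ => (hu _).hx (by omega) _
  have h2 := h1.smul (-1)
  rw [abs_neg, abs_one, one_mul] at h2
  refine h2.congr fun t _ x => ?_
  simp only [neg_one_mul]
  rfl

/-- Constant coefficient bilinear expressions. -/
lemma Cls.bilin {ι κ : Type*} [Fintype ι] [Fintype κ] (T lam : ℝ) (N s : ℕ) (δ δ' : ℝ)
    (B : (ι → ℝ) →ₗ[ℝ] (κ → ℝ) →ₗ[ℝ] ℝ) :
    ∃ C, 0 ≤ C ∧ ∀ (a : ι → ℝ → Spc n → ℝ) (b : κ → ℝ → Spc n → ℝ) (K K' : ℝ), 0 ≤ K → 0 ≤ K' →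
      (∀ i, Cls T lam N s δ (a i) K) → (∀ j, Cls T lam N s δ' (b j) K') →
      Cls T lam N s (δ + δ') (fun t x => B (fun i => a i t x) fun j => b j t x)
        (C * (K * K')) := by
  obtain ⟨C, hC, H⟩ := Cls.mul (n := n) T lam N s δ δ'
  refine ⟨∑ i, ∑ j, |B (Pi.single i 1) (Pi.single j 1)| * C,
    Finset.sum_nonneg fun i _ => Finset.sum_nonneg fun j _ => by positivity,
    fun a b K K' _ _ ha hb => ?_⟩
  have h1 := Cls.sum (T := T) Finset.univ fun i _ => Cls.sum (T := T) Finset.univ fun j _ =>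
    (H (a i) (b j) K K' (ha i) (hb j)).smul (B (Pi.single i 1) (Pi.single j 1))
  simp only [Finset.sum_mul, mul_assoc]
  refine h1.congr fun t _ x => ?_
  rw [LinearMap.pi_apply_eq_sum_univ B, LinearMap.sum_apply]
  refine Finset.sum_congr rfl fun i _ => ?_
  rw [LinearMap.smul_apply, LinearMap.pi_apply_eq_sum_univ (B _), smul_eq_mul, Finset.mul_sum]
  refine Finset.sum_congr rfl fun j _ => ?_
  have e1 : (Pi.single i 1 : ι → ℝ) = fun j => if i = j then 1 else 0 := by
    funext k
    simp [Pi.single_apply, eq_comm]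
  have e2 : (Pi.single j 1 : κ → ℝ) = fun k => if j = k then 1 else 0 := by
    funext k
    simp [Pi.single_apply, eq_comm]
  rw [e1, e2, smul_eq_mul]
  ring

/-- The bilinear map `M₁((d⊕d^*)a, b) + d_{q-1} M₂(a,b)`. -/
def Qop (M₁ : M1Type n q) (M₂ : M2Type n q) (a b : FormT n q) : FormT n q := fun I t x =>
  M₁ (ddFib a t x) (fib b t x) I + dLowT (fun K t' x' => M₂ (fib a t' x') (fib b t' x') K) I t x

lemma M2_cls (T lam : ℝ) (N s : ℕ) (δ : ℝ) (M₂ : M2Type n q) (J : Idx n (q - 1)) :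
    ∃ C, 0 ≤ C ∧ ∀ (a b : FormT n q) (K K' : ℝ), 0 ≤ K → 0 ≤ K' →
      (∀ I, Cls T lam N s δ (a I) K) → (∀ I, Cls T lam N s δ (b I) K') →
      Cls T lam N s (2 * δ) (fun t x => M₂ (fib a t x) (fib b t x) J) (C * (K * K')) := by
  rw [two_mul]
  exact Cls.bilin T lam N s δ δ (M₂.compr₂ (LinearMap.proj J))

lemma M1_cls (T lam : ℝ) (N s : ℕ) (δ : ℝ) (M₁ : M1Type n q) (I : Idx n q) :
    ∃ C, 0 ≤ C ∧ ∀ (a b : FormT n q) (K K' : ℝ), 0 ≤ K → 0 ≤ K' →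
      (∀ I, Cls T lam (N + 1) s δ (a I) K) → (∀ I, Cls T lam N s δ (b I) K') →
      Cls T lam N s (2 * δ + 1) (fun t x => M₁ (ddFib a t x) (fib b t x) I) (C * (K * K')) := by
  obtain ⟨C, hC, H⟩ := Cls.bilin (n := n) T lam N s (δ + 1) δ
    ((M₁.comp (LinearMap.inl ℝ _ _)).compr₂ (LinearMap.proj I))
  obtain ⟨D, hD, H'⟩ := Cls.bilin (n := n) T lam N s (δ + 1) δ
    ((M₁.comp (LinearMap.inr ℝ _ _)).compr₂ (LinearMap.proj I))
  refine ⟨(C + D) * n, by positivity, fun a b K K' hK hK' ha hb => ?_⟩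
  have h1 := (H (dT a) b (n * K) K' (by positivity) hK' (Cls.dT hK ha) hb).add
    (H' (coDT a) b (n * K) K' (by positivity) hK' (Cls.coDT hK ha) hb)
  rw [show δ + 1 + δ = 2 * δ + 1 by ring] at h1
  refine (h1.congr fun t _ x => ?_).mono le_rfl le_rfl le_rfl (le_of_eq (by ring))
  have h2 : ddFib a t x = ((fun J => dT a J t x : Fib n (q + 1)), (0 : Fib n (q - 1))) +
      ((0 : Fib n (q + 1)), (fun J => coDT a J t x : Fib n (q - 1))) := by
    rw [Prod.mk_add_mk, add_zero, zero_add]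
    rfl
  rw [h2, map_add]
  rfl

lemma Qop_cls (T lam : ℝ) (N s : ℕ) (δ : ℝ) (M₁ : M1Type n q) (M₂ : M2Type n q) (I : Idx n q) :
    ∃ C, 0 ≤ C ∧ ∀ (a b : FormT n q) (K K' : ℝ), 0 ≤ K → 0 ≤ K' →
      (∀ I, Cls T lam (N + 1) s δ (a I) K) → (∀ I, Cls T lam (N + 1) s δ (b I) K') →
      Cls T lam N s (2 * δ + 1) (Qop M₁ M₂ a b I) (C * (K * K')) := by
  obtain ⟨C, hC, H⟩ := M1_cls T lam N s δ M₁ I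
  choose D hD HD using fun J => M2_cls T lam (N + 1) s δ M₂ J
  have hD0 : 0 ≤ ∑ J, D J := Finset.sum_nonneg fun J _ => hD J
  refine ⟨C + n * ∑ J, D J, by positivity, fun a b K K' hK hK' ha hb => ?_⟩
  have hKK := mul_nonneg hK hK'
  have h1 := H a b K K' hK hK' ha fun J => (hb J).mono (by omega) le_rfl le_rfl le_rfl
  have h2 := Cls.dLowT (T := T) (K := (∑ J, D J) * (K * K')) (N := N) (by positivity)
    (fun J => (HD J a b K K' hK hK' ha hb).mono le_rfl le_rfl le_rfl
      (mul_le_mul_of_nonneg_right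
        (Finset.single_le_sum (f := D) (fun j _ => hD j) (Finset.mem_univ J)) hKK)) I
  exact (h1.add h2).mono le_rfl le_rfl le_rfl (le_of_eq (by ring))

lemma pd_add {φ ψ : Spc n → ℝ} (hφ : Differentiable ℝ φ) (hψ : Differentiable ℝ ψ) (i : Fin n)
    (x : Spc n) : pd i (φ + ψ) x = pd i φ x + pd i ψ x := by
  rw [pd, fderiv_add (hφ x) (hψ x)]
  rfl

lemma dT_add {a b : FormT n q} {t : ℝ} (ha : ∀ I, Differentiable ℝ (a I t))
    (hb : ∀ I, Differentiable ℝ (b I t)) (J : Idx n (q + 1)) (x : Spc n) :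
    dT (a + b) J t x = dT a J t x + dT b J t x := by
  simp only [dT, dS]
  rw [← Finset.sum_add_distrib]
  refine Finset.sum_congr rfl fun i _ => ?_
  split_ifs with h
  · rw [← mul_add, ← pd_add (ha _) (hb _)]
    rfl
  · simp

lemma dLowT_add {a b : FormT n (q - 1)} {t : ℝ} (ha : ∀ I, Differentiable ℝ (a I t))
    (hb : ∀ I, Differentiable ℝ (b I t)) (J : Idx n q) (x : Spc n) :
    dLowT (a + b) J t x = dLowT a J t x + dLowT b J t x := by
  simp only [dLowT, dLowS]
  rw [← Finset.sum_add_distrib]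
  refine Finset.sum_congr rfl fun i _ => ?_
  split_ifs with h
  · rw [← mul_add, ← pd_add (ha _) (hb _)]
    rfl
  · simp

lemma coDT_add {a b : FormT n q} {t : ℝ} (ha : ∀ I, Differentiable ℝ (a I t))
    (hb : ∀ I, Differentiable ℝ (b I t)) (J : Idx n (q - 1)) (x : Spc n) :
    coDT (a + b) J t x = coDT a J t x + coDT b J t x := by
  simp only [coDT, coDS]
  rw [← neg_add, ← Finset.sum_add_distrib]
  refine congrArg _ (Finset.sum_congr rfl fun i _ => ?_)
  split_ifs with h
  · rw [← mul_add, ← pd_add (ha _) (hb _)]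
    rfl
  · simp

lemma ddFib_add {a b : FormT n q} {t : ℝ} (ha : ∀ I, Differentiable ℝ (a I t))
    (hb : ∀ I, Differentiable ℝ (b I t)) (x : Spc n) :
    ddFib (a + b) t x = ddFib a t x + ddFib b t x :=
  Prod.ext (funext fun J => dT_add ha hb J x) (funext fun J => coDT_add ha hb J x)

lemma differentiable_M2 (M₂ : M2Type n q) {a b : FormT n q} {t : ℝ}
    (ha : ∀ I, Differentiable ℝ (a I t)) (hb : ∀ I, Differentiable ℝ (b I t))
    (J : Idx n (q - 1)) : Differentiable ℝ fun x => M₂ (fib a t x) (fib b t x) J := by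
  have h1 : ∀ {r : ℕ} (c : FormT n r), (∀ I, Differentiable ℝ (c I t)) →
      Differentiable ℝ (fib c t) := fun c hc => differentiable_pi.2 hc
  let B := LinearMap.toContinuousBilinearMap (M₂.compr₂ (LinearMap.proj J))
  exact B.isBoundedBilinearMap.differentiable.comp ((h1 a ha).prodMk (h1 b hb))

/-- Expansion of the quadratic nonlinearity. -/
lemma Nop_add (M₁ : M1Type n q) (M₂ : M2Type n q) {a b : FormT n q} {t : ℝ}
    (ha : ∀ I, Differentiable ℝ (a I t)) (hb : ∀ I, Differentiable ℝ (b I t)) (I : Idx n q)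
    (x : Spc n) :
    Nop M₁ M₂ (a + b) I t x = Nop M₁ M₂ a I t x +
      (Qop M₁ M₂ a b I t x + Qop M₁ M₂ b a I t x + Qop M₁ M₂ b b I t x) := by
  let P : FormT n q → FormT n q → FormT n (q - 1) :=
    fun c d J t x => M₂ (fib c t x) (fib d t x) J
  have hf : ∀ t x, fib (a + b) t x = fib a t x + fib b t x := fun t x => rfl
  have hP : P (a + b) (a + b) = P a a + P a b + P b a + P b b := by
    funext J t x
    simp only [P, hf, map_add, Pi.add_apply, LinearMap.add_apply]
    ring
  have haa : ∀ J, Differentiable ℝ (P a a J t) := differentiable_M2 M₂ ha ha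
  have hab : ∀ J, Differentiable ℝ (P a b J t) := differentiable_M2 M₂ ha hb
  have hba : ∀ J, Differentiable ℝ (P b a J t) := differentiable_M2 M₂ hb ha
  have hbb : ∀ J, Differentiable ℝ (P b b J t) := differentiable_M2 M₂ hb hb
  have h2 : dLowT (P (a + b) (a + b)) I t x = dLowT (P a a) I t x + dLowT (P a b) I t x +
      dLowT (P b a) I t x + dLowT (P b b) I t x := by
    rw [hP, dLowT_add (fun J => ((haa J).add (hab J)).add (hba J)) hbb,
      dLowT_add (fun J => (haa J).add (hab J)) hba, dLowT_add haa hab]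
  have h3 : Nop M₁ M₂ (a + b) I t x =
      M₁ (ddFib (a + b) t x) (fib (a + b) t x) I + dLowT (P (a + b) (a + b)) I t x := rfl
  have h4 : Nop M₁ M₂ a I t x = M₁ (ddFib a t x) (fib a t x) I + dLowT (P a a) I t x := rfl
  have h5 : ∀ c d, Qop M₁ M₂ c d I t x =
      M₁ (ddFib c t x) (fib d t x) I + dLowT (P c d) I t x := fun c d => rfl
  rw [h3, h4, h5, h5, h5, h2, hf, ddFib_add ha hb]
  simp only [map_add, Pi.add_apply, LinearMap.add_apply]
  ring

lemma eAnisoKS_le_F {k : ℕ} (u : FormT n q) (I : Idx n q) :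
    eAnisoKS T k s lam δ (u I) ≤ eAnisoKSF T k s lam δ u :=
  Finset.single_le_sum (f := fun I => eAnisoKS T k s lam δ (u I)) (fun _ _ => zero_le)
    (Finset.mem_univ I)

/-- The bilinear estimate underlying the local Lipschitz property. -/
lemma volPotF_Nop_sub_cls (T : ℝ) (hT : 0 < T) (hl : 0 < lam) (hl1 : lam < 1) (hδ : 0 ≤ δ)
    (hμ : 0 < μ) (N s : ℕ) (M₁ : M1Type n q) (M₂ : M2Type n q) (I : Idx n q) :
    ∃ C, 0 ≤ C ∧ ∀ (a b : FormT n q) (K K' : ℝ), 0 ≤ K → 0 ≤ K' →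
      (∀ I, Cls T lam (N + 1) s δ (a I) K) → (∀ I, Cls T lam (N + 1) s δ (b I) K') →
      Cls T lam (N + 2) (s + 1) (2 * δ - 1)
        (volPot μ (Nop M₁ M₂ (a + b) I) - volPot μ (Nop M₁ M₂ a I))
        (C * (2 * (K * K') + K' * K')) := by
  obtain ⟨C, hC, H⟩ := Qop_cls T lam N s δ M₁ M₂ I
  have hδ' : 0 ≤ 2 * δ + 1 := by linarith
  obtain ⟨D, hD, H'⟩ := volPot_cls (n := n) T hT hl hl1 hμ N s hδ'
  refine ⟨D * C, by positivity, fun a b K K' hK hK' ha hb => ?_⟩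
  have hQ := ((H a b K K' hK hK' ha hb).add (H b a K' K hK' hK hb ha)).add
    (H b b K' K' hK' hK' hb hb)
  have hda : ∀ t ∈ Set.Icc (0 : ℝ) T, ∀ I, Differentiable ℝ (a I t) :=
    fun t ht I => (ha I).hdx (by omega) t ht
  have hdb : ∀ t ∈ Set.Icc (0 : ℝ) T, ∀ I, Differentiable ℝ (b I t) :=
    fun t ht I => (hb I).hdx (by omega) t ht
  have h1 := H' _ _ hQ
  rw [show 2 * δ + 1 - 2 = 2 * δ - 1 by ring] at h1
  refine (h1.congr fun t ht x => ?_).mono le_rfl le_rfl le_rfl (le_of_eq (by ring))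
  have h2 := volPot_add (μ := μ) hT hl hl1 hδ' hμ (H a a K K hK hK ha ha).hb hQ.hb t ht x
  have h3 : volPot μ (Nop M₁ M₂ (a + b) I) t x = _ :=
    volPot_congr (fun t ht x => Nop_add M₁ M₂ (hda t ht) (hdb t ht) I x) t ht x
  have h4 : volPot μ (Nop M₁ M₂ (a + b) I) t x = volPot μ (Nop M₁ M₂ a I) t x +
      volPot μ (Qop M₁ M₂ a b I + Qop M₁ M₂ b a I + Qop M₁ M₂ b b I) t x := h3.trans h2
  rw [Pi.sub_apply, Pi.sub_apply, h4]
  ring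

end

/-- the local Lipschitz estimate for `Ψ_{μ,q}𝒩_q` from
`C^{k,𝐬(s,λ,δ)}_{T,Λ^q,𝒟_{d⊕d*}}` into `C^{k-1,𝐬(s+1,λ,2δ-1)}_{T,Λ^q}`. -/
theorem stmt19 (n q s k : ℕ) (hn : 2 ≤ n) (hq : q ≤ n) (hs : 1 ≤ s) (hk : 1 ≤ k)
    (lam δ μ T : ℝ) (h1 : 0 < lam) (h2 : lam < 1) (hδ : 0 < δ) (hμ : 0 < μ) (hT : 0 < T)
    (M₁ : M1Type n q) (M₂ : M2Type n q) :
    ∃ C₁ C₂ : ℝ, 0 < C₁ ∧ 0 < C₂ ∧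
      ∀ u' u'' : FormT n q, CMemD T k s lam δ u' → CMemD T k s lam δ u'' →
        CMemF T (k - 1) (s + 1) lam (2 * δ - 1)
          (volPotF μ (Nop M₁ M₂ u') - volPotF μ (Nop M₁ M₂ u'')) ∧
        eAnisoKSF T (k - 1) (s + 1) lam (2 * δ - 1)
            (volPotF μ (Nop M₁ M₂ u') - volPotF μ (Nop M₁ M₂ u'')) ≤
          ENNReal.ofReal C₁ * eCD T k s lam δ u'' *
              eAnisoKSF T k s lam δ (u' - u'') +
            ENNReal.ofReal C₂ * (eAnisoKSF T k s lam δ (u' - u'')) ^ 2 := by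
  obtain ⟨k, rfl⟩ : ∃ j, k = j + 1 := ⟨k - 1, by omega⟩
  simp only [Nat.add_sub_cancel]
  obtain ⟨E, hE, HE⟩ := cls_of_aniso (n := n) T lam δ hT h1 h2.le (k + 1) s
  obtain ⟨F, hF, HF⟩ := Cls.eAnisoKS_le (n := n) T lam (2 * δ - 1) h1 k (s + 1)
  obtain ⟨F', hF', HF'⟩ := Cls.eAnisoKS_le (n := n) T lam δ h1 (k + 1) s
  choose D hD HD using fun I =>
    volPotF_Nop_sub_cls (n := n) T hT h1 h2 hδ.le hμ (2 * s + k) s M₁ M₂ I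
  have hA : 0 ≤ F * (∑ I, D I) * E ^ 2 := by
    have := Finset.sum_nonneg fun I (_ : I ∈ Finset.univ) => hD I
    positivity
  refine ⟨2 * (F * (∑ I, D I) * E ^ 2) + 1, F * (∑ I, D I) * E ^ 2 + 1, by positivity,
    by positivity, fun u' u'' hu' hu'' => ?_⟩
  have hcls : ∀ u : FormT n q, (∀ I, AnisoReg T (k + 1) s (u I)) →
      eAnisoKSF T (k + 1) s lam δ u ≠ ⊤ →
      ∀ I, Cls T lam (2 * s + (k + 1)) s δ (u I)
        (E * (eAnisoKSF T (k + 1) s lam δ u).toReal) := fun u hr ht I =>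
    HE _ _ ENNReal.toReal_nonneg (hr I) ((eAnisoKS_le_F u I).trans (ENNReal.ofReal_toReal ht).ge)
  have c' := hcls u' hu'.1.1 hu'.1.2
  have c'' := hcls u'' hu''.1.1 hu''.1.2
  have hv : eAnisoKSF T (k + 1) s lam δ (u' - u'') ≠ ⊤ :=
    ENNReal.sum_ne_top.2 fun I _ =>
      ne_top_of_le_ne_top ENNReal.ofReal_ne_top (HF' _ _ ((c' I).sub (c'' I)))
  have cv := hcls (u' - u'') (fun I => ((c' I).sub (c'' I)).anisoReg hT h1) hv
  set X := (eAnisoKSF T (k + 1) s lam δ u'').toReal with hX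
  set Y := (eAnisoKSF T (k + 1) s lam δ (u' - u'')).toReal with hY
  have hX0 : 0 ≤ X := ENNReal.toReal_nonneg
  have hY0 : 0 ≤ Y := ENNReal.toReal_nonneg
  clear_value X Y
  have hEX : 0 ≤ E * X := mul_nonneg hE hX0
  have hEY : 0 ≤ E * Y := mul_nonneg hE hY0
  have hW : ∀ I, Cls T lam (2 * (s + 1) + k) (s + 1) (2 * δ - 1)
      ((volPotF μ (Nop M₁ M₂ u') - volPotF μ (Nop M₁ M₂ u'')) I)
      (D I * (2 * (E * X * (E * Y)) + E * Y * (E * Y))) := by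
    intro I
    have h := HD I u'' (u' - u'') (E * X) (E * Y) hEX hEY c'' cv
    rw [add_sub_cancel, show 2 * s + k + 2 = 2 * (s + 1) + k by ring] at h
    exact h
  have hle : eAnisoKSF T k (s + 1) lam (2 * δ - 1)
      (volPotF μ (Nop M₁ M₂ u') - volPotF μ (Nop M₁ M₂ u'')) ≤
      ENNReal.ofReal (F * (∑ I, D I) * E ^ 2 * (2 * (X * Y) + Y ^ 2)) := by
    refine (Finset.sum_le_sum fun I _ => HF _ _ (hW I)).trans ?_
    have hnn : ∀ I ∈ Finset.univ,
        0 ≤ F * (D I * (2 * (E * X * (E * Y)) + E * Y * (E * Y))) := fun I _ => by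
      have := hD I
      positivity
    rw [← ENNReal.ofReal_sum_of_nonneg hnn]
    refine ENNReal.ofReal_le_ofReal (le_of_eq ?_)
    rw [← Finset.mul_sum, ← Finset.sum_mul]
    ring
  refine ⟨⟨fun I => (hW I).anisoReg hT h1, ne_top_of_le_ne_top ENNReal.ofReal_ne_top hle⟩,
    hle.trans ?_⟩
  have hXe : ENNReal.ofReal X ≤ eCD T (k + 1) s lam δ u'' := by
    rw [hX, ENNReal.ofReal_toReal hu''.1.2, eCD, add_assoc]
    exact le_self_add
  have hYe : ENNReal.ofReal Y = eAnisoKSF T (k + 1) s lam δ (u' - u'') := by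
    rw [hY, ENNReal.ofReal_toReal hv]
  rw [← hYe]
  generalize F * (∑ I, D I) * E ^ 2 = A at hA ⊢
  calc ENNReal.ofReal (A * (2 * (X * Y) + Y ^ 2))
      ≤ ENNReal.ofReal ((2 * A + 1) * X * Y + (A + 1) * Y ^ 2) := by
        refine ENNReal.ofReal_le_ofReal ?_
        have := mul_nonneg hX0 hY0
        nlinarith [sq_nonneg Y]
    _ = ENNReal.ofReal (2 * A + 1) * ENNReal.ofReal X * ENNReal.ofReal Y +
        ENNReal.ofReal (A + 1) * ENNReal.ofReal Y ^ 2 := by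
        rw [ENNReal.ofReal_add (by positivity) (by positivity),
          ENNReal.ofReal_mul (by positivity), ENNReal.ofReal_mul (by positivity),
          ENNReal.ofReal_mul (by positivity), ENNReal.ofReal_pow hY0]
    _ ≤ _ := by gcongr
end NSdeRham

end
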